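/- arXiv:1407.2294 — 3 statements merged into one kernel-verified Lean document; each statement's English description precedes it below -/
import Mathlib

section
/- Let k be a number field with r_2 pairs of complex embeddings, and let \kappa_k be the residue at s = 1 of the Dedekind zeta function \zeta_k(s). Then, as x \to \infty, the number of quadratic extensions L of k with |\Delta_{L/k}| \le x is asymptotic to (1/2^{r_2}) \cdot (\kappa_k/\zeta_k(2)) \cdot x. -/
open NumberField Filter Topology
open scoped Classical

noncomputable section

variable (k : Type*) [Field k] [NumberField k]

/-- The absolute value of the discriminant of a number field (junk value `0` if the
field is not finite over `ℚ`). -/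
def absDisc (L : Type*) [Field L] [CharZero L] : ℕ :=
  if h : FiniteDimensional ℚ L then
    letI : NumberField L := @NumberField.mk L _ inferInstance h
    (NumberField.discr L).natAbs
  else 0

/-- The absolute norm `|Δ_{L/k}|` of the relative discriminant of `L/k`, computed as
`d_L / d_k²`. -/
def relDiscNorm (L : IntermediateField k (AlgebraicClosure k)) : ℝ :=
  (absDisc L : ℝ) / ((NumberField.discr k).natAbs : ℝ) ^ 2

/-- The number of quadratic extensions of `k` (inside a fixed algebraic closure;
quadratic extensions are Galois, so this is the same as counting them up to
`k`-isomorphism) with `|Δ_{L/k}| ≤ x`. -/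
def quadCount (x : ℝ) : ℕ :=
  Nat.card {L : IntermediateField k (AlgebraicClosure k) //
    Module.finrank k L = 2 ∧ relDiscNorm k L ≤ x}

/-- The Dedekind zeta function of `k` at a real argument `s`, as the sum
`∑_{0 ≠ I ⊆ O_k} N(I)^{-s}` over nonzero ideals of the ring of integers. -/
def dedekindZetaReal (s : ℝ) : ℝ :=
  ∑' I : {I : Ideal (𝓞 k) // I ≠ ⊥}, (Ideal.absNorm I.1 : ℝ) ^ (-s)

set_option linter.unusedSectionVars false

section ConeCount

open NumberField.mixedEmbedding NumberField.mixedEmbedding.fundamentalCone NumberField.Units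
  NumberField.InfinitePlace
open scoped Pointwise

/-- The algebraic integers whose image in the mixed space lies in the fundamental cone for the
action of the units. -/
def coneSet : Set (𝓞 k) := {D | mixedEmbedding k (D : k) ∈ fundamentalCone k}

variable {k} in
/-- The absolute value of the norm to `ℚ`, as a real number. -/
def absNormReal (x : k) : ℝ := |(Algebra.norm ℚ x : ℝ)|

variable {k} in
theorem norm_mixedEmbedding_eq (x : k) :
    mixedEmbedding.norm (mixedEmbedding k x) = absNormReal x := by
  rw [norm_eq_norm, absNormReal]; push_cast; rfl

/-- The embedding of the ring of integers in the Euclidean mixed space. -/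
def euclideanEmbedding : 𝓞 k →+ euclidean.mixedSpace k :=
  ((euclidean.toMixed k).symm.toLinearEquiv.toLinearMap.toAddMonoidHom).comp
    (((mixedEmbedding k).comp (algebraMap (𝓞 k) k)).toAddMonoidHom)

theorem toMixed_euclideanEmbedding (x : 𝓞 k) :
    euclidean.toMixed k (euclideanEmbedding k x) = mixedEmbedding k (x : k) := by
  simp [euclideanEmbedding]

theorem euclideanEmbedding_injective : Function.Injective (euclideanEmbedding k) := by
  intro x y h
  have := congrArg (euclidean.toMixed k) h
  rw [toMixed_euclideanEmbedding, toMixed_euclideanEmbedding] at this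
  exact RingOfIntegers.coe_injective (mixedEmbedding_injective k this)

/-- The image of a group of algebraic integers in the Euclidean mixed space. -/
def subLattice (M : AddSubgroup (𝓞 k)) : Submodule ℤ (euclidean.mixedSpace k) :=
  AddSubgroup.toIntSubmodule (M.map (euclideanEmbedding k))

variable {k} in
theorem mem_subLattice {M : AddSubgroup (𝓞 k)} {x : euclidean.mixedSpace k} :
    x ∈ subLattice k M ↔ ∃ D ∈ M, euclideanEmbedding k D = x :=
  AddSubgroup.mem_map

theorem subLattice_top : subLattice k ⊤ = euclidean.integerLattice k := by
  ext x
  rw [mem_subLattice, euclidean.integerLattice]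
  change _ ↔ (euclidean.toMixed k x) ∈ mixedEmbedding.integerLattice k
  simp only [AddSubgroup.mem_top, true_and, LinearMap.mem_range]
  refine exists_congr fun D => ?_
  rw [← (euclidean.toMixed k).injective.eq_iff, toMixed_euclideanEmbedding]
  rfl

theorem subLattice_le (M : AddSubgroup (𝓞 k)) : subLattice k M ≤ euclidean.integerLattice k := by
  rw [← subLattice_top]
  intro x
  simp only [mem_subLattice]
  rintro ⟨D, -, h⟩
  exact ⟨D, trivial, h⟩

instance (M : AddSubgroup (𝓞 k)) : DiscreteTopology (subLattice k M) :=
  DiscreteTopology.of_subset (s := (euclidean.integerLattice k : Set (euclidean.mixedSpace k)))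
    (inferInstanceAs (DiscreteTopology (euclidean.integerLattice k))) (subLattice_le k M)

instance (M : AddSubgroup (𝓞 k)) [M.FiniteIndex] : IsZLattice ℝ (subLattice k M) where
  span_top := by
    rw [eq_top_iff, ← IsZLattice.span_top (K := ℝ) (L := euclidean.integerLattice k),
      Submodule.span_le, ← subLattice_top]
    intro x hx
    obtain ⟨D, -, rfl⟩ := mem_subLattice.mp hx
    have h0 : (M.index : ℝ) ≠ 0 := Nat.cast_ne_zero.mpr AddSubgroup.FiniteIndex.index_ne_zero
    have : euclideanEmbedding k D =
        (M.index : ℝ)⁻¹ • euclideanEmbedding k (M.index • D) := by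
      rw [map_nsmul, ← Nat.cast_smul_eq_nsmul ℝ, inv_smul_smul₀ h0]
    rw [this]
    refine Submodule.smul_mem _ _ (Submodule.subset_span ?_)
    exact mem_subLattice.mpr ⟨_, M.nsmul_index_mem D, rfl⟩

theorem covolume_subLattice (M : AddSubgroup (𝓞 k)) [M.FiniteIndex] :
    ZLattice.covolume (subLattice k M) =
      M.index * ((2⁻¹) ^ nrComplexPlaces k * √|discr k|) := by
  have h := ZLattice.covolume_div_covolume_eq_relIndex' _ _ (subLattice_le k M)
  have h1 : (subLattice k M).toAddSubgroup.relIndex (euclidean.integerLattice k).toAddSubgroup =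
      M.index := by
    rw [← subLattice_top]
    change (M.map (euclideanEmbedding k)).relIndex
      ((⊤ : AddSubgroup (𝓞 k)).map (euclideanEmbedding k)) = _
    rw [AddSubgroup.relIndex_map_map_of_injective _ _ (euclideanEmbedding_injective k),
      AddSubgroup.relIndex_top_right]
  have h2 : ZLattice.covolume (euclidean.integerLattice k) =
      (2⁻¹) ^ nrComplexPlaces k * √|discr k| := by
    rw [← covolume_integerLattice, euclidean.integerLattice]
    exact ZLattice.covolume_comap _ _ _ (euclidean.volumePreserving_toMixed k)
  rw [h1, div_eq_iff (ZLattice.covolume_ne_zero _ _), h2] at h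
  exact h

/-- The points of the subset `S` of `𝓞 k` in the cone, of norm at most `T`. -/
def conePoints (S : Set (𝓞 k)) (T : ℝ) : Set (𝓞 k) :=
  {D | D ∈ S ∧ D ∈ coneSet k ∧ absNormReal (D : k) ≤ T}

theorem image_conePoints (M : AddSubgroup (𝓞 k)) (T : ℝ) :
    euclideanEmbedding k '' (conePoints k M T) =
    ({x ∈ euclidean.toMixed k ⁻¹' fundamentalCone k |
      mixedEmbedding.norm (euclidean.toMixed k x) ≤ T} ∩ (subLattice k M) : Set _) := by
  ext x
  simp only [Set.mem_image, Set.mem_inter_iff, SetLike.mem_coe, mem_subLattice, conePoints,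
    Set.mem_ofPred_eq, coneSet]
  constructor
  · rintro ⟨D, ⟨h1, h2, h3⟩, rfl⟩
    refine ⟨⟨?_, ?_⟩, D, h1, rfl⟩
    · rwa [Set.mem_preimage, toMixed_euclideanEmbedding]
    · rwa [toMixed_euclideanEmbedding, norm_mixedEmbedding_eq]
  · rintro ⟨⟨h1, h2⟩, D, h3, rfl⟩
    rw [Set.mem_preimage, toMixed_euclideanEmbedding] at h1
    rw [toMixed_euclideanEmbedding, norm_mixedEmbedding_eq] at h2
    exact ⟨D, ⟨h3, h1, h2⟩, rfl⟩

theorem tendsto_conePoints (M : AddSubgroup (𝓞 k)) [M.FiniteIndex] :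
    Tendsto (fun T : ℝ => ((conePoints k M T).ncard : ℝ) / T) atTop
      (𝓝 (torsionOrder k * dedekindZeta_residue k / classNumber k / M.index)) := by
  have h₁ : ∀ s : ℝ,
    {x | x ∈ euclidean.toMixed k ⁻¹' fundamentalCone k ∧
        mixedEmbedding.norm (euclidean.toMixed k x) ≤ s} =
      euclidean.toMixed k ⁻¹' {x | x ∈ fundamentalCone k ∧ mixedEmbedding.norm x ≤ s} := fun _ ↦ rfl
  have h₂ : {x | x ∈ fundamentalCone k ∧ mixedEmbedding.norm x ≤ 1} = normLeOne k := by ext; simp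
  have key := ZLattice.covolume.tendsto_card_le_div' (subLattice k M)
    (F := fun x ↦ mixedEmbedding.norm (euclidean.toMixed k x))
    (X := (euclidean.toMixed k) ⁻¹' (fundamentalCone k))
    (fun x r h h' ↦ by
      rwa [Set.mem_preimage, map_smul, smul_mem_iff_mem h'.ne'])
    (fun x r h ↦ by
      rw [map_smul, mixedEmbedding.norm_smul, euclidean.finrank, abs_of_nonneg h])
    (by
      rw [h₁, h₂]
      exact (euclidean.toMixed k).antilipschitz.isBounded_preimage (isBounded_normLeOne k))
    (by
      rw [h₁, h₂]
      exact (euclidean.toMixed k).continuous.measurable (measurableSet_normLeOne k))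
    (by
      rw [h₁, ← (euclidean.toMixed k).coe_toHomeomorph, ← Homeomorph.preimage_frontier,
      (euclidean.toMixed k).coe_toHomeomorph,
      (euclidean.volumePreserving_toMixed k).measure_preimage
      measurableSet_frontier.nullMeasurableSet, h₂, volume_frontier_normLeOne])
  convert! key using 2 with T
  · rw [← image_conePoints, ← Set.ncard_image_of_injective _ (euclideanEmbedding_injective k)]
    rfl
  · rw [h₁, h₂, MeasureTheory.measureReal_def,
      (euclidean.volumePreserving_toMixed k).measure_preimage
      (measurableSet_normLeOne k).nullMeasurableSet, volume_normLeOne, covolume_subLattice,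
      ENNReal.toReal_mul,
      ENNReal.toReal_mul, ENNReal.toReal_pow, ENNReal.toReal_pow, ENNReal.toReal_ofNat,
      ENNReal.coe_toReal, NNReal.coe_real_pi, ENNReal.toReal_ofReal (regulator_pos k).le,
      dedekindZeta_residue_def]
    have : (classNumber k : ℝ) ≠ 0 := Nat.cast_ne_zero.mpr (classNumber_ne_zero k)
    have : (torsionOrder k : ℝ) ≠ 0 := Nat.cast_ne_zero.mpr (torsionOrder_ne_zero k)
    have : (M.index : ℝ) ≠ 0 := Nat.cast_ne_zero.mpr AddSubgroup.FiniteIndex.index_ne_zero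
    have : √|(discr k : ℝ)| ≠ 0 := by
      rw [Real.sqrt_ne_zero']
      exact abs_pos.mpr (Int.cast_ne_zero.mpr (discr_ne_zero k))
    field_simp
    rw [mul_right_comm, ← mul_pow, mul_right_comm, mul_one_div_cancel two_ne_zero, one_mul,
      mul_comm]

theorem finite_conePoints (S : Set (𝓞 k)) (T : ℝ) : (conePoints k S T).Finite := by
  suffices h : (conePoints k (⊤ : AddSubgroup (𝓞 k)) T).Finite from
    h.subset fun D hD => ⟨trivial, hD.2⟩
  refine Set.Finite.of_finite_image (f := euclideanEmbedding k) ?_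
    (euclideanEmbedding_injective k).injOn
  rw [image_conePoints]
  have hd : DiscreteTopology (subLattice k ⊤).toAddSubgroup :=
    inferInstanceAs (DiscreteTopology (subLattice k ⊤))
  refine Metric.finite_isBounded_inter_isClosed ⟨hd⟩ ?_
    (AddSubgroup.isClosed_of_discrete (H := (subLattice k ⊤).toAddSubgroup))
  set c : ℝ := max T 1
  have hc1 : 1 ≤ c := le_max_right _ _
  have hc0 : 0 < c := by linarith
  have hc : T ≤ c ^ Module.finrank ℚ k :=
    (le_max_left T 1).trans (le_self_pow₀ hc1 Module.finrank_pos.ne')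
  have hb : Bornology.IsBounded (c • (euclidean.toMixed k ⁻¹' normLeOne k)) :=
    ((euclidean.toMixed k).antilipschitz.isBounded_preimage (isBounded_normLeOne k)).smul₀ c
  refine hb.subset fun x hx => ?_
  rw [Set.mem_smul_set_iff_inv_smul_mem₀ hc0.ne', Set.mem_preimage, map_smul]
  refine ⟨(smul_mem_iff_mem (inv_ne_zero hc0.ne')).mpr hx.1, ?_⟩
  rw [Set.mem_ofPred_eq, mixedEmbedding.norm_smul, abs_of_pos (inv_pos.mpr hc0), inv_pow,
    inv_mul_le_iff₀ (pow_pos hc0 _), mul_one]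
  exact hx.2.trans hc

end ConeCount

section Cosets

open NumberField.mixedEmbedding NumberField.mixedEmbedding.fundamentalCone NumberField.Units

variable {k}

theorem absNormReal_neg (x : k) : absNormReal (-x) = absNormReal x := by
  rw [← norm_mixedEmbedding_eq, ← norm_mixedEmbedding_eq, map_neg,
    ← neg_one_smul ℝ, mixedEmbedding.norm_smul]
  simp

theorem neg_mem_coneSet {D : 𝓞 k} : -D ∈ coneSet k ↔ D ∈ coneSet k := by
  have h : mixedEmbedding k ((-D : 𝓞 k) : k) = (-1 : ℝ) • mixedEmbedding k (D : k) := by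
    simp
  rw [coneSet, Set.mem_ofPred_eq, Set.mem_ofPred_eq, h, smul_mem_iff_mem (by norm_num)]

theorem ncard_conePoints_union {S₁ S₂ : Set (𝓞 k)} (h : Disjoint S₁ S₂) (T : ℝ) :
    (conePoints k (S₁ ∪ S₂) T).ncard = (conePoints k S₁ T).ncard + (conePoints k S₂ T).ncard := by
  rw [← Set.ncard_union_eq _ (finite_conePoints k _ _) (finite_conePoints k _ _)]
  · congr 1
    ext D
    simp only [conePoints, Set.mem_ofPred_eq, Set.mem_union]
    tauto
  · exact h.mono (fun _ h => h.1) (fun _ h => h.1)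

theorem ncard_conePoints_neg (S : Set (𝓞 k)) (T : ℝ) :
    (conePoints k {D | -D ∈ S} T).ncard = (conePoints k S T).ncard := by
  refine Set.BijOn.ncard_eq (f := fun D => -D) ⟨?_, neg_injective.injOn, ?_⟩
  · rintro D ⟨h1, h2, h3⟩
    refine ⟨h1, neg_mem_coneSet.mpr h2, ?_⟩
    rwa [RingOfIntegers.coe_eq_algebraMap, map_neg, absNormReal_neg]
  · rintro D ⟨h1, h2, h3⟩
    refine ⟨-D, ⟨by simpa using h1, neg_mem_coneSet.mpr h2, ?_⟩, neg_neg D⟩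
    rwa [RingOfIntegers.coe_eq_algebraMap, map_neg, absNormReal_neg]

/-- The subgroup generated by `M` and `v` when `2 • v ∈ M`. -/
def adjoinHalf (M : AddSubgroup (𝓞 k)) (v : 𝓞 k) (hv : 2 • v ∈ M) : AddSubgroup (𝓞 k) where
  carrier := {D | D ∈ M ∨ D - v ∈ M}
  zero_mem' := Or.inl M.zero_mem
  add_mem' := by
    rintro a b (ha | ha) (hb | hb)
    · exact Or.inl (M.add_mem ha hb)
    · right; convert! M.add_mem ha hb using 1; abel
    · right; convert! M.add_mem ha hb using 1; abel
    · left; convert! M.add_mem (M.add_mem ha hb) hv using 1; abel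
  neg_mem' := by
    rintro a (ha | ha)
    · exact Or.inl (M.neg_mem ha)
    · right; convert! M.neg_mem (M.add_mem ha hv) using 1; abel

theorem mem_adjoinHalf {M : AddSubgroup (𝓞 k)} {v : 𝓞 k} {hv : 2 • v ∈ M} {D : 𝓞 k} :
    D ∈ adjoinHalf M v hv ↔ D ∈ M ∨ D - v ∈ M := Iff.rfl

theorem index_adjoinHalf {M : AddSubgroup (𝓞 k)} {v : 𝓞 k} (hv : 2 • v ∈ M) (hv' : v ∉ M) :
    M.index = 2 * (adjoinHalf M v hv).index := by
  have hle : M ≤ adjoinHalf M v hv := fun x hx => Or.inl hx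
  rw [← AddSubgroup.relIndex_mul_index hle]
  congr 1
  rw [AddSubgroup.relIndex, AddSubgroup.index_eq_two_iff]
  refine ⟨⟨v, Or.inr (by simp)⟩, fun b => ?_⟩
  rw [AddSubgroup.mem_addSubgroupOf, AddSubgroup.mem_addSubgroupOf]
  obtain ⟨b, hb⟩ := b
  change Xor (b + v ∈ M) (b ∈ M)
  by_cases hbM : b ∈ M
  · right
    exact ⟨hbM, fun h => hv' (by simpa using M.sub_mem h hbM)⟩
  · left
    refine ⟨?_, hbM⟩
    have := (mem_adjoinHalf.mp hb).resolve_left hbM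
    convert! M.add_mem this hv using 1; abel

theorem tendsto_conePoints_coset_of_two (M : AddSubgroup (𝓞 k)) [M.FiniteIndex] (v : 𝓞 k)
    (hv : 2 • v ∈ M) :
    Tendsto (fun T : ℝ => ((conePoints k {D | D - v ∈ M} T).ncard : ℝ) / T) atTop
      (𝓝 (torsionOrder k * dedekindZeta_residue k / classNumber k / M.index)) := by
  by_cases hv' : v ∈ M
  · have h : {D | D - v ∈ M} = (M : Set (𝓞 k)) := by
      ext D
      exact ⟨fun h => by simpa using M.add_mem h hv', fun h => M.sub_mem h hv'⟩
    rw [h]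
    exact tendsto_conePoints k M
  have hi := index_adjoinHalf hv hv'
  have : (adjoinHalf M v hv).FiniteIndex :=
    ⟨fun h => AddSubgroup.FiniteIndex.index_ne_zero (H := M) (by rw [hi, h])⟩
  have := (tendsto_conePoints k (adjoinHalf M v hv)).sub (tendsto_conePoints k M)
  convert! this using 1
  · ext T
    have h : ((adjoinHalf M v hv : AddSubgroup (𝓞 k)) : Set (𝓞 k)) =
        (M : Set (𝓞 k)) ∪ {D | D - v ∈ M} := rfl
    rw [h, ncard_conePoints_union]
    · push_cast; ring
    · rw [Set.disjoint_left]
      intro D h1 h2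
      exact hv' (by simpa using M.sub_mem h1 h2)
  · have h0 : ((adjoinHalf M v hv).index : ℝ) ≠ 0 :=
      Nat.cast_ne_zero.mpr AddSubgroup.FiniteIndex.index_ne_zero
    rw [hi]
    congr 1
    push_cast
    field_simp
    norm_num

theorem tendsto_conePoints_coset (M : AddSubgroup (𝓞 k)) [M.FiniteIndex] (v : 𝓞 k)
    (hv : 4 • v ∈ M) :
    Tendsto (fun T : ℝ => ((conePoints k {D | D - v ∈ M} T).ncard : ℝ) / T) atTop
      (𝓝 (torsionOrder k * dedekindZeta_residue k / classNumber k / M.index)) := by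
  by_cases hv' : 2 • v ∈ M
  · exact tendsto_conePoints_coset_of_two M v hv'
  have hv2 : 2 • (2 • v) ∈ M := by rwa [← mul_nsmul]
  have hi := index_adjoinHalf hv2 hv'
  have : (adjoinHalf M _ hv2).FiniteIndex :=
    ⟨fun h => AddSubgroup.FiniteIndex.index_ne_zero (H := M) (by rw [hi, h])⟩
  have := (tendsto_conePoints_coset_of_two (adjoinHalf M _ hv2) v
    (mem_adjoinHalf.mpr (Or.inr (by simp)))).const_mul (1 / 2)
  convert! this using 1
  · ext T
    have h : {D | D - v ∈ adjoinHalf M _ hv2} = {D | D - v ∈ M} ∪ {D | -D ∈ {D | D - v ∈ M}} := by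
      ext D
      simp only [Set.mem_ofPred_eq, mem_adjoinHalf, Set.mem_union]
      refine or_congr Iff.rfl ⟨fun h => ?_, fun h => ?_⟩
      · convert! M.neg_mem (M.add_mem h hv) using 1; abel
      · convert! M.neg_mem (M.add_mem h hv) using 1; abel
    rw [h, ncard_conePoints_union, ncard_conePoints_neg]
    · push_cast; ring
    · rw [Set.disjoint_left]
      intro D h1 h2
      refine hv' ?_
      convert! M.neg_mem (M.add_mem h1 h2) using 1; abel
  · have h0 : ((adjoinHalf M _ hv2).index : ℝ) ≠ 0 :=
      Nat.cast_ne_zero.mpr AddSubgroup.FiniteIndex.index_ne_zero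
    rw [hi]
    push_cast
    field_simp

end Cosets

section SquareResidues

open NumberField.Units
open scoped nonZeroDivisors

variable {k}

theorem FractionalIdeal.mem_iff_forall_inv {J : FractionalIdeal (𝓞 k)⁰ k} (hJ : J ≠ 0) (u : k) :
    u ∈ J ↔ ∀ c ∈ J⁻¹, IsIntegral ℤ (c * u) := by
  conv_lhs => rw [← inv_inv J, FractionalIdeal.mem_inv_iff (inv_ne_zero hJ)]
  refine forall₂_congr fun c _ => ?_
  rw [FractionalIdeal.mem_one_iff, mul_comm]
  exact ⟨fun ⟨x, hx⟩ => hx ▸ x.isIntegral_coe, fun h => ⟨⟨_, h⟩, rfl⟩⟩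

theorem isIntegral_of_mul_add {A : Type*} [CommRing A] {x a : A} (ha : IsIntegral ℤ a)
    (h : IsIntegral ℤ (x ^ 2 + a * x)) : IsIntegral ℤ x := by
  refine isIntegral_trans (A := integralClosure ℤ A) _ ?_
  let a' : integralClosure ℤ A := ⟨a, ha⟩
  let b' : integralClosure ℤ A := ⟨_, h⟩
  refine ⟨Polynomial.X ^ 2 + Polynomial.C a' * Polynomial.X - Polynomial.C b', ?_, ?_⟩
  · nontriviality (integralClosure ℤ A)
    monicity!
  · simp only [Polynomial.eval₂_sub, Polynomial.eval₂_add, Polynomial.eval₂_pow,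
      Polynomial.eval₂_mul, Polynomial.eval₂_X, Polynomial.eval₂_C]
    exact sub_self _

/-- The ideal `4 J ^ 2`. -/
def fourSq (J : Ideal (𝓞 k)) : Ideal (𝓞 k) := Ideal.span {4} * J ^ 2

/-- The algebraic integers congruent to `r * t ^ 2` modulo `4 J ^ 2` for some `t` in `J`. -/
def squareResidues (r : 𝓞 k) (J : Ideal (𝓞 k)) : Set (𝓞 k) :=
  {D | ∃ t ∈ J, D - r * t ^ 2 ∈ fourSq J}

theorem mem_fourSq {J : Ideal (𝓞 k)} {x : 𝓞 k} : x ∈ fourSq J ↔ ∃ n ∈ J ^ 2, x = 4 * n := by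
  rw [fourSq, Ideal.mem_span_singleton_mul]
  exact exists_congr fun n => and_congr Iff.rfl eq_comm

theorem absNorm_span_natCast (n : ℕ) :
    Ideal.absNorm (Ideal.span {(n : 𝓞 k)}) = n ^ Module.finrank ℚ k := by
  rw [Ideal.absNorm_span_singleton]
  have : (n : 𝓞 k) = algebraMap ℤ (𝓞 k) n := by simp
  rw [this, Algebra.norm_algebraMap, RingOfIntegers.rank, Int.natAbs_pow, Int.natAbs_natCast]

theorem index_toAddSubgroup (I : Ideal (𝓞 k)) :
    I.toAddSubgroup.index = Ideal.absNorm I := rfl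

theorem index_fourSq (J : Ideal (𝓞 k)) :
    (fourSq J).toAddSubgroup.index = 4 ^ Module.finrank ℚ k * Ideal.absNorm J ^ 2 := by
  rw [index_toAddSubgroup, fourSq, map_mul, map_pow, ← absNorm_span_natCast]
  simp

theorem sub_mem_two_mul_of_sq_sub_sq_mem {J : Ideal (𝓞 k)} (hJ : J ≠ ⊥) {s t : 𝓞 k}
    (hs : s ∈ J) (h : t ^ 2 - s ^ 2 ∈ fourSq J) : t - s ∈ Ideal.span {2} * J := by
  have hJ' : (J : FractionalIdeal (𝓞 k)⁰ k) ≠ 0 := FractionalIdeal.coeIdeal_ne_zero.mpr hJ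
  have key : ((t - s : k) / 2) ∈ (J : FractionalIdeal (𝓞 k)⁰ k) := by
    rw [FractionalIdeal.mem_iff_forall_inv hJ']
    intro c hc
    obtain ⟨n, hn, hn'⟩ := mem_fourSq.mp h
    have hcs : IsIntegral ℤ (c * s) :=
      (FractionalIdeal.mem_iff_forall_inv hJ' _).mp
        (FractionalIdeal.mem_coeIdeal_of_mem _ hs) c hc
    have hn2 : IsIntegral ℤ (c ^ 2 * n) := by
      have hJ2 : ((J ^ 2 : Ideal (𝓞 k)) : FractionalIdeal (𝓞 k)⁰ k) ≠ 0 :=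
        FractionalIdeal.coeIdeal_ne_zero.mpr (pow_ne_zero 2 hJ)
      refine (FractionalIdeal.mem_iff_forall_inv hJ2 _).mp
        (FractionalIdeal.mem_coeIdeal_of_mem _ hn) _ ?_
      rw [FractionalIdeal.coeIdeal_pow, ← inv_pow, pow_two, pow_two]
      exact FractionalIdeal.mul_mem_mul hc hc
    have hn'' : (t : k) ^ 2 - (s : k) ^ 2 = 4 * n := by
      have := congrArg (algebraMap (𝓞 k) k) hn'
      rwa [map_sub, map_pow, map_pow, map_mul, map_ofNat] at this
    refine isIntegral_of_mul_add hcs (by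
      convert! hn2 using 1
      linear_combination c ^ 2 / 4 * hn'')
  obtain ⟨m, hm, hm'⟩ := (FractionalIdeal.mem_coeIdeal _).mp key
  rw [Ideal.mem_span_singleton_mul]
  refine ⟨m, hm, RingOfIntegers.coe_injective ?_⟩
  rw [map_mul, hm', map_sub,
    map_ofNat]
  ring

theorem ncard_conePoints_biUnion {ι : Type*} (s : Finset ι) (S : ι → Set (𝓞 k))
    (h : Pairwise fun i j => Disjoint (S i) (S j)) (T : ℝ) :
    (conePoints k (⋃ i ∈ s, S i) T).ncard = ∑ i ∈ s, (conePoints k (S i) T).ncard := by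
  induction s using Finset.induction_on with
  | empty => simp [conePoints]
  | insert a s ha ih =>
    rw [Finset.set_biUnion_insert, Finset.sum_insert ha, ncard_conePoints_union, ih]
    rw [Set.disjoint_iUnion₂_right]
    exact fun i hi => h fun hai => ha (hai ▸ hi)

theorem relIndex_span_two_mul {J : Ideal (𝓞 k)} (hJ : J ≠ ⊥) :
    (Ideal.span {2} * J).toAddSubgroup.relIndex J.toAddSubgroup = 2 ^ Module.finrank ℚ k := by
  have h := AddSubgroup.relIndex_mul_index (H := (Ideal.span {2} * J).toAddSubgroup)
    (K := J.toAddSubgroup) (Ideal.mul_le_right : Ideal.span {2} * J ≤ J)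
  rw [index_toAddSubgroup, index_toAddSubgroup, map_mul] at h
  have h2 := absNorm_span_natCast (k := k) 2
  rw [Nat.cast_ofNat] at h2
  rw [h2] at h
  exact Nat.eq_of_mul_eq_mul_right (Nat.pos_of_ne_zero (Ideal.absNorm_eq_zero_iff.not.mpr hJ)) h

theorem tendsto_squareResidues {J : Ideal (𝓞 k)} (hJ : J ≠ ⊥) (r : (𝓞 k)ˣ) :
    Tendsto (fun T : ℝ => ((conePoints k (squareResidues (r : 𝓞 k) J) T).ncard : ℝ) / T) atTop
      (𝓝 (torsionOrder k * dedekindZeta_residue k / classNumber k /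
        (2 ^ Module.finrank ℚ k * Ideal.absNorm J ^ 2))) := by
  have hN : Ideal.absNorm J ≠ 0 := Ideal.absNorm_eq_zero_iff.not.mpr hJ
  have hfi : (fourSq J).toAddSubgroup.FiniteIndex :=
    ⟨by rw [index_fourSq]; exact mul_ne_zero (by positivity) (pow_ne_zero 2 hN)⟩
  let H := (Ideal.span {2} * J).toAddSubgroup.addSubgroupOf J.toAddSubgroup
  have hcard : Nat.card (J.toAddSubgroup ⧸ H) = 2 ^ Module.finrank ℚ k :=
    relIndex_span_two_mul hJ
  have : Finite (J.toAddSubgroup ⧸ H) :=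
    Nat.finite_of_card_ne_zero (by rw [hcard]; positivity)
  have := Fintype.ofFinite (J.toAddSubgroup ⧸ H)
  let t : J.toAddSubgroup ⧸ H → 𝓞 k := fun q => (Quotient.out q : J.toAddSubgroup)
  have ht : ∀ q, t q ∈ J := fun q => (Quotient.out q : J.toAddSubgroup).2
  let S : J.toAddSubgroup ⧸ H → Set (𝓞 k) :=
    fun q => {D | D - r * t q ^ 2 ∈ (fourSq J).toAddSubgroup}
  have hS : squareResidues (r : 𝓞 k) J = ⋃ q ∈ Finset.univ, S q := by
    ext D
    simp only [squareResidues, Set.mem_ofPred_eq, Finset.mem_univ, Set.iUnion_true, Set.mem_iUnion]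
    constructor
    · rintro ⟨s, hs, hD⟩
      refine ⟨QuotientAddGroup.mk (⟨s, hs⟩ : J.toAddSubgroup), ?_⟩
      set q : J.toAddSubgroup ⧸ H := QuotientAddGroup.mk (⟨s, hs⟩ : J.toAddSubgroup)
      have hq : -t q + s ∈ Ideal.span {2} * J :=
        QuotientAddGroup.eq.mp (Quotient.out_eq q)
      obtain ⟨m, hm, hm'⟩ := Ideal.mem_span_singleton_mul.mp hq
      change D - r * t q ^ 2 ∈ fourSq J
      have h2 : D - r * t q ^ 2 = (D - r * s ^ 2) + r * (4 * (m ^ 2 + m * t q)) := by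
        have : s = t q + 2 * m := by linear_combination -hm'
        rw [this]; ring
      rw [h2]
      refine add_mem hD (Ideal.mul_mem_left _ _ (mem_fourSq.mpr ⟨_, ?_, rfl⟩))
      rw [pow_two m, pow_two J]
      exact add_mem (Ideal.mul_mem_mul hm hm) (Ideal.mul_mem_mul hm (ht q))
    · rintro ⟨q, hq⟩
      exact ⟨t q, ht q, hq⟩
  have hdisj : Pairwise fun i j => Disjoint (S i) (S j) := by
    intro i j hij
    rw [Set.disjoint_left]
    intro D hi hj
    apply hij
    have h1 : (r : 𝓞 k) * (t j ^ 2 - t i ^ 2) ∈ fourSq J := by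
      convert! (fourSq J).sub_mem hi hj using 1; ring
    have h2 : t j ^ 2 - t i ^ 2 ∈ fourSq J := by
      convert! (fourSq J).mul_mem_left ((r⁻¹ : (𝓞 k)ˣ) : 𝓞 k) h1 using 1
      rw [Units.inv_mul_cancel_left]
    have h3 := sub_mem_two_mul_of_sq_sub_sq_mem hJ (ht i) h2
    rw [← Quotient.out_eq i, ← Quotient.out_eq j]
    refine QuotientAddGroup.eq.mpr ?_
    change -t i + t j ∈ Ideal.span {2} * J
    convert! h3 using 1; ring
  have hlim : ∀ q, Tendsto (fun T : ℝ => ((conePoints k (S q) T).ncard : ℝ) / T) atTop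
      (𝓝 (torsionOrder k * dedekindZeta_residue k / classNumber k /
        (fourSq J).toAddSubgroup.index)) := by
    intro q
    refine tendsto_conePoints_coset _ _ ?_
    change 4 • (r * t q ^ 2) ∈ fourSq J
    have : 4 • ((r : 𝓞 k) * t q ^ 2) = r * (4 * t q ^ 2) := by rw [nsmul_eq_mul]; push_cast; ring
    rw [this]
    exact Ideal.mul_mem_left _ _ (mem_fourSq.mpr ⟨_, Ideal.pow_mem_pow (ht q) 2, rfl⟩)
  have := tendsto_finsetSum Finset.univ fun q _ => hlim q
  convert! this using 1
  · ext T
    rw [hS, ncard_conePoints_biUnion _ _ hdisj, Nat.cast_sum, Finset.sum_div]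
  · rw [Finset.sum_const, Finset.card_univ, ← Nat.card_eq_fintype_card, hcard, index_fourSq,
      nsmul_eq_mul]
    congr 1
    have h4 : (4 : ℝ) ^ Module.finrank ℚ k = 2 ^ Module.finrank ℚ k * 2 ^ Module.finrank ℚ k := by
      rw [← mul_pow]; norm_num
    push_cast [h4]
    have : (Ideal.absNorm J : ℝ) ≠ 0 := Nat.cast_ne_zero.mpr hN
    field_simp

end SquareResidues

section QuadraticGenerators

open scoped nonZeroDivisors

/-- A generator of a quadratic extension `L` of `k`: an element `θ` whose square is the inverse
of an algebraic integer `a` of `k`, together with the conjugation `σ`. -/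
structure QuadGen (L : Type*) [Field L] [NumberField L] [Algebra k L] where
  a : 𝓞 k
  θ : L
  σ : L ≃ₐ[k] L
  mul_sq : algebraMap k L a * θ ^ 2 = 1
  map_θ : σ θ = -θ
  span : ∀ v : L, ∃ t y : k, 2 * v = algebraMap k L t + algebraMap k L y * θ
  finrank_eq : Module.finrank k L = 2

namespace QuadGen

variable {k} {L : Type*} [Field L] [NumberField L] [Algebra k L] (d : QuadGen k L)

theorem θ_ne_zero : d.θ ≠ 0 := by
  intro h
  have := d.mul_sq
  simp [h] at this

theorem a_ne_zero : (d.a : k) ≠ 0 := by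
  intro h
  have := d.mul_sq
  rw [h] at this
  simp at this

theorem exists_sub (v : L) : ∃ y : k, v - d.σ v = algebraMap k L y * d.θ := by
  obtain ⟨t, y, h⟩ := d.span v
  refine ⟨y, ?_⟩
  have h2 := congrArg d.σ h
  simp only [map_mul, map_add, AlgEquiv.commutes, d.map_θ, map_ofNat] at h2
  linear_combination (h - h2) / 2

theorem algebraMap_trace (v : L) : algebraMap k L (Algebra.trace k L v) = v + d.σ v := by
  obtain ⟨t, y, h⟩ := d.span v
  have h2 := congrArg d.σ h
  simp only [map_mul, map_add, AlgEquiv.commutes, d.map_θ, map_ofNat] at h2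
  have hv : v = (t / 2) • (1 : L) + (y / 2) • d.θ := by
    rw [Algebra.smul_def, Algebra.smul_def, map_div₀, map_div₀, map_ofNat]
    linear_combination h / 2
  have h1 : Algebra.trace k L 1 = 2 := by
    have := Algebra.trace_algebraMap (R := k) (S := L) 1
    rw [map_one, d.finrank_eq] at this
    rw [this]; simp
  have h0 : Algebra.trace k L d.θ = 0 := by
    have := Algebra.trace_eq_of_algEquiv d.σ d.θ
    rw [d.map_θ, map_neg] at this
    exact self_eq_neg.mp this.symm
  have ht : Algebra.trace k L v = t := by
    conv_lhs => rw [hv]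
    rw [map_add, map_smul, map_smul, h1, h0]
    simp
  rw [ht]
  linear_combination -(h + h2) / 2

theorem isIntegral_map {v : L} (hv : IsIntegral ℤ v) : IsIntegral ℤ (d.σ v) :=
  hv.map (d.σ.toAlgHom.restrictScalars ℤ)

theorem isIntegral_algebraMap_iff {y : k} : IsIntegral ℤ (algebraMap k L y) ↔ IsIntegral ℤ y :=
  _root_.isIntegral_algebraMap_iff (algebraMap k L).injective

/-- The ideal of those `y` such that `y * θ = v - σ v` for some algebraic integer `v`. -/
def ideal : Ideal (𝓞 k) where
  carrier := {y | ∃ v : L, IsIntegral ℤ v ∧ v - d.σ v = algebraMap k L y * d.θ}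
  zero_mem' := ⟨0, isIntegral_zero, by simp⟩
  add_mem' := by
    rintro y z ⟨v, hv, hv'⟩ ⟨w, hw, hw'⟩
    refine ⟨v + w, hv.add hw, ?_⟩
    rw [RingOfIntegers.coe_eq_algebraMap] at hv' hw' ⊢
    rw [map_add, map_add, map_add]
    linear_combination hv' + hw'
  smul_mem' := by
    rintro c y ⟨v, hv, hv'⟩
    refine ⟨algebraMap k L c * v, (isIntegral_algebraMap_iff.mpr c.isIntegral_coe).mul hv, ?_⟩
    rw [smul_eq_mul, RingOfIntegers.coe_eq_algebraMap (c * y), map_mul, map_mul, map_mul,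
      AlgEquiv.commutes]
    linear_combination algebraMap k L c * hv'

theorem mem_ideal {y : 𝓞 k} :
    y ∈ d.ideal ↔ ∃ v : L, IsIntegral ℤ v ∧ v - d.σ v = algebraMap k L y * d.θ := Iff.rfl

theorem isIntegral_of_mul_θ {y : k} (h : IsIntegral ℤ (algebraMap k L y * d.θ)) :
    IsIntegral ℤ y := by
  refine IsIntegral.of_pow two_pos ?_
  rw [← isIntegral_algebraMap_iff (L := L), map_pow]
  have := (isIntegral_algebraMap_iff (L := L).mpr d.a.isIntegral_coe).mul (h.pow 2)
  convert! this using 1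
  linear_combination -(algebraMap k L y) ^ 2 * d.mul_sq

theorem mem_coe_ideal {y : k} : y ∈ (d.ideal : FractionalIdeal (𝓞 k)⁰ k) ↔
    ∃ v : L, IsIntegral ℤ v ∧ v - d.σ v = algebraMap k L y * d.θ := by
  rw [FractionalIdeal.mem_coeIdeal]
  constructor
  · rintro ⟨z, hz, rfl⟩
    exact hz
  · rintro ⟨v, hv, hv'⟩
    have hy : IsIntegral ℤ y :=
      d.isIntegral_of_mul_θ (hv' ▸ hv.sub (d.isIntegral_map hv))
    exact ⟨⟨y, hy⟩, ⟨v, hv, hv'⟩, rfl⟩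

theorem isIntegral_a_mul_θ : IsIntegral ℤ (algebraMap k L d.a * d.θ) := by
  refine IsIntegral.of_pow two_pos ?_
  convert! isIntegral_algebraMap_iff (L := L).mpr d.a.isIntegral_coe using 1
  linear_combination algebraMap k L d.a * d.mul_sq

theorem ideal_ne_bot : d.ideal ≠ ⊥ := by
  intro h
  have h2 : 2 * d.a ∈ d.ideal := by
    refine ⟨algebraMap k L d.a * d.θ, d.isIntegral_a_mul_θ, ?_⟩
    rw [map_mul, AlgEquiv.commutes, d.map_θ, RingOfIntegers.coe_eq_algebraMap (2 * d.a), map_mul,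
      map_mul, map_ofNat, map_ofNat]
    ring
  rw [h, Ideal.mem_bot] at h2
  refine d.a_ne_zero ?_
  rw [(mul_eq_zero.mp h2).resolve_left two_ne_zero]
  simp

theorem mem_range_iff {x : k} : x ∈ (algebraMap (𝓞 k) k).range ↔ IsIntegral ℤ x :=
  ⟨fun ⟨y, hy⟩ => hy ▸ y.isIntegral_coe, fun h => ⟨⟨x, h⟩, rfl⟩⟩

theorem mem_dual_iff {z : L} :
    z ∈ FractionalIdeal.dual (𝓞 k) k (1 : FractionalIdeal (𝓞 L)⁰ L) ↔
      ∀ β ∈ d.ideal, IsIntegral ℤ (z * d.θ * algebraMap k L β) := by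
  have hone : (1 : FractionalIdeal (𝓞 L)⁰ L) ≠ 0 := one_ne_zero
  rw [FractionalIdeal.mem_dual hone]
  have hall : (∀ a ∈ (1 : FractionalIdeal (𝓞 L)⁰ L),
      Algebra.traceForm k L z a ∈ (algebraMap (𝓞 k) k).range) ↔
      ∀ x : L, IsIntegral ℤ x → IsIntegral ℤ (z * x + d.σ (z * x)) := by
    constructor
    · intro h x hx
      have := mem_range_iff.mp (h x ((FractionalIdeal.mem_one_iff _).mpr ⟨⟨x, hx⟩, rfl⟩))
      rw [Algebra.traceForm_apply] at this
      rwa [← d.algebraMap_trace, isIntegral_algebraMap_iff]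
    · intro h x hx
      obtain ⟨x, rfl⟩ := (FractionalIdeal.mem_one_iff _).mp hx
      have := h _ x.isIntegral_coe
      rwa [mem_range_iff, Algebra.traceForm_apply, ← isIntegral_algebraMap_iff (L := L),
        d.algebraMap_trace]
  rw [hall]
  constructor
  · rintro h β ⟨x, hx, hx'⟩
    have h1 := h 1 isIntegral_one
    have h2 := h x hx
    rw [mul_one] at h1
    convert! h2.sub (h1.mul (d.isIntegral_map hx)) using 1
    rw [map_mul]
    linear_combination -z * hx'
  · intro h x hx
    rw [← d.algebraMap_trace, isIntegral_algebraMap_iff]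
    set s := Algebra.trace k L (z * x)
    have hs : algebraMap k L s = z * x + d.σ z * d.σ x := by rw [← map_mul, d.algebraMap_trace]
    refine isIntegral_trans (A := 𝓞 k) _ (isIntegral_of_smul_mem_submodule
      (d.ideal : FractionalIdeal (𝓞 k)⁰ k).coeToSubmodule ?_
      (FractionalIdeal.fg_of_isNoetherianRing le_rfl _) s ?_)
    · rw [Ne, FractionalIdeal.coeToSubmodule_eq_bot]
      exact FractionalIdeal.coeIdeal_ne_zero.mpr d.ideal_ne_bot
    · intro y hy
      obtain ⟨β, hβ, rfl⟩ := (FractionalIdeal.mem_coeIdeal _).mp hy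
      refine d.mem_coe_ideal.mpr ⟨_, (h β hβ).mul hx, ?_⟩
      rw [map_mul, map_mul, map_mul, AlgEquiv.commutes, d.map_θ, smul_eq_mul, map_mul, hs]
      ring

theorem coe_differentIdeal : (differentIdeal (𝓞 k) (𝓞 L) : FractionalIdeal (𝓞 L)⁰ L) =
    FractionalIdeal.spanSingleton (𝓞 L)⁰ d.θ *
      (d.ideal.map (algebraMap (𝓞 k) (𝓞 L)) : Ideal (𝓞 L)) := by
  have hmap : ((d.ideal.map (algebraMap (𝓞 k) (𝓞 L)) : Ideal (𝓞 L)) :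
      FractionalIdeal (𝓞 L)⁰ L) ≠ 0 := by
    rw [FractionalIdeal.coeIdeal_ne_zero, Ne,
      Ideal.map_eq_bot_iff_of_injective (FaithfulSMul.algebraMap_injective _ _)]
    exact d.ideal_ne_bot
  rw [coeIdeal_differentIdeal (𝓞 k) k, inv_eq_iff_eq_inv, mul_inv,
    FractionalIdeal.spanSingleton_inv]
  ext z
  have h1 : z ∈ FractionalIdeal.spanSingleton (𝓞 L)⁰ d.θ⁻¹ *
      (d.ideal.map (algebraMap (𝓞 k) (𝓞 L)) : FractionalIdeal (𝓞 L)⁰ L)⁻¹ ↔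
      z * d.θ ∈ (d.ideal.map (algebraMap (𝓞 k) (𝓞 L)) : FractionalIdeal (𝓞 L)⁰ L)⁻¹ := by
    rw [FractionalIdeal.mem_singleton_mul]
    have hθ := d.θ_ne_zero
    constructor
    · rintro ⟨y, hy, rfl⟩
      convert! hy using 1
      field_simp
    · exact fun h => ⟨_, h, by field_simp⟩
  rw [d.mem_dual_iff, h1, FractionalIdeal.mem_inv_iff hmap]
  constructor
  · intro h y hy
    obtain ⟨y, hy', rfl⟩ := (FractionalIdeal.mem_coeIdeal _).mp hy
    suffices IsIntegral ℤ (z * d.θ * y) from (FractionalIdeal.mem_one_iff _).mpr ⟨⟨_, this⟩, rfl⟩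
    refine Submodule.span_induction ?_ ?_ ?_ ?_ hy'
    · rintro _ ⟨β, hβ, rfl⟩
      exact h β hβ
    · simpa using isIntegral_zero
    · intro x y _ _ hx hy
      rw [RingOfIntegers.coe_eq_algebraMap] at hx hy ⊢
      rw [map_add, mul_add]
      exact hx.add hy
    · intro c x _ hx
      rw [RingOfIntegers.coe_eq_algebraMap] at hx ⊢
      rw [smul_eq_mul, map_mul, mul_left_comm]
      exact c.isIntegral_coe.mul hx
  · intro h β hβ
    obtain ⟨x, hx⟩ := (FractionalIdeal.mem_one_iff _).mp (h (algebraMap (𝓞 L) L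
      (algebraMap (𝓞 k) (𝓞 L) β)) (FractionalIdeal.mem_coeIdeal_of_mem _
        (Ideal.mem_map_of_mem _ hβ)))
    change IsIntegral ℤ (z * d.θ * algebraMap (𝓞 L) L (algebraMap (𝓞 k) (𝓞 L) β))
    rw [← hx]
    exact x.isIntegral_coe

theorem absNorm_differentIdeal :
    Ideal.absNorm (differentIdeal (𝓞 k) (𝓞 L)) * (Algebra.norm ℤ d.a).natAbs =
      Ideal.absNorm d.ideal ^ 2 := by
  let φ : 𝓞 L := ⟨_, d.isIntegral_a_mul_θ⟩
  have hφ : φ ^ 2 = algebraMap (𝓞 k) (𝓞 L) d.a := by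
    refine RingOfIntegers.coe_injective ?_
    change (algebraMap k L d.a * d.θ) ^ 2 = algebraMap k L d.a
    linear_combination algebraMap k L d.a * d.mul_sq
  have h : Ideal.span {φ} * differentIdeal (𝓞 k) (𝓞 L) =
      d.ideal.map (algebraMap (𝓞 k) (𝓞 L)) := by
    rw [← (FractionalIdeal.coeIdeal_injective (K := L)).eq_iff, FractionalIdeal.coeIdeal_mul,
      coe_differentIdeal, FractionalIdeal.coeIdeal_span_singleton, ← mul_assoc,
      FractionalIdeal.spanSingleton_mul_spanSingleton]
    have : algebraMap (𝓞 L) L φ * d.θ = 1 := by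
      change algebraMap k L d.a * d.θ * d.θ = 1
      linear_combination d.mul_sq
    rw [this, FractionalIdeal.spanSingleton_one, one_mul]
  have hn := congrArg Ideal.absNorm h
  have hr : Module.finrank (𝓞 k) (𝓞 L) = 2 := by
    rw [← d.finrank_eq, IsFractionRing.finrank_eq (𝓞 k) k (𝓞 L) L]
  rw [map_mul, Ideal.absNorm_algebraMap, hr] at hn
  rw [← hn, mul_comm]
  congr 1
  have h2 := congrArg (fun x => (Algebra.norm ℤ x).natAbs) hφ
  have h3 : (Algebra.norm ℤ (algebraMap (𝓞 k) (𝓞 L) d.a)).natAbs =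
      (Algebra.norm ℤ d.a).natAbs ^ 2 := by
    rw [← Ideal.absNorm_span_singleton, ← Ideal.absNorm_span_singleton, ← hr,
      ← Ideal.absNorm_algebraMap, Ideal.map_span, Set.image_singleton]
  simp only [map_pow, Int.natAbs_pow, h3] at h2
  rw [Ideal.absNorm_span_singleton]
  exact (Nat.pow_left_injective two_ne_zero h2).symm

end QuadGen

end QuadraticGenerators

section SquareClasses

open scoped nonZeroDivisors

variable {k}

theorem FractionalIdeal.mem_mul_iff_forall_inv {I : FractionalIdeal (𝓞 k)⁰ k} (hI : I ≠ 0)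
    (B : FractionalIdeal (𝓞 k)⁰ k) {y : k} : y ∈ I * B ↔ ∀ c ∈ I⁻¹, c * y ∈ B := by
  constructor
  · intro h c hc
    have := FractionalIdeal.mul_mem_mul hc h
    rwa [← mul_assoc, inv_mul_cancel₀ hI, one_mul] at this
  · intro h
    suffices ∀ z ∈ I * I⁻¹, z * y ∈ I * B by
      simpa using this 1 (by rw [mul_inv_cancel₀ hI]; exact FractionalIdeal.one_mem_one _)
    intro z hz
    refine FractionalIdeal.mul_induction_on hz (fun i hi c hc => ?_) (fun a b ha hb => ?_)
    · rw [mul_assoc]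
      exact FractionalIdeal.mul_mem_mul hi (h c hc)
    · rw [add_mul]
      exact Submodule.add_mem _ ha hb

theorem mem_squareResidues_one_iff {L : Type*} [Field L] [NumberField L] [Algebra k L]
    (d : QuadGen k L) {J : Ideal (𝓞 k)} (hJ : J ≠ ⊥) {D : 𝓞 k} {y : k}
    (hD : (D : k) * d.a = y ^ 2) :
    D ∈ squareResidues 1 J ↔ y ∈ ((J * d.ideal : Ideal (𝓞 k)) : FractionalIdeal (𝓞 k)⁰ k) := by
  have hJ' : (J : FractionalIdeal (𝓞 k)⁰ k) ≠ 0 := FractionalIdeal.coeIdeal_ne_zero.mpr hJ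
  have hJ2 : ((J ^ 2 : Ideal (𝓞 k)) : FractionalIdeal (𝓞 k)⁰ k) ≠ 0 :=
    FractionalIdeal.coeIdeal_ne_zero.mpr (pow_ne_zero 2 hJ)
  have hDL : algebraMap k L D = (algebraMap k L y * d.θ) ^ 2 := by
    have := congrArg (algebraMap k L) hD
    rw [map_mul, map_pow] at this
    linear_combination d.θ ^ 2 * this - algebraMap k L D * d.mul_sq
  rw [FractionalIdeal.coeIdeal_mul, FractionalIdeal.mem_mul_iff_forall_inv hJ']
  constructor
  · rintro ⟨t, ht, h⟩ c hc
    obtain ⟨n, hn, hn'⟩ := mem_fourSq.mp h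
    rw [one_mul] at hn'
    have hct : IsIntegral ℤ (c * t) :=
      (FractionalIdeal.mem_iff_forall_inv hJ' _).mp
        (FractionalIdeal.mem_coeIdeal_of_mem _ ht) c hc
    have hcn : IsIntegral ℤ (c ^ 2 * n) := by
      refine (FractionalIdeal.mem_iff_forall_inv hJ2 _).mp
        (FractionalIdeal.mem_coeIdeal_of_mem _ hn) _ ?_
      rw [FractionalIdeal.coeIdeal_pow, ← inv_pow, pow_two, pow_two]
      exact FractionalIdeal.mul_mem_mul hc hc
    have hn'' : algebraMap k L D - algebraMap k L t ^ 2 = 4 * algebraMap k L n := by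
      have := congrArg (algebraMap (𝓞 k) L) hn'
      rwa [map_sub, map_pow, map_mul, map_ofNat] at this
    rw [d.mem_coe_ideal]
    refine ⟨(algebraMap k L (c * t) + algebraMap k L (c * y) * d.θ) / 2,
      isIntegral_of_mul_add (a := algebraMap k L (-(c * t)))
        (QuadGen.isIntegral_algebraMap_iff.mpr hct.neg) ?_, ?_⟩
    · convert! (QuadGen.isIntegral_algebraMap_iff (L := L)).mpr hcn using 1
      simp only [map_mul, map_neg, map_pow]
      linear_combination (algebraMap k L c) ^ 2 / 4 * (hn'' - hDL)
    · rw [map_div₀, map_add, map_mul d.σ, AlgEquiv.commutes, AlgEquiv.commutes, d.map_θ, map_ofNat]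
      ring
  · intro h
    have key : ∀ z ∈ (J : FractionalIdeal (𝓞 k)⁰ k) * (J : FractionalIdeal (𝓞 k)⁰ k)⁻¹,
        ∃ w ∈ J, ∀ c ∈ (J : FractionalIdeal (𝓞 k)⁰ k)⁻¹, IsIntegral ℤ
          (algebraMap k L c * (algebraMap k L w + algebraMap k L z * algebraMap k L y * d.θ) / 2) := by
      intro z hz
      refine FractionalIdeal.mul_induction_on hz (fun i hi b hb => ?_) (fun z₁ z₂ h₁ h₂ => ?_)
      · obtain ⟨j, hj, rfl⟩ := (FractionalIdeal.mem_coeIdeal _).mp hi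
        obtain ⟨v, hv, hv'⟩ := d.mem_coe_ideal.mp (h b hb)
        have ht : IsIntegral ℤ (Algebra.trace k L v) := by
          rw [← QuadGen.isIntegral_algebraMap_iff (L := L), d.algebraMap_trace]
          exact hv.add (d.isIntegral_map hv)
        obtain ⟨t, ht'⟩ : ∃ t : 𝓞 k, algebraMap (𝓞 k) k t = Algebra.trace k L v := ⟨⟨_, ht⟩, rfl⟩
        refine ⟨t * j, Ideal.mul_mem_left _ _ hj, fun c hc => ?_⟩
        have hcj : IsIntegral ℤ (c * j) :=
          (FractionalIdeal.mem_iff_forall_inv hJ' _).mp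
            (FractionalIdeal.mem_coeIdeal_of_mem _ hj) c hc
        convert! ((QuadGen.isIntegral_algebraMap_iff (L := L)).mpr hcj).mul hv using 1
        rw [RingOfIntegers.coe_eq_algebraMap (t * j), map_mul, ht', map_mul, map_mul, map_mul,
          d.algebraMap_trace]
        rw [map_mul] at hv'
        linear_combination -algebraMap k L c * algebraMap k L j / 2 * hv'
      · obtain ⟨w₁, hw₁, h₁⟩ := h₁
        obtain ⟨w₂, hw₂, h₂⟩ := h₂
        refine ⟨w₁ + w₂, J.add_mem hw₁ hw₂, fun c hc => ?_⟩
        convert! (h₁ c hc).add (h₂ c hc) using 1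
        rw [RingOfIntegers.coe_eq_algebraMap (w₁ + w₂), map_add, map_add, map_add]
        ring
    obtain ⟨w, hw, hx⟩ := key 1 (by
      rw [mul_inv_cancel₀ hJ']; exact FractionalIdeal.one_mem_one _)
    refine ⟨w, hw, ?_⟩
    have hn : ((D : k) - (w : k) ^ 2) / 4 ∈
        ((J ^ 2 : Ideal (𝓞 k)) : FractionalIdeal (𝓞 k)⁰ k) := by
      rw [FractionalIdeal.mem_iff_forall_inv hJ2, FractionalIdeal.coeIdeal_pow, ← inv_pow, pow_two]
      intro z hz
      refine FractionalIdeal.mul_induction_on hz (fun b hb c hc => ?_) (fun z₁ z₂ h₁ h₂ => ?_)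
      · rw [← QuadGen.isIntegral_algebraMap_iff (L := L)]
        convert! ((hx b hb).mul (d.isIntegral_map (hx c hc))).neg using 1
        simp only [map_mul, map_div₀, map_sub, map_add, map_pow, map_ofNat, map_one,
          AlgEquiv.commutes, d.map_θ]
        linear_combination algebraMap k L b * algebraMap k L c / 4 * hDL
      · rw [add_mul]
        exact h₁.add h₂
    obtain ⟨n, hn, hn'⟩ := (FractionalIdeal.mem_coeIdeal _).mp hn
    refine mem_fourSq.mpr ⟨n, hn, RingOfIntegers.coe_injective ?_⟩
    rw [one_mul, map_sub, map_pow, map_mul, hn', map_ofNat]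
    ring

end SquareClasses

section QuadraticExtensions

namespace QuadGen

variable {k}

theorem nonempty_of_finrank (L : Type*) [Field L] [NumberField L] [Algebra k L]
    (h : Module.finrank k L = 2) : Nonempty (QuadGen k L) := by
  have : Algebra.IsQuadraticExtension k L := ⟨h⟩
  have hc : Nat.card Gal(L/k) = 2 := by rw [IsGalois.card_aut_eq_finrank, h]
  obtain ⟨σ, hσ, hσ'⟩ := (Nat.card_eq_two_iff' (1 : Gal(L/k))).mp hc
  have hfix : ∀ x : L, σ x = x → ∃ y : k, algebraMap k L y = x := fun x hx => by
    refine (IsGalois.mem_range_algebraMap_iff_fixed (F := k) x).mpr fun τ => ?_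
    by_cases hτ : τ = 1
    · rw [hτ]; rfl
    · rw [hσ' τ hτ, hx]
  have hσσ : ∀ x, σ (σ x) = x := fun x => by
    have : σ ^ 2 = 1 := by rw [← hc]; exact pow_card_eq_one'
    rw [pow_two] at this
    exact DFunLike.congr_fun this x
  obtain ⟨v, hv⟩ : ∃ v, σ v ≠ v := by
    by_contra! hcon
    exact hσ (AlgEquiv.ext hcon)
  obtain ⟨c, hc⟩ := hfix ((v - σ v) ^ 2) (by rw [map_pow, map_sub, hσσ]; ring)
  obtain ⟨p, q, hq, rfl⟩ := IsFractionRing.div_surjective (A := 𝓞 k) c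
  have hq0 : (algebraMap k L (algebraMap (𝓞 k) k q)) ≠ 0 := by
    simpa using nonZeroDivisors.ne_zero hq
  have hv0 : v - σ v ≠ 0 := sub_ne_zero.mpr hv.symm
  refine ⟨⟨p * q, (algebraMap k L (algebraMap (𝓞 k) k q) * (v - σ v))⁻¹, σ, ?_, ?_, ?_, h⟩⟩
  · rw [RingOfIntegers.coe_eq_algebraMap, map_mul, map_mul, inv_pow, mul_pow, ← hc, map_div₀]
    have : algebraMap k L (algebraMap (𝓞 k) k p) ≠ 0 := by
      intro h0
      rw [map_div₀, h0, zero_div] at hc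
      exact pow_ne_zero 2 hv0 hc.symm
    field_simp
  · rw [map_inv₀, map_mul, AlgEquiv.commutes, map_sub, hσσ, ← neg_sub v, mul_neg, inv_neg]
  · intro x
    obtain ⟨t, ht⟩ := hfix (x + σ x) (by rw [map_add, hσσ, add_comm])
    obtain ⟨y, hy⟩ := hfix ((x - σ x) * (algebraMap k L (algebraMap (𝓞 k) k q) * (v - σ v))) (by
      rw [map_mul, map_mul, map_sub, map_sub, AlgEquiv.commutes, hσσ, hσσ]; ring)
    refine ⟨t, y, ?_⟩
    rw [ht, hy, mul_inv_cancel_right₀ (mul_ne_zero hq0 hv0)]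
    ring

section

variable {L : Type*} [Field L] [NumberField L] [Algebra k L] (d : QuadGen k L)

theorem sq_mul_θ {D y : k} (h : D * d.a = y ^ 2) :
    (algebraMap k L y * d.θ) ^ 2 = algebraMap k L D := by
  have := congrArg (algebraMap k L) h
  rw [map_mul, map_pow] at this
  linear_combination -d.θ ^ 2 * this + algebraMap k L D * d.mul_sq

theorem exists_mul_a_eq_sq {D : k} (hD : ¬ IsSquare D) {x : L} (hx : x ^ 2 = algebraMap k L D) :
    ∃ y : k, D * d.a = y ^ 2 := by
  obtain ⟨y, hy⟩ := d.exists_sub x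
  have h := d.algebraMap_trace x
  set t := Algebra.trace k L x
  have hσ : d.σ x ^ 2 = algebraMap k L D := by
    rw [← map_pow, hx, AlgEquiv.commutes]
  have h0 : (x - d.σ x) * (x + d.σ x) = 0 := by linear_combination hx - hσ
  rcases mul_eq_zero.mp h0 with h1 | h1
  · refine absurd ⟨t / 2, (algebraMap k L).injective ?_⟩ hD
    rw [map_mul, map_div₀, h, map_ofNat, ← hx]
    linear_combination (3 * x + d.σ x) / 4 * h1
  · refine ⟨y / 2, (algebraMap k L).injective ?_⟩
    have h2 : 2 * x = algebraMap k L y * d.θ := by linear_combination h1 + hy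
    have h3 : 4 * algebraMap k L D = (algebraMap k L y * d.θ) ^ 2 := by
      rw [← h2, ← hx]; ring
    rw [map_mul, map_pow, map_div₀, map_ofNat]
    linear_combination algebraMap k L d.a / 4 * h3 + (algebraMap k L y) ^ 2 / 4 * d.mul_sq

theorem not_isSquare {D y : k} (h : D * d.a = y ^ 2) (hD : D ≠ 0) : ¬ IsSquare D := by
  rintro ⟨s, rfl⟩
  have h1 := d.sq_mul_θ h
  rw [← pow_two, map_pow, sq_eq_sq_iff_eq_or_eq_neg] at h1
  have h2 : d.σ (algebraMap k L y * d.θ) = algebraMap k L y * d.θ := by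
    rcases h1 with h1 | h1
    · rw [h1, AlgEquiv.commutes]
    · rw [h1, map_neg, AlgEquiv.commutes]
  rw [map_mul, AlgEquiv.commutes, d.map_θ, mul_neg, neg_eq_self,
    mul_eq_zero, or_iff_left d.θ_ne_zero, FaithfulSMul.algebraMap_eq_zero_iff] at h2
  rw [h2, zero_pow two_ne_zero, mul_eq_zero, or_iff_left d.a_ne_zero] at h
  exact hD h

end

end QuadGen

/-- The quadratic extensions of `k` in its algebraic closure. -/
abbrev QuadExt : Type _ := {L : IntermediateField k (AlgebraicClosure k) // Module.finrank k L = 2}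

namespace QuadExt

variable {k}

instance (L : QuadExt k) : NumberField L.1 :=
  have : FiniteDimensional k L.1 := Module.finite_of_finrank_eq_succ L.2
  NumberField.of_module_finite k L.1

/-- A chosen generator of a quadratic extension. -/
def gen (L : QuadExt k) : QuadGen k L.1 := (QuadGen.nonempty_of_finrank L.1 L.2).some

theorem le_of_sq_eq {L L' : QuadExt k} (d : QuadGen k L.1) (d' : QuadGen k L'.1) {D y y' : k}
    (hD : D ≠ 0) (h : D * d.a = y ^ 2) (h' : D * d'.a = y' ^ 2) : L.1 ≤ L'.1 := by
  let i := algebraMap L.1 (AlgebraicClosure k)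
  let i' := algebraMap L'.1 (AlgebraicClosure k)
  have h1 : i (algebraMap k L.1 y * d.θ) ^ 2 = i' (algebraMap k L'.1 y' * d'.θ) ^ 2 := by
    rw [← map_pow, d.sq_mul_θ h, ← map_pow, d'.sq_mul_θ h']
    rfl
  have h2 : ((algebraMap k L.1 y * d.θ : L.1) : AlgebraicClosure k) ∈ L'.1 := by
    rcases sq_eq_sq_iff_eq_or_eq_neg.mp h1 with h3 | h3
    · change i (algebraMap k L.1 y * d.θ) ∈ L'.1
      rw [h3]
      exact (algebraMap k L'.1 y' * d'.θ : L'.1).2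
    · change i (algebraMap k L.1 y * d.θ) ∈ L'.1
      rw [h3]
      exact neg_mem (algebraMap k L'.1 y' * d'.θ : L'.1).2
  have hy : y ≠ 0 := by
    rintro rfl
    rw [zero_pow two_ne_zero] at h
    exact (mul_ne_zero hD d.a_ne_zero) h
  have h3 : (d.θ : AlgebraicClosure k) ∈ L'.1 := by
    have h4 : (d.θ : AlgebraicClosure k) = algebraMap k (AlgebraicClosure k) y⁻¹ *
        ((algebraMap k L.1 y * d.θ : L.1) : AlgebraicClosure k) := by
      change _ = _ * (algebraMap k (AlgebraicClosure k) y * (d.θ : AlgebraicClosure k))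
      rw [← mul_assoc, ← map_mul, inv_mul_cancel₀ hy, map_one, one_mul]
    rw [h4]
    exact mul_mem (L'.1.algebraMap_mem _) h2
  intro v hv
  obtain ⟨t, z, htz⟩ := d.span ⟨v, hv⟩
  have htz' : 2 * v = algebraMap k (AlgebraicClosure k) t + algebraMap k (AlgebraicClosure k) z *
      (d.θ : AlgebraicClosure k) := congrArg (fun x : L.1 => (x : AlgebraicClosure k)) htz
  have : v = algebraMap k (AlgebraicClosure k) (1 / 2) * (2 * v) := by
    rw [map_div₀, map_one, map_ofNat]; ring
  rw [this, htz']
  exact mul_mem (L'.1.algebraMap_mem _)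
    (add_mem (L'.1.algebraMap_mem _) (mul_mem (L'.1.algebraMap_mem _) h3))

theorem eq_of_sq_eq {L L' : QuadExt k} (d : QuadGen k L.1) (d' : QuadGen k L'.1) {D y y' : k}
    (hD : D ≠ 0) (h : D * d.a = y ^ 2) (h' : D * d'.a = y' ^ 2) : L = L' :=
  Subtype.ext (le_antisymm (le_of_sq_eq d d' hD h h') (le_of_sq_eq d' d hD h' h))

theorem exists_of_not_isSquare {D : k} (hD : ¬ IsSquare D) :
    ∃ L : QuadExt k, ∃ x : L.1, x ^ 2 = algebraMap k L.1 D := by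
  obtain ⟨x, hx⟩ := IsAlgClosed.exists_pow_nat_eq (algebraMap k (AlgebraicClosure k) D) two_pos
  have hirr : Irreducible (Polynomial.X ^ 2 - Polynomial.C D) := by
    refine X_pow_sub_C_irreducible_of_prime Nat.prime_two fun b hb => hD ⟨b, ?_⟩
    rw [← hb, pow_two]
  have hmin : minpoly k x = Polynomial.X ^ 2 - Polynomial.C D := by
    refine (minpoly.eq_of_irreducible_of_monic hirr ?_ (Polynomial.monic_X_pow_sub_C _ two_ne_zero)).symm
    simp [hx]
  have h_integral : IsIntegral k x := Algebra.IsIntegral.isIntegral x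
  refine ⟨⟨IntermediateField.adjoin k {x}, ?_⟩, ⟨x, IntermediateField.mem_adjoin_simple_self k x⟩, ?_⟩
  · rw [IntermediateField.adjoin.finrank h_integral, hmin, Polynomial.natDegree_X_pow_sub_C]
  · exact Subtype.ext hx

/-- The norm of the relative discriminant. -/
def disc (L : QuadExt k) : ℝ := relDiscNorm k L.1

theorem disc_eq (L : QuadExt k) :
    L.disc = Ideal.absNorm (differentIdeal (𝓞 k) (𝓞 L.1)) := by
  have h : absDisc L.1 = (NumberField.discr L.1).natAbs := by
    rw [absDisc, dif_pos (inferInstance : FiniteDimensional ℚ L.1)]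
  rw [disc, relDiscNorm, h,
    NumberField.natAbs_discr_eq_absNorm_differentIdeal_mul_natAbs_discr_pow k (𝓞 k) L.1 (𝓞 L.1), L.2]
  have : ((discr k).natAbs : ℝ) ≠ 0 :=
    Nat.cast_ne_zero.mpr (Int.natAbs_ne_zero.mpr (discr_ne_zero k))
  push_cast
  field_simp

theorem disc_mul (L : QuadExt k) :
    L.disc * absNormReal (L.gen.a : k) = (Ideal.absNorm L.gen.ideal : ℝ) ^ 2 := by
  have h : absNormReal (L.gen.a : k) = ((Algebra.norm ℤ L.gen.a).natAbs : ℝ) := by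
    rw [absNormReal, ← Algebra.coe_norm_int, Nat.cast_natAbs]
    push_cast
    rfl
  rw [disc_eq, h]
  exact_mod_cast L.gen.absNorm_differentIdeal

end QuadExt

end QuadraticExtensions

section UnitSquares

open NumberField.Units

/-- The subgroup of squares in the unit group. -/
abbrev unitSquares : Subgroup (𝓞 k)ˣ := (powMonoidHom 2 : (𝓞 k)ˣ →* (𝓞 k)ˣ).range

/-- The decomposition of the unit group into its torsion and its free part. -/
def torsionProdHom : Additive (torsion k) × (Fin (rank k) → ℤ) →+ Additive (𝓞 k)ˣ where
  toFun p := Additive.ofMul (((p.1.toMul : torsion k) : (𝓞 k)ˣ) * ∏ i, fundSystem k i ^ p.2 i)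
  map_zero' := by simp
  map_add' p q := by
    rw [← ofMul_mul]
    congr 1
    simp only [Prod.fst_add, toMul_add, Subgroup.coe_mul, Prod.snd_add, Pi.add_apply, zpow_add,
      Finset.prod_mul_distrib]
    exact mul_mul_mul_comm _ _ _ _

theorem torsionProdHom_bijective : Function.Bijective (torsionProdHom k) := by
  rw [Function.bijective_iff_existsUnique]
  intro x
  obtain ⟨⟨ζ, f⟩, h, h'⟩ := exist_unique_eq_mul_prod k x.toMul
  refine ⟨(Additive.ofMul ζ, f), congrArg Additive.ofMul h.symm, fun p hp => ?_⟩
  have := h' (p.1.toMul, p.2) (congrArg Additive.toMul hp.symm)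
  exact Prod.ext (congrArg (fun q => Additive.ofMul (Prod.fst q)) this) (congrArg Prod.snd this)

theorem index_unitSquares : (unitSquares k).index =
    2 ^ (InfinitePlace.nrRealPlaces k + InfinitePlace.nrComplexPlaces k) := by
  let e := AddEquiv.ofBijective _ (torsionProdHom_bijective k)
  have h1 : (nsmulAddMonoidHom 2 : Additive (𝓞 k)ˣ →+ _).range =
      ((nsmulAddMonoidHom 2 : Additive (torsion k) × (Fin (rank k) → ℤ) →+ _).range).map e := by
    ext x
    simp only [AddSubgroup.mem_map, AddMonoidHom.mem_range, nsmulAddMonoidHom_apply]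
    constructor
    · rintro ⟨y, rfl⟩
      exact ⟨2 • e.symm y, ⟨_, rfl⟩, by
        rw [map_nsmul]; exact congrArg (2 • ·) (e.apply_symm_apply y)⟩
    · rintro ⟨_, ⟨y, rfl⟩, rfl⟩
      exact ⟨e y, (map_nsmul e 2 y).symm⟩
  have h2 : (nsmulAddMonoidHom 2 : Additive (torsion k) × (Fin (rank k) → ℤ) →+ _).range =
      (nsmulAddMonoidHom 2 : Additive (torsion k) →+ _).range.prod
        (nsmulAddMonoidHom 2 : (Fin (rank k) → ℤ) →+ _).range := by
    ext x
    simp only [AddSubgroup.mem_prod, AddMonoidHom.mem_range, nsmulAddMonoidHom_apply]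
    constructor
    · rintro ⟨y, rfl⟩
      exact ⟨⟨_, rfl⟩, ⟨_, rfl⟩⟩
    · rintro ⟨⟨y, hy⟩, ⟨z, hz⟩⟩
      exact ⟨(y, z), Prod.ext hy hz⟩
  have h3 : (nsmulAddMonoidHom 2 : Additive (torsion k) →+ _).range.index = 2 := by
    have : (powMonoidHom 2 : torsion k →* torsion k).range.index = 2 := by
      rw [IsCyclic.index_powMonoidHom_range]
      exact Nat.gcd_eq_right (even_torsionOrder k).two_dvd
    exact this
  have h4 : (unitSquares k).index = (nsmulAddMonoidHom 2 : Additive (𝓞 k)ˣ →+ _).range.index := rfl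
  rw [h4, h1, AddSubgroup.index_map_equiv, h2, AddSubgroup.index_prod, h3,
    AddSubgroup.index_range_nsmul, Module.finrank_fin_fun, ← pow_succ', rank,
    Nat.sub_add_cancel (Fintype.card_pos), InfinitePlace.card_eq_nrRealPlaces_add_nrComplexPlaces]

instance : Finite ((𝓞 k)ˣ ⧸ unitSquares k) := by
  refine Subgroup.finiteIndex_iff_finite_quotient.mp ⟨?_⟩
  rw [index_unitSquares]
  positivity

instance : Fintype ((𝓞 k)ˣ ⧸ unitSquares k) := Fintype.ofFinite _

end UnitSquares

section Parametrization

open scoped nonZeroDivisors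

variable {k}

theorem unit_mul_mem_squareResidues {J : Ideal (𝓞 k)} (r : (𝓞 k)ˣ) {D : 𝓞 k} :
    (r : 𝓞 k) * D ∈ squareResidues (r : 𝓞 k) J ↔ D ∈ squareResidues 1 J := by
  simp only [squareResidues, Set.mem_ofPred_eq, mem_fourSq]
  constructor
  · rintro ⟨t, ht, n, hn, h⟩
    refine ⟨t, ht, (r⁻¹ : (𝓞 k)ˣ) * n, Ideal.mul_mem_left _ _ hn, ?_⟩
    have h1 : ((r⁻¹ : (𝓞 k)ˣ) : 𝓞 k) * r = 1 := r.inv_mul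
    linear_combination ((r⁻¹ : (𝓞 k)ˣ) : 𝓞 k) * h - (D - t ^ 2) * h1
  · rintro ⟨t, ht, n, hn, h⟩
    refine ⟨t, ht, r * n, Ideal.mul_mem_left _ _ hn, ?_⟩
    linear_combination (r : 𝓞 k) * h

theorem unit_ne_zero (u : (𝓞 k)ˣ) : ((u : 𝓞 k) : k) ≠ 0 :=
  RingOfIntegers.coe_ne_zero_iff.mpr u.ne_zero

theorem coe_unit_mul_inv (u : (𝓞 k)ˣ) : ((u : 𝓞 k) : k) * ((u⁻¹ : (𝓞 k)ˣ) : 𝓞 k) = 1 := by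
  rw [← Units.coe_mul, mul_inv_cancel, Units.coe_one]

theorem absNormReal_mul (x y : k) : absNormReal (x * y) = absNormReal x * absNormReal y := by
  simp [absNormReal, abs_mul]

theorem absNormReal_pow (x : k) (n : ℕ) : absNormReal (x ^ n) = absNormReal x ^ n := by
  simp [absNormReal]

theorem absNormReal_unit (u : (𝓞 k)ˣ) : absNormReal ((u : 𝓞 k) : k) = 1 := by
  have := NumberField.Units.norm k u
  rw [absNormReal]
  exact_mod_cast this

theorem absNormReal_pos {x : k} (hx : x ≠ 0) : 0 < absNormReal x := by
  rw [absNormReal, abs_pos]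
  exact_mod_cast Algebra.norm_ne_zero_iff.mpr hx

theorem absNormReal_of_spanSingleton {y : k} {I : Ideal (𝓞 k)}
    (h : FractionalIdeal.spanSingleton (𝓞 k)⁰ y = I) : absNormReal y = Ideal.absNorm I := by
  have h1 := FractionalIdeal.absNorm_span_singleton (R := 𝓞 k) y
  rw [h, FractionalIdeal.coeIdeal_absNorm] at h1
  rw [absNormReal]
  exact_mod_cast h1.symm

theorem spanSingleton_unit_mul (u : (𝓞 k)ˣ) (y : k) :
    FractionalIdeal.spanSingleton (𝓞 k)⁰ (((u : 𝓞 k) : k) * y) =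
      FractionalIdeal.spanSingleton (𝓞 k)⁰ y := by
  refine le_antisymm ?_ ?_
  · rw [FractionalIdeal.spanSingleton_le_iff_mem, FractionalIdeal.mem_spanSingleton]
    exact ⟨(u : 𝓞 k), by rw [Algebra.smul_def]⟩
  · rw [FractionalIdeal.spanSingleton_le_iff_mem, FractionalIdeal.mem_spanSingleton]
    refine ⟨((u⁻¹ : (𝓞 k)ˣ) : 𝓞 k), ?_⟩
    rw [Algebra.smul_def, ← mul_assoc, mul_comm (algebraMap _ _ _), coe_unit_mul_inv, one_mul]

theorem exists_unit_of_spanSingleton_eq {y z : k} (hy : y ≠ 0)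
    (h : FractionalIdeal.spanSingleton (𝓞 k)⁰ y = FractionalIdeal.spanSingleton (𝓞 k)⁰ z) :
    ∃ u : (𝓞 k)ˣ, z = ((u : 𝓞 k) : k) * y := by
  have h1 := FractionalIdeal.mem_spanSingleton_self (𝓞 k)⁰ y
  have h2 := FractionalIdeal.mem_spanSingleton_self (𝓞 k)⁰ z
  rw [h] at h1
  rw [← h] at h2
  obtain ⟨s, hs⟩ := (FractionalIdeal.mem_spanSingleton _).mp h1
  obtain ⟨t, ht⟩ := (FractionalIdeal.mem_spanSingleton _).mp h2
  rw [Algebra.smul_def] at hs ht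
  have hst : s * t = 1 := by
    apply RingOfIntegers.coe_injective
    rw [map_mul, map_one]
    apply mul_right_cancel₀ hy
    linear_combination hs + algebraMap (𝓞 k) k s * ht
  exact ⟨⟨t, s, by rw [mul_comm, hst], hst⟩, ht.symm⟩

theorem mem_unitSquares_iff_out (r r' : (𝓞 k)ˣ) :
    (QuotientGroup.mk r : (𝓞 k)ˣ ⧸ unitSquares k) = QuotientGroup.mk r' ↔
      ∃ ε : (𝓞 k)ˣ, r' = r * ε ^ 2 := by
  rw [QuotientGroup.eq]
  constructor
  · rintro ⟨ε, hε⟩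
    exact ⟨ε, by rw [show ε ^ 2 = r⁻¹ * r' from hε, mul_inv_cancel_left]⟩
  · rintro ⟨ε, rfl⟩
    exact ⟨ε, by simp⟩

/-- An integral ideal in a given ideal class. -/
def classRep (C : ClassGroup (𝓞 k)) : Ideal (𝓞 k) := (ClassGroup.mk0_surjective C).choose

theorem classRep_ne_bot (C : ClassGroup (𝓞 k)) : classRep C ≠ ⊥ :=
  nonZeroDivisors.ne_zero (ClassGroup.mk0_surjective C).choose.2

theorem mk0_classRep (C : ClassGroup (𝓞 k)) :
    ClassGroup.mk0 ⟨classRep C, mem_nonZeroDivisors_of_ne_zero (classRep_ne_bot C)⟩ = C :=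
  (ClassGroup.mk0_surjective C).choose_spec

variable (k)

/-- Parameters for discriminant elements: an ideal class, a class of units modulo squares and
an integer. -/
abbrev DiscParam := (ClassGroup (𝓞 k) × ((𝓞 k)ˣ ⧸ unitSquares k)) × 𝓞 k

variable {k}

/-- The parameter `q` corresponds to the quadratic extension `p.1` and the ideal `p.2`. -/
def IsParam (p : QuadExt k × Ideal (𝓞 k)) (q : DiscParam k) : Prop :=
  ∃ y : k, y ≠ 0 ∧ (q.2 : k) * p.1.gen.a = ((q.1.2.out : (𝓞 k)ˣ) : 𝓞 k) * y ^ 2 ∧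
    FractionalIdeal.spanSingleton (𝓞 k)⁰ y = (p.2 * (classRep q.1.1 * p.1.gen.ideal) :
      Ideal (𝓞 k)) ∧ q.2 ∈ coneSet k

theorem unit_smul_mem_coneSet_iff (u : (𝓞 k)ˣ) {D : 𝓞 k} (hD : D ∈ coneSet k) :
    (u : 𝓞 k) * D ∈ coneSet k ↔ u ∈ NumberField.Units.torsion k := by
  rw [← NumberField.mixedEmbedding.fundamentalCone.unit_smul_mem_iff_mem_torsion hD u]
  rw [coneSet, Set.mem_ofPred_eq, mixedEmbedding.unitSMul_smul, ← map_mul,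
    RingOfIntegers.coe_eq_algebraMap (_ * D), map_mul]

theorem ne_zero_of_mem_coneSet {D : 𝓞 k} (hD : D ∈ coneSet k) : D ≠ 0 := by
  rintro rfl
  have := NumberField.mixedEmbedding.fundamentalCone.norm_pos_of_mem hD
  simp at this

namespace IsParam

variable {p : QuadExt k × Ideal (𝓞 k)} {q : DiscParam k}

theorem ideal_ne_bot (h : IsParam p q) : p.2 ≠ ⊥ := by
  obtain ⟨y, hy, -, hs, -⟩ := h
  intro h0
  rw [h0, ← Ideal.zero_eq_bot, zero_mul, Ideal.zero_eq_bot, FractionalIdeal.coeIdeal_bot,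
    FractionalIdeal.spanSingleton_eq_zero_iff] at hs
  exact hy hs

theorem exists_eq_unit_mul (h : IsParam p q) : ∃ (D : 𝓞 k) (y : k), y ≠ 0 ∧
    q.2 = (q.1.2.out : (𝓞 k)ˣ) * D ∧ (D : k) * p.1.gen.a = y ^ 2 ∧
    FractionalIdeal.spanSingleton (𝓞 k)⁰ y = (p.2 * (classRep q.1.1 * p.1.gen.ideal) :
      Ideal (𝓞 k)) := by
  obtain ⟨y, hy, hq, hs, -⟩ := h
  have h1 := coe_unit_mul_inv q.1.2.out
  refine ⟨((q.1.2.out⁻¹ : (𝓞 k)ˣ) : 𝓞 k) * q.2, y, hy, ?_, ?_, hs⟩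
  · rw [← mul_assoc, Units.mul_inv, one_mul]
  · rw [RingOfIntegers.coe_eq_algebraMap (_ * q.2), map_mul]
    linear_combination (((q.1.2.out⁻¹ : (𝓞 k)ˣ) : 𝓞 k) : k) * hq + y ^ 2 * h1

theorem mem_squareResidues (h : IsParam p q) :
    q.2 ∈ squareResidues ((q.1.2.out : (𝓞 k)ˣ) : 𝓞 k) (classRep q.1.1) := by
  obtain ⟨D, y, hy, hq, hD, hs⟩ := h.exists_eq_unit_mul
  rw [hq, unit_mul_mem_squareResidues, mem_squareResidues_one_iff _ (classRep_ne_bot _) hD]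
  rw [← FractionalIdeal.spanSingleton_le_iff_mem, hs]
  exact FractionalIdeal.coeIdeal_le_coeIdeal _ |>.mpr Ideal.mul_le_right

theorem absNormReal_eq (h : IsParam p q) : absNormReal (q.2 : k) =
    (Ideal.absNorm p.2 : ℝ) ^ 2 * p.1.disc * (Ideal.absNorm (classRep q.1.1) : ℝ) ^ 2 := by
  obtain ⟨y, hy, hq, hs, -⟩ := h
  have h1 := congrArg absNormReal hq
  rw [absNormReal_mul, absNormReal_mul, absNormReal_pow, absNormReal_unit, one_mul,
    absNormReal_of_spanSingleton hs, map_mul, map_mul] at h1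
  have h2 := p.1.disc_mul
  have h3 := absNormReal_pos p.1.gen.a_ne_zero
  apply mul_right_cancel₀ h3.ne'
  push_cast at h1
  rw [h1, mul_pow, mul_pow, ← h2]
  ring

theorem not_isSquare (h : IsParam p q) (s : 𝓞 k) : q.2 ≠ (q.1.2.out : (𝓞 k)ˣ) * s ^ 2 := by
  obtain ⟨D, y, hy, hq, hD, hs⟩ := h.exists_eq_unit_mul
  rw [hq]
  intro h1
  have h2 : D = s ^ 2 := (q.1.2.out : (𝓞 k)ˣ).isUnit.mul_left_cancel h1
  refine p.1.gen.not_isSquare hD ?_ ⟨(s : k), by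
    rw [h2, RingOfIntegers.coe_eq_algebraMap (s ^ 2), map_pow, pow_two]⟩
  intro h0
  rw [h0, zero_mul] at hD
  exact hy (pow_eq_zero_iff two_ne_zero |>.mp hD.symm)

theorem unique {p' : QuadExt k × Ideal (𝓞 k)} (h : IsParam p q) (h' : IsParam p' q) : p = p' := by
  obtain ⟨D, y, hy, hq, hD, hs⟩ := h.exists_eq_unit_mul
  obtain ⟨D', y', hy', hq', hD', hs'⟩ := h'.exists_eq_unit_mul
  have hDD : D' = D := (q.1.2.out : (𝓞 k)ˣ).isUnit.mul_left_cancel (hq'.symm.trans hq)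
  subst hDD
  obtain ⟨L, g⟩ := p
  obtain ⟨L', g'⟩ := p'
  have hD0 : (D' : k) ≠ 0 := by
    intro h0
    rw [h0, zero_mul] at hD
    exact hy (pow_eq_zero_iff two_ne_zero |>.mp hD.symm)
  obtain rfl : L = L' := QuadExt.eq_of_sq_eq _ _ hD0 hD hD'
  congr 1
  have h1 : FractionalIdeal.spanSingleton (𝓞 k)⁰ y = FractionalIdeal.spanSingleton (𝓞 k)⁰ y' := by
    rcases sq_eq_sq_iff_eq_or_eq_neg.mp (hD.symm.trans hD') with h2 | h2
    · rw [h2]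
    · rw [h2, ← spanSingleton_unit_mul (-1) y']
      congr 1
      rw [Units.val_neg, Units.val_one, RingOfIntegers.coe_eq_algebraMap, map_neg, map_one,
        neg_one_mul]
  rw [hs, hs'] at h1
  exact mul_right_cancel₀ (mul_ne_zero (classRep_ne_bot _) L.gen.ideal_ne_bot)
    (FractionalIdeal.coeIdeal_injective h1)

end IsParam

theorem exists_isParam_of_not_square {q : DiscParam k} (hq : q.2 ∈ coneSet k)
    (hJ : q.2 ∈ squareResidues ((q.1.2.out : (𝓞 k)ˣ) : 𝓞 k) (classRep q.1.1))
    (hs : ∀ s : 𝓞 k, q.2 ≠ (q.1.2.out : (𝓞 k)ˣ) * s ^ 2) : ∃ p, IsParam p q := by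
  obtain ⟨D, hD⟩ : ∃ D : 𝓞 k, q.2 = (q.1.2.out : (𝓞 k)ˣ) * D :=
    ⟨((q.1.2.out⁻¹ : (𝓞 k)ˣ) : 𝓞 k) * q.2, by rw [← mul_assoc, Units.mul_inv, one_mul]⟩
  have hns : ¬ IsSquare (D : k) := by
    rintro ⟨s, h⟩
    have hi : IsIntegral ℤ s := by
      refine IsIntegral.of_pow two_pos ?_
      rw [pow_two, ← h]
      exact D.isIntegral_coe
    obtain ⟨t, ht⟩ : ∃ t : 𝓞 k, algebraMap _ _ t = s := ⟨⟨s, hi⟩, rfl⟩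
    refine hs t ?_
    rw [hD]
    congr 1
    apply RingOfIntegers.coe_injective
    rw [map_pow, pow_two, ht]
    exact h
  have hD0 : (D : k) ≠ 0 := fun h => hns (h ▸ IsSquare.zero)
  obtain ⟨L, x, hx⟩ := QuadExt.exists_of_not_isSquare hns
  obtain ⟨y, hy⟩ := L.gen.exists_mul_a_eq_sq hns hx
  have hy0 : y ≠ 0 := by
    rintro rfl
    rw [zero_pow two_ne_zero] at hy
    exact mul_ne_zero hD0 L.gen.a_ne_zero hy
  rw [hD, unit_mul_mem_squareResidues, mem_squareResidues_one_iff _ (classRep_ne_bot _) hy,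
    ← FractionalIdeal.spanSingleton_le_iff_mem] at hJ
  set B := classRep q.1.1 * L.gen.ideal with hB
  have hB0 : (B : FractionalIdeal (𝓞 k)⁰ k) ≠ 0 :=
    FractionalIdeal.coeIdeal_ne_zero.mpr (mul_ne_zero (classRep_ne_bot _) L.gen.ideal_ne_bot)
  obtain ⟨g, hg⟩ : ∃ g : Ideal (𝓞 k), (g : FractionalIdeal (𝓞 k)⁰ k) =
      FractionalIdeal.spanSingleton (𝓞 k)⁰ y * (B : FractionalIdeal (𝓞 k)⁰ k)⁻¹ := by
    refine FractionalIdeal.le_one_iff_exists_coeIdeal.mp ?_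
    rw [← mul_inv_cancel₀ hB0]
    gcongr
  refine ⟨(L, g), y, hy0, ?_, ?_, hq⟩
  · have := congrArg (algebraMap (𝓞 k) k) hD
    rw [map_mul] at this
    rw [← hy, ← mul_assoc]
    exact congrArg (· * (L.gen.a : k)) this
  · rw [FractionalIdeal.coeIdeal_mul, hg, inv_mul_cancel_right₀ hB0]

theorem exists_isParam (p : QuadExt k × Ideal (𝓞 k)) (hp : p.2 ≠ ⊥) : ∃ q, IsParam p q := by
  obtain ⟨L, g⟩ := p
  have hgb : g * L.gen.ideal ≠ 0 := mul_ne_zero hp L.gen.ideal_ne_bot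
  set C : ClassGroup (𝓞 k) :=
    (ClassGroup.mk0 ⟨g * L.gen.ideal, mem_nonZeroDivisors_of_ne_zero hgb⟩)⁻¹ with hC
  have h1 : ClassGroup.mk0 (⟨g * L.gen.ideal, mem_nonZeroDivisors_of_ne_zero hgb⟩ *
      ⟨classRep C, mem_nonZeroDivisors_of_ne_zero (classRep_ne_bot C)⟩) = 1 := by
    rw [map_mul, mk0_classRep, hC, mul_inv_cancel]
  rw [ClassGroup.mk0_eq_one_iff] at h1
  obtain ⟨z, hz⟩ := h1
  have hz' : g * (classRep C * L.gen.ideal) = Ideal.span {z} := by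
    rw [← mul_assoc, mul_right_comm]
    exact hz
  have hz0 : z ≠ 0 := by
    rintro rfl
    rw [Set.singleton_zero, Ideal.span_zero] at hz'
    exact mul_ne_zero hp (mul_ne_zero (classRep_ne_bot C) L.gen.ideal_ne_bot) hz'
  have hzk : (z : k) ≠ 0 := RingOfIntegers.coe_ne_zero_iff.mpr hz0
  have hzb : z ∈ L.gen.ideal := by
    have : z ∈ g * (classRep C * L.gen.ideal) := hz' ▸ Ideal.mem_span_singleton_self z
    exact Ideal.mul_le_right (Ideal.mul_le_right this)
  have ha := L.gen.a_ne_zero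
  obtain ⟨D, hD⟩ : ∃ D : 𝓞 k, algebraMap (𝓞 k) k D = (z : k) ^ 2 / L.gen.a := by
    obtain ⟨v, hv, hvz⟩ := L.gen.mem_ideal.mp hzb
    have h2 : IsIntegral ℤ (algebraMap k L.1 z * L.gen.θ) := hvz ▸ hv.sub (L.gen.isIntegral_map hv)
    refine ⟨⟨(z : k) ^ 2 / L.gen.a, ?_⟩, rfl⟩
    change IsIntegral ℤ _
    rw [← QuadGen.isIntegral_algebraMap_iff (L := L.1)]
    convert! h2.pow 2 using 1
    have h3 := L.gen.mul_sq
    have h4 : algebraMap k L.1 L.gen.a ≠ 0 := by simpa using ha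
    rw [map_div₀, map_pow, div_eq_iff h4]
    linear_combination -(algebraMap k L.1 z) ^ 2 * h3
  have hDa : (D : k) * L.gen.a = (z : k) ^ 2 := by
    rw [RingOfIntegers.coe_eq_algebraMap D, hD, div_mul_cancel₀ _ ha]
  have hD0 : (D : k) ≠ 0 := by
    intro h0
    rw [h0, zero_mul] at hDa
    exact pow_ne_zero 2 hzk hDa.symm
  obtain ⟨η, hη⟩ := NumberField.mixedEmbedding.fundamentalCone.exists_unit_smul_mem
    (K := k) (x := mixedEmbedding k (D : k)) (by
      rw [norm_mixedEmbedding_eq]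
      exact (absNormReal_pos hD0).ne')
  obtain ⟨ε, hε⟩ := (mem_unitSquares_iff_out
    ((QuotientGroup.mk η : (𝓞 k)ˣ ⧸ unitSquares k).out) η).mp (Quotient.out_eq _)
  refine ⟨((C, QuotientGroup.mk η), η * D), ((ε : 𝓞 k) : k) * z, mul_ne_zero (unit_ne_zero ε) hzk,
    ?_, ?_, ?_⟩
  · have h5 := congrArg (fun u : (𝓞 k)ˣ => algebraMap (𝓞 k) k u) hε
    simp only [Units.val_mul, Units.val_pow_eq_pow_val, map_mul, map_pow] at h5
    dsimp only
    rw [RingOfIntegers.coe_eq_algebraMap (_ * D), map_mul]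
    linear_combination ((η : 𝓞 k) : k) * hDa + (z : k) ^ 2 * h5
  · rw [spanSingleton_unit_mul]
    dsimp only
    rw [hz', FractionalIdeal.coeIdeal_span_singleton]
  · rw [mixedEmbedding.unitSMul_smul, ← map_mul] at hη
    rw [coneSet, Set.mem_ofPred_eq, RingOfIntegers.coe_eq_algebraMap (_ * D), map_mul]
    exact hη

/-- The action of a unit on parameters. -/
def unitAct (u : (𝓞 k)ˣ) (q : DiscParam k) : DiscParam k :=
  ((q.1.1, QuotientGroup.mk u * q.1.2), u * q.2)

theorem IsParam.act {p : QuadExt k × Ideal (𝓞 k)} {q : DiscParam k} (h : IsParam p q)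
    {u : (𝓞 k)ˣ} (hu : u ∈ NumberField.Units.torsion k) : IsParam p (unitAct u q) := by
  obtain ⟨y, hy, hq, hs, hc⟩ := h
  obtain ⟨ε, hε⟩ := (mem_unitSquares_iff_out
    ((QuotientGroup.mk u * q.1.2 : (𝓞 k)ˣ ⧸ unitSquares k).out) (u * q.1.2.out)).mp (by
      rw [QuotientGroup.mk_mul]
      exact (Quotient.out_eq _).trans (congrArg _ (Quotient.out_eq _).symm))
  refine ⟨((ε : 𝓞 k) : k) * y, mul_ne_zero (unit_ne_zero ε) hy, ?_, ?_, ?_⟩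
  · have h5 := congrArg (fun u : (𝓞 k)ˣ => algebraMap (𝓞 k) k u) hε
    simp only [Units.val_mul, Units.val_pow_eq_pow_val, map_mul, map_pow] at h5
    dsimp only [unitAct]
    rw [RingOfIntegers.coe_eq_algebraMap (_ * q.2), map_mul]
    linear_combination ((u : 𝓞 k) : k) * hq + y ^ 2 * h5
  · rw [spanSingleton_unit_mul]
    exact hs
  · exact (unit_smul_mem_coneSet_iff u hc).mpr hu

theorem IsParam.exists_unitAct {p : QuadExt k × Ideal (𝓞 k)} {q q' : DiscParam k}
    (h : IsParam p q) (h' : IsParam p q') :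
    ∃ u ∈ NumberField.Units.torsion k, q' = unitAct u q := by
  have hg := h.ideal_ne_bot
  obtain ⟨y, hy, hq, hs, hc⟩ := h
  obtain ⟨y', hy', hq', hs', hc'⟩ := h'
  have hC : q'.1.1 = q.1.1 := by
    rw [← mk0_classRep q.1.1, ← mk0_classRep q'.1.1, eq_comm,
      ClassGroup.mk0_eq_mk0_iff_exists_fraction_ring (K := k)]
    refine ⟨y' / y, div_ne_zero hy' hy, ?_⟩
    have hA : ((p.2 * p.1.gen.ideal : Ideal (𝓞 k)) : FractionalIdeal (𝓞 k)⁰ k) ≠ 0 :=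
      FractionalIdeal.coeIdeal_ne_zero.mpr (mul_ne_zero hg p.1.gen.ideal_ne_bot)
    apply mul_left_cancel₀ hA
    rw [mul_left_comm, ← FractionalIdeal.coeIdeal_mul, ← FractionalIdeal.coeIdeal_mul, mul_assoc,
      mul_assoc, mul_comm p.1.gen.ideal, mul_comm p.1.gen.ideal, ← hs, ← hs',
      FractionalIdeal.spanSingleton_mul_spanSingleton, div_mul_cancel₀ _ hy]
  rw [hC, ← hs] at hs'
  obtain ⟨ε, rfl⟩ := exists_unit_of_spanSingleton_eq hy hs'.symm
  have ha := p.1.gen.a_ne_zero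
  set u : (𝓞 k)ˣ := q'.1.2.out * ε ^ 2 * q.1.2.out⁻¹ with hu
  have hu' : q'.1.2.out * ε ^ 2 = u * q.1.2.out := by rw [hu, inv_mul_cancel_right]
  have hqq : q'.2 = u * q.2 := by
    have h5 := congrArg (fun u : (𝓞 k)ˣ => algebraMap (𝓞 k) k u) hu'
    simp only [Units.val_mul, Units.val_pow_eq_pow_val, map_mul, map_pow] at h5
    apply RingOfIntegers.coe_injective
    rw [map_mul]
    apply mul_right_cancel₀ ha
    linear_combination hq' - ((u : 𝓞 k) : k) * hq + y ^ 2 * h5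
  have hut : u ∈ NumberField.Units.torsion k :=
    (unit_smul_mem_coneSet_iff u hc).mp (hqq ▸ hc')
  refine ⟨u, hut, ?_⟩
  refine Prod.ext (Prod.ext hC ?_) hqq
  have h6 := (mem_unitSquares_iff_out q'.1.2.out (u * q.1.2.out)).mpr ⟨ε, hu'.symm⟩
  rw [QuotientGroup.mk_mul] at h6
  exact (Quotient.out_eq _).symm.trans (h6.trans (congrArg _ (Quotient.out_eq _)))

theorem unitAct_injective {q : DiscParam k} (hq : q.2 ≠ 0) {u v : (𝓞 k)ˣ}
    (h : unitAct u q = unitAct v q) : u = v :=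
  Units.ext (mul_right_cancel₀ hq (congrArg Prod.snd h))

end Parametrization

section Counting

open NumberField.Units NumberField.InfinitePlace

/-- Pairs of a quadratic extension and a nonzero ideal, of bounded weight. -/
def pairs (X : ℝ) : Set (QuadExt k × Ideal (𝓞 k)) :=
  {p | p.2 ≠ ⊥ ∧ p.1.disc * (Ideal.absNorm p.2 : ℝ) ^ 2 ≤ X}

/-- The parameters of bounded norm. -/
def params (X : ℝ) : Set (DiscParam k) :=
  {q | q.2 ∈ conePoints k (squareResidues ((q.1.2.out : (𝓞 k)ˣ) : 𝓞 k) (classRep q.1.1))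
    ((Ideal.absNorm (classRep q.1.1) : ℝ) ^ 2 * X)}

/-- Integers which are a given unit times a square. -/
def unitMulSquares (r : (𝓞 k)ˣ) : Set (𝓞 k) := {D | ∃ s : 𝓞 k, D = r * s ^ 2}

/-- The parameters of bounded norm which do not correspond to a field extension. -/
def squareParams (X : ℝ) : Set (DiscParam k) :=
  {q ∈ params k X | q.2 ∈ unitMulSquares k q.1.2.out}

theorem IsParam.mem_params_iff {p : QuadExt k × Ideal (𝓞 k)} {q : DiscParam k} (h : IsParam p q)
    (X : ℝ) : q ∈ params k X ↔ p ∈ pairs k X := by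
  have hJ : (0 : ℝ) < (Ideal.absNorm (classRep q.1.1) : ℝ) ^ 2 := by
    have := Ideal.absNorm_eq_zero_iff.not.mpr (classRep_ne_bot q.1.1)
    positivity
  have hc : q.2 ∈ coneSet k := by
    obtain ⟨y, -, -, -, hc⟩ := h
    exact hc
  rw [params, pairs, Set.mem_ofPred_eq, Set.mem_ofPred_eq, conePoints, Set.mem_ofPred_eq,
    and_iff_right h.mem_squareResidues, and_iff_right hc, and_iff_right h.ideal_ne_bot,
    h.absNormReal_eq, mul_comm, mul_le_mul_iff_right₀ hJ, mul_comm]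

variable {k} in
/-- The parametrization of pairs up to torsion. -/
def paramMap (x : (QuadExt k × Ideal (𝓞 k)) × torsion k) : DiscParam k :=
  if h : x.1.2 ≠ ⊥ then unitAct (x.2 : (𝓞 k)ˣ) (exists_isParam x.1 h).choose else ((1, 1), 0)

theorem bijOn_paramMap (X : ℝ) :
    Set.BijOn paramMap (pairs k X ×ˢ Set.univ) (params k X \ squareParams k X) := by
  have key : ∀ p : QuadExt k × Ideal (𝓞 k), p.2 ≠ ⊥ → ∃ q, IsParam p q ∧
      ∀ ζ : torsion k, paramMap (p, ζ) = unitAct (ζ : (𝓞 k)ˣ) q := fun p hp =>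
    ⟨_, (exists_isParam p hp).choose_spec, fun ζ => dif_pos hp⟩
  refine ⟨?_, ?_, ?_⟩
  · rintro ⟨p, ζ⟩ ⟨hp, -⟩
    obtain ⟨q, hq, h⟩ := key p hp.1
    rw [h]
    have h1 := hq.act ζ.2
    refine ⟨(h1.mem_params_iff k X).mpr hp, fun h2 => ?_⟩
    obtain ⟨s, hs⟩ := h2.2
    exact h1.not_isSquare s hs
  · rintro ⟨p, ζ⟩ ⟨hp, -⟩ ⟨p', ζ'⟩ ⟨hp', -⟩ he
    obtain ⟨q, hq, h⟩ := key p hp.1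
    obtain ⟨q', hq', h'⟩ := key p' hp'.1
    have he0 := he
    rw [h, h'] at he
    obtain rfl : p = p' := (hq.act ζ.2).unique (he ▸ hq'.act ζ'.2)
    rw [h, h] at he0
    obtain ⟨y, -, -, -, hc⟩ := hq
    rw [Subtype.ext (unitAct_injective (ne_zero_of_mem_coneSet hc) he0)]
  · rintro q ⟨hq, hq'⟩
    obtain ⟨p, hp⟩ := exists_isParam_of_not_square hq.2.1 hq.1 fun s hs => hq' ⟨hq, s, hs⟩
    obtain ⟨q0, hq0, h⟩ := key p hp.ideal_ne_bot
    obtain ⟨u, hu, rfl⟩ := hq0.exists_unitAct hp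
    exact ⟨(p, ⟨u, hu⟩), ⟨(hp.mem_params_iff k X).mp hq, trivial⟩, h _⟩

theorem finite_setOf_mem {α β : Type*} [Finite α] {A : α → Set β} (hA : ∀ a, (A a).Finite) :
    {q : α × β | q.2 ∈ A q.1}.Finite := by
  refine (Set.finite_iUnion fun a => (hA a).image (Prod.mk a)).subset ?_
  rintro ⟨a, b⟩ h
  exact Set.mem_iUnion.mpr ⟨a, b, h, rfl⟩

theorem ncard_setOf_mem {α β : Type*} [Fintype α] {A : α → Set β} (hA : ∀ a, (A a).Finite) :
    {q : α × β | q.2 ∈ A q.1}.ncard = ∑ a, (A a).ncard := by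
  have e : {q : α × β | q.2 ∈ A q.1} ≃ Σ a, A a :=
    { toFun := fun q => ⟨q.1.1, q.1.2, q.2⟩
      invFun := fun s => ⟨(s.1, s.2.1), s.2.2⟩
      left_inv := fun _ => rfl
      right_inv := fun _ => rfl }
  have := fun a => (hA a).to_subtype
  rw [← Nat.card_coe_set_eq, Nat.card_congr e, Nat.card_sigma]
  rfl

theorem finite_params (X : ℝ) : (params k X).Finite :=
  finite_setOf_mem (A := fun a : ClassGroup (𝓞 k) × ((𝓞 k)ˣ ⧸ unitSquares k) =>
    conePoints k (squareResidues ((a.2.out : (𝓞 k)ˣ) : 𝓞 k) (classRep a.1))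
      ((Ideal.absNorm (classRep a.1) : ℝ) ^ 2 * X)) fun _ => finite_conePoints k _ _

theorem ncard_params (X : ℝ) : (params k X).ncard =
    ∑ a : ClassGroup (𝓞 k) × ((𝓞 k)ˣ ⧸ unitSquares k),
      (conePoints k (squareResidues ((a.2.out : (𝓞 k)ˣ) : 𝓞 k) (classRep a.1))
        ((Ideal.absNorm (classRep a.1) : ℝ) ^ 2 * X)).ncard :=
  ncard_setOf_mem (A := fun a : ClassGroup (𝓞 k) × ((𝓞 k)ˣ ⧸ unitSquares k) =>
    conePoints k (squareResidues ((a.2.out : (𝓞 k)ˣ) : 𝓞 k) (classRep a.1))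
      ((Ideal.absNorm (classRep a.1) : ℝ) ^ 2 * X)) fun _ => finite_conePoints k _ _

theorem finite_pairs (X : ℝ) : (pairs k X).Finite := by
  have h := bijOn_paramMap k X
  have h1 : (pairs k X ×ˢ (Set.univ : Set (torsion k))).Finite :=
    Set.Finite.of_finite_image (h.image_eq ▸ (finite_params k X).subset Set.sdiff_subset) h.injOn
  refine (h1.image Prod.fst).subset fun p hp => ⟨(p, 1), ⟨hp, trivial⟩, rfl⟩

theorem ncard_pairs_mul (X : ℝ) :
    (pairs k X).ncard * torsionOrder k + (squareParams k X).ncard = (params k X).ncard := by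
  have h := (bijOn_paramMap k X).ncard_eq
  rw [Set.ncard_prod, Set.ncard_univ] at h
  rw [torsionOrder, h]
  exact Set.ncard_sdiff_add_ncard_of_subset (Set.sep_subset _ _) (finite_params k X)

theorem tendsto_params : Tendsto (fun X : ℝ => ((params k X).ncard : ℝ) / X) atTop
    (𝓝 (torsionOrder k * (1 / 2 ^ nrComplexPlaces k * dedekindZeta_residue k))) := by
  have h1 : ∀ a : ClassGroup (𝓞 k) × ((𝓞 k)ˣ ⧸ unitSquares k),
      Tendsto (fun X : ℝ =>
        ((conePoints k (squareResidues ((a.2.out : (𝓞 k)ˣ) : 𝓞 k) (classRep a.1))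
        ((Ideal.absNorm (classRep a.1) : ℝ) ^ 2 * X)).ncard : ℝ) / X) atTop
      (𝓝 (torsionOrder k * dedekindZeta_residue k / classNumber k / 2 ^ Module.finrank ℚ k)) := by
    intro a
    have hJ : (0 : ℝ) < (Ideal.absNorm (classRep a.1) : ℝ) ^ 2 := by
      have := Ideal.absNorm_eq_zero_iff.not.mpr (classRep_ne_bot a.1)
      positivity
    have hJ' : (Ideal.absNorm (classRep a.1) : ℝ) ≠ 0 := pow_ne_zero_iff two_ne_zero |>.mp hJ.ne'
    have h2 := ((tendsto_squareResidues (classRep_ne_bot a.1) a.2.out).comp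
      (tendsto_id.const_mul_atTop hJ)).const_mul ((Ideal.absNorm (classRep a.1) : ℝ) ^ 2)
    convert! h2 using 2
    · simp only [Function.comp_apply, id]
      field_simp
    · field_simp
  have h3 := tendsto_finsetSum Finset.univ fun a _ => h1 a
  convert! h3 using 2
  · rw [ncard_params, Nat.cast_sum, Finset.sum_div]
  · have hc : (Fintype.card ((𝓞 k)ˣ ⧸ unitSquares k) : ℝ) =
        2 ^ (nrRealPlaces k + nrComplexPlaces k) := by
      rw [← Nat.card_eq_fintype_card]
      exact_mod_cast index_unitSquares k
    have hh : (classNumber k : ℝ) ≠ 0 := Nat.cast_ne_zero.mpr (classNumber_ne_zero k)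
    rw [Finset.sum_const, Finset.card_univ, Fintype.card_prod, nsmul_eq_mul, Nat.cast_mul, hc,
      ← card_add_two_mul_card_eq_rank, show Fintype.card (ClassGroup (𝓞 k)) = classNumber k from rfl]
    rw [two_mul, ← add_assoc, pow_add _ (nrRealPlaces k + nrComplexPlaces k)]
    field_simp

theorem ncard_unitMulSquares_le (r : (𝓞 k)ˣ) (T : ℝ) :
    (conePoints k (unitMulSquares k r) T).ncard ≤
      torsionOrder k * {I : Ideal (𝓞 k) | (Ideal.absNorm I : ℝ) ≤ √T}.ncard := by
  let P : Ideal (𝓞 k) → 𝓞 k → Prop := fun I D =>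
    D ∈ coneSet k ∧ ∃ s : 𝓞 k, D = r * s ^ 2 ∧ I = Ideal.span {s}
  let g : torsion k × Ideal (𝓞 k) → 𝓞 k := fun x =>
    if h : ∃ D, P x.2 D then ((x.1 : (𝓞 k)ˣ) : 𝓞 k) * h.choose else 0
  have hfin : {I : Ideal (𝓞 k) | (Ideal.absNorm I : ℝ) ≤ √T}.Finite := by
    refine (Ideal.finite_setOfPred_absNorm_le (S := 𝓞 k) ⌊√T⌋₊).subset fun I hI => ?_
    exact (Nat.le_floor_iff (Real.sqrt_nonneg _)).mpr hI
  have hsub : conePoints k (unitMulSquares k r) T ⊆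
      g '' (Set.univ ×ˢ {I : Ideal (𝓞 k) | (Ideal.absNorm I : ℝ) ≤ √T}) := by
    rintro D ⟨⟨s, hs⟩, hc, hN⟩
    have hP : ∃ D', P (Ideal.span {s}) D' := ⟨D, hc, s, hs, rfl⟩
    obtain ⟨hc', s', hs', hI⟩ := hP.choose_spec
    rw [Ideal.span_singleton_eq_span_singleton] at hI
    obtain ⟨ε, hε⟩ := hI
    have h1 : ((ε ^ 2 : (𝓞 k)ˣ) : 𝓞 k) * D = hP.choose := by
      rw [hs', hs, ← hε, Units.val_pow_eq_pow_val]
      ring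
    have h2 := (unit_smul_mem_coneSet_iff (ε ^ 2) hc).mp (h1 ▸ hc')
    refine ⟨(⟨ε ^ 2, h2⟩⁻¹, Ideal.span {s}), ⟨trivial, ?_⟩, ?_⟩
    · rw [Set.mem_ofPred_eq]
      refine Real.le_sqrt_of_sq_le ?_
      have h3 : absNormReal (s : k) = Ideal.absNorm (Ideal.span {s}) :=
        absNormReal_of_spanSingleton (FractionalIdeal.coeIdeal_span_singleton _).symm
      rw [← h3]
      convert! hN using 1
      rw [hs, RingOfIntegers.coe_eq_algebraMap (_ * s ^ 2), map_mul, map_pow, absNormReal_mul,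
        absNormReal_pow, absNormReal_unit, one_mul]
    · change dite _ _ _ = _
      rw [dif_pos hP, ← h1, ← mul_assoc, ← Units.val_mul, Subgroup.coe_inv, inv_mul_cancel,
        Units.val_one, one_mul]
  calc _ ≤ _ := Set.ncard_le_ncard hsub ((Set.finite_univ.prod hfin).image g)
    _ ≤ _ := Set.ncard_image_le (Set.finite_univ.prod hfin)
    _ = _ := by rw [Set.ncard_prod, Set.ncard_univ, torsionOrder]

theorem tendsto_unitMulSquares (r : (𝓞 k)ˣ) :
    Tendsto (fun T : ℝ => ((conePoints k (unitMulSquares k r) T).ncard : ℝ) / T) atTop (𝓝 0) := by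
  have h1 := ((NumberField.Ideal.tendsto_norm_le_div_atTop k).comp Real.tendsto_sqrt_atTop).mul
    (tendsto_inv_atTop_zero.comp Real.tendsto_sqrt_atTop)
  rw [mul_zero] at h1
  have h2 := h1.const_mul (torsionOrder k : ℝ)
  rw [mul_zero] at h2
  refine squeeze_zero' ?_ ?_ h2
  · filter_upwards [eventually_gt_atTop 0] with T hT
    positivity
  · filter_upwards [eventually_gt_atTop 0] with T hT
    have h3 : ((conePoints k (unitMulSquares k r) T).ncard : ℝ) ≤
        torsionOrder k * {I : Ideal (𝓞 k) | (Ideal.absNorm I : ℝ) ≤ √T}.ncard := by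
      exact_mod_cast ncard_unitMulSquares_le k r T
    have h4 : √T * √T = T := Real.mul_self_sqrt hT.le
    have h5 : 0 < √T := Real.sqrt_pos.mpr hT
    calc _ ≤ torsionOrder k * {I : Ideal (𝓞 k) | (Ideal.absNorm I : ℝ) ≤ √T}.ncard / T := by gcongr
      _ = torsionOrder k * ((Nat.card {I : Ideal (𝓞 k) // (Ideal.absNorm I : ℝ) ≤ √T} : ℝ) / √T *
          (√T)⁻¹) := by
        rw [← Nat.card_coe_set_eq]
        nth_rewrite 2 [← h4]
        simp only [Set.coe_ofPred]
        field_simp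

theorem tendsto_squareParams :
    Tendsto (fun X : ℝ => ((squareParams k X).ncard : ℝ) / X) atTop (𝓝 0) := by
  have h1 : ∀ a : ClassGroup (𝓞 k) × ((𝓞 k)ˣ ⧸ unitSquares k),
      Tendsto (fun X : ℝ => ((conePoints k (unitMulSquares k a.2.out)
        ((Ideal.absNorm (classRep a.1) : ℝ) ^ 2 * X)).ncard : ℝ) / X) atTop (𝓝 0) := by
    intro a
    have hJ : (0 : ℝ) < (Ideal.absNorm (classRep a.1) : ℝ) ^ 2 := by
      have := Ideal.absNorm_eq_zero_iff.not.mpr (classRep_ne_bot a.1)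
      positivity
    have hJ' : (Ideal.absNorm (classRep a.1) : ℝ) ≠ 0 := pow_ne_zero_iff two_ne_zero |>.mp hJ.ne'
    have h2 := ((tendsto_unitMulSquares k a.2.out).comp
      (tendsto_id.const_mul_atTop hJ)).const_mul ((Ideal.absNorm (classRep a.1) : ℝ) ^ 2)
    rw [mul_zero] at h2
    convert! h2 using 2
    simp only [Function.comp_apply, id]
    field_simp
  have h3 := tendsto_finsetSum Finset.univ fun a _ => h1 a
  rw [Finset.sum_const_zero] at h3
  refine squeeze_zero' ?_ ?_ h3
  · filter_upwards [eventually_gt_atTop 0] with T hT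
    positivity
  · filter_upwards [eventually_gt_atTop 0] with X hX
    rw [← Finset.sum_div]
    gcongr
    let A := fun a : ClassGroup (𝓞 k) × ((𝓞 k)ˣ ⧸ unitSquares k) =>
      conePoints k (unitMulSquares k a.2.out) ((Ideal.absNorm (classRep a.1) : ℝ) ^ 2 * X)
    have hA : ∀ a, (A a).Finite := fun a => finite_conePoints k _ _
    have h4 := Set.ncard_le_ncard (s := squareParams k X) (t := {q | q.2 ∈ A q.1})
      (fun q hq => ⟨hq.2, hq.1.2⟩) (finite_setOf_mem hA)
    rw [ncard_setOf_mem hA] at h4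
    have h5 : ((squareParams k X).ncard : ℝ) ≤ ((∑ a, (A a).ncard : ℕ) : ℝ) := Nat.cast_le.mpr h4
    rwa [Nat.cast_sum] at h5

theorem tendsto_pairs : Tendsto (fun X : ℝ => ((pairs k X).ncard : ℝ) / X) atTop
    (𝓝 (1 / 2 ^ nrComplexPlaces k * dedekindZeta_residue k)) := by
  have hw : (torsionOrder k : ℝ) ≠ 0 := Nat.cast_ne_zero.mpr (torsionOrder_ne_zero k)
  have h := ((tendsto_params k).sub (tendsto_squareParams k)).const_mul (torsionOrder k : ℝ)⁻¹
  rw [sub_zero, inv_mul_cancel_left₀ hw] at h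
  refine h.congr fun X => ?_
  have h1 : ((pairs k X).ncard : ℝ) * torsionOrder k + (squareParams k X).ncard =
    (params k X).ncard := by exact_mod_cast ncard_pairs_mul k X
  rw [← h1]
  field_simp
  ring

end Counting

section Zeta

open Ideal

/-- The number of ideals of given norm, summed over norms, has linear growth. -/
theorem tendsto_sum_card_absNorm_div :
    Tendsto (fun n : ℕ => (∑ m ∈ Finset.Icc 1 n,
      (Nat.card {I : Ideal (𝓞 k) // absNorm I = m} : ℝ)) / n) atTop
      (𝓝 (dedekindZeta_residue k)) := by
  refine ((Ideal.tendsto_norm_le_div_atTop₀ k).comp tendsto_natCast_atTop_atTop).congr fun n ↦ ?_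
  simp only [Function.comp_apply, Nat.cast_le, ← Nat.cast_sum]
  congr
  rw [← add_left_inj 1, ← card_norm_le_eq_card_norm_le_add_one,
    show Finset.Icc 1 n = Finset.Ioc 0 n from Finset.Icc_succ_left_eq_Ioc _ _,
    show 1 = Nat.card {I : Ideal (𝓞 k) // absNorm I = 0} by simp [Ideal.absNorm_eq_zero_iff],
    Finset.sum_Ioc_add_eq_sum_Icc (n.zero_le),
    ← Finset.card_preimage_eq_sum_card_image_eq (fun k _ ↦ finite_setOfPred_absNorm_eq k)]
  simp [Set.coe_eq_subtype]

theorem lseriesSummable_card_absNorm {s : ℝ} (hs : 1 < s) :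
    LSeriesSummable (fun n ↦ (Nat.card {I : Ideal (𝓞 k) // absNorm I = n} : ℂ)) s := by
  have hO : (fun n : ℕ => ∑ m ∈ Finset.Icc 1 n,
      (Nat.card {I : Ideal (𝓞 k) // absNorm I = m} : ℝ)) =O[atTop] fun n : ℕ => (n : ℝ) ^ (1 : ℝ) := by
    have h := ((tendsto_sum_card_absNorm_div k).isBigO_one ℝ).mul
      (Asymptotics.isBigO_refl (fun n : ℕ => (n : ℝ)) atTop)
    refine (h.congr' ?_ (.of_forall fun n => by simp))
    filter_upwards [eventually_ge_atTop 1] with n hn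
    exact div_mul_cancel₀ _ (by positivity)
  have := LSeriesSummable_of_sum_norm_bigO_and_nonneg (s := (s : ℂ)) hO
    (fun _ => Nat.cast_nonneg _) zero_le_one (by simpa using hs)
  simpa using this

theorem tsum_fiber_absNorm (s : ℝ) (n : ℕ) :
    ∑' y : {I : {I : Ideal (𝓞 k) // I ≠ ⊥} // absNorm I.1 = n}, (absNorm y.1.1 : ℝ) ^ (-s) =
      if n = 0 then 0 else (Nat.card {I : Ideal (𝓞 k) // absNorm I = n} : ℝ) / (n : ℝ) ^ s := by
  have h1 : ∑' y : {I : {I : Ideal (𝓞 k) // I ≠ ⊥} // absNorm I.1 = n}, (absNorm y.1.1 : ℝ) ^ (-s) =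
      Nat.card {I : {I : Ideal (𝓞 k) // I ≠ ⊥} // absNorm I.1 = n} * (n : ℝ) ^ (-s) := by
    rw [← nsmul_eq_mul, ← tsum_const]
    exact tsum_congr fun y => by rw [y.2]
  rw [h1]
  split_ifs with hn
  · have : IsEmpty {I : {I : Ideal (𝓞 k) // I ≠ ⊥} // absNorm I.1 = n} :=
      ⟨fun y => y.1.2 (absNorm_eq_zero_iff.mp (y.2.trans hn))⟩
    simp
  · rw [Nat.card_congr (Equiv.subtypeSubtypeEquivSubtype (p := fun I : Ideal (𝓞 k) => I ≠ ⊥)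
      (q := fun I => absNorm I = n) fun {I} hI hb => hn (by simp [← hI, hb])),
      Real.rpow_neg (Nat.cast_nonneg _), div_eq_mul_inv]

theorem lseries_term_card_absNorm (s : ℝ) (n : ℕ) :
    LSeries.term (fun n ↦ (Nat.card {I : Ideal (𝓞 k) // absNorm I = n} : ℂ)) s n =
      ((if n = 0 then 0 else
        (Nat.card {I : Ideal (𝓞 k) // absNorm I = n} : ℝ) / (n : ℝ) ^ s : ℝ) : ℂ) := by
  rw [LSeries.term_def]
  split_ifs
  · simp
  · rw [Complex.ofReal_div, Complex.ofReal_cpow (Nat.cast_nonneg _), Complex.ofReal_natCast,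
      Complex.ofReal_natCast]

theorem summable_absNorm_rpow_neg {s : ℝ} (hs : 1 < s) :
    Summable fun I : {I : Ideal (𝓞 k) // I ≠ ⊥} => (absNorm I.1 : ℝ) ^ (-s) := by
  rw [← (Equiv.sigmaFiberEquiv fun I : {I : Ideal (𝓞 k) // I ≠ ⊥} => absNorm I.1).summable_iff]
  refine (summable_sigma_of_nonneg fun x => Real.rpow_nonneg (Nat.cast_nonneg _) _).mpr ?_
  constructor
  · intro n
    have : Finite {I : Ideal (𝓞 k) // absNorm I = n} := finite_setOfPred_absNorm_eq n
    have : Finite {I : {I : Ideal (𝓞 k) // I ≠ ⊥} // absNorm I.1 = n} :=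
      Finite.of_injective (fun y => (⟨y.1.1, y.2⟩ : {I : Ideal (𝓞 k) // absNorm I = n}))
        fun y z h => Subtype.ext (Subtype.ext (Subtype.mk.inj h))
    exact Summable.of_finite
  · have h := lseriesSummable_card_absNorm k hs
    rw [LSeriesSummable, funext (lseries_term_card_absNorm k s), Complex.summable_ofReal] at h
    exact h.congr fun n => (tsum_fiber_absNorm k s n).symm

theorem ofReal_dedekindZetaReal {s : ℝ} (hs : 1 < s) :
    (dedekindZetaReal k s : ℂ) = dedekindZeta k s := by
  let e := Equiv.sigmaFiberEquiv fun I : {I : Ideal (𝓞 k) // I ≠ ⊥} => absNorm I.1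
  have h := e.summable_iff.mpr (summable_absNorm_rpow_neg k hs)
  have h2 : dedekindZetaReal k s = ∑' n : ℕ,
      ∑' y : {I : {I : Ideal (𝓞 k) // I ≠ ⊥} // absNorm I.1 = n}, (absNorm y.1.1 : ℝ) ^ (-s) :=
    (e.tsum_eq _).symm.trans h.tsum_sigma
  rw [h2, dedekindZeta, LSeries,
    funext (lseries_term_card_absNorm k s), ← Complex.ofReal_tsum]
  exact congrArg _ (tsum_congr (tsum_fiber_absNorm k s))

theorem tendsto_sub_one_mul_dedekindZetaReal :
    Tendsto (fun s : ℝ => (s - 1) * dedekindZetaReal k s) (𝓝[>] 1)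
      (𝓝 (dedekindZeta_residue k)) := by
  have h := (Complex.continuous_re.tendsto _).comp (tendsto_sub_one_mul_dedekindZeta_nhdsGT k)
  refine h.congr' ?_
  filter_upwards [self_mem_nhdsWithin] with s hs
  rw [Function.comp_apply, ← ofReal_dedekindZetaReal k hs]
  norm_cast

theorem summable_absNorm_sq_inv :
    Summable fun I : {I : Ideal (𝓞 k) // I ≠ ⊥} => ((absNorm I.1 : ℝ) ^ 2)⁻¹ := by
  refine (summable_absNorm_rpow_neg k one_lt_two).congr fun I => ?_
  rw [Real.rpow_neg (Nat.cast_nonneg _), Real.rpow_two]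

theorem dedekindZetaReal_two :
    dedekindZetaReal k 2 = ∑' I : {I : Ideal (𝓞 k) // I ≠ ⊥}, ((absNorm I.1 : ℝ) ^ 2)⁻¹ :=
  tsum_congr fun I => by rw [Real.rpow_neg (Nat.cast_nonneg _), Real.rpow_two]

theorem dedekindZetaReal_two_pos : 0 < dedekindZetaReal k 2 := by
  rw [dedekindZetaReal_two]
  exact (summable_absNorm_sq_inv k).tsum_pos (fun _ => by positivity) ⟨⊤, top_ne_bot⟩
    (by simp)

end Zeta

section Moebius

open Ideal IsDedekindDomain

/-- Weighted sums of dilates of a function with linear growth have linear growth. -/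
theorem tendsto_tsum_dilate {ι : Type*} {F : ℝ → ℝ} {c C : ℝ} (hC : ∀ Y, 0 < Y → |F Y| ≤ C * Y)
    (hF : Tendsto (fun Y => F Y / Y) atTop (𝓝 c)) {n ε : ι → ℝ} (hn : ∀ i, 0 < n i)
    (hε : ∀ i, |ε i| ≤ 1) (hs : Summable fun i => (n i)⁻¹) :
    Tendsto (fun X => (∑' i, ε i * F (X / n i)) / X) atTop (𝓝 (c * ∑' i, ε i * (n i)⁻¹)) := by
  simp_rw [← tsum_div_const, ← tsum_mul_left]
  refine tendsto_tsum_of_dominated_convergence (bound := fun i => C * (n i)⁻¹) (hs.mul_left C) ?_ ?_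
  · intro i
    have h := (hF.comp (tendsto_id.atTop_div_const (hn i))).const_mul (ε i * (n i)⁻¹)
    rw [show c * (ε i * (n i)⁻¹) = ε i * (n i)⁻¹ * c by ring]
    refine h.congr fun X => ?_
    have := (hn i).ne'
    simp only [Function.comp_apply, id]
    field_simp
  · filter_upwards [eventually_gt_atTop 0] with X hX i
    rw [Real.norm_eq_abs, abs_div, abs_mul, abs_of_pos hX, div_le_iff₀ hX]
    have h := hC _ (div_pos hX (hn i))
    calc |ε i| * |F (X / n i)| ≤ 1 * (C * (X / n i)) :=
          mul_le_mul (hε i) h (abs_nonneg _) zero_le_one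
      _ = _ := by ring

/-- Interchange of a finite sum with a sum of finite support. -/
theorem finsetSum_tsum_ite {α ι : Type*} (P : Finset α) (r : α → ι → Prop)
    (hr : ∀ a ∈ P, {i | r a i}.Finite) (ε : ι → ℝ) :
    ∑ a ∈ P, ∑' i, (if r a i then ε i else 0) =
      ∑' i, ε i * ({a | a ∈ P ∧ r a i}.ncard : ℝ) := by
  rw [← Summable.tsum_finsetSum]
  · refine tsum_congr fun i => ?_
    rw [← Finset.sum_filter, Finset.sum_const, nsmul_eq_mul, mul_comm, ← Set.ncard_coe_finset]
    congr 3
    ext a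
    simp
  · intro a ha
    refine summable_of_hasFiniteSupport ((hr a ha).subset fun i hi => ?_)
    by_contra h
    exact hi (if_neg h)

variable {k}

theorem QuadExt.one_le_disc (L : QuadExt k) : 1 ≤ L.disc := by
  rw [disc_eq, Nat.one_le_cast, Nat.one_le_iff_ne_zero]
  exact absNorm_eq_zero_iff.not.mpr differentIdeal_ne_bot

/-- The squarefree ideal attached to a finite set of primes. -/
def primeProd (s : Finset (HeightOneSpectrum (𝓞 k))) : Ideal (𝓞 k) := ∏ p ∈ s, p.asIdeal

theorem primeProd_ne_bot (s : Finset (HeightOneSpectrum (𝓞 k))) : primeProd s ≠ ⊥ :=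
  Finset.prod_ne_zero_iff.mpr fun p _ => p.ne_bot

theorem primeProd_dvd_iff (s : Finset (HeightOneSpectrum (𝓞 k))) (g : Ideal (𝓞 k)) :
    primeProd s ∣ g ↔ ∀ p ∈ s, p.asIdeal ∣ g :=
  ⟨fun h _ hp => (Finset.dvd_prod_of_mem _ hp).trans h, fun h => Finset.prod_dvd_of_coprime
    (fun p _ q _ hpq => HeightOneSpectrum.isCoprime_of_ne p q hpq) h⟩

theorem dvd_primeProd_iff (p : HeightOneSpectrum (𝓞 k)) (s : Finset (HeightOneSpectrum (𝓞 k))) :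
    p.asIdeal ∣ primeProd s ↔ p ∈ s := by
  refine ⟨fun h => ?_, fun h => Finset.dvd_prod_of_mem _ h⟩
  obtain ⟨q, hq, hpq⟩ := (p.prime.dvd_finsetProd_iff _).mp h
  by_contra hp
  have h1 := HeightOneSpectrum.isCoprime_of_ne p q fun e => hp (e ▸ hq)
  exact p.prime.not_isUnit (h1.isUnit_of_dvd' dvd_rfl hpq)

theorem primeProd_injective :
    Function.Injective (primeProd : Finset (HeightOneSpectrum (𝓞 k)) → Ideal (𝓞 k)) :=
  fun s t h => Finset.ext fun p => by rw [← dvd_primeProd_iff, h, dvd_primeProd_iff]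

/-- Möbius inversion for ideals. -/
theorem tsum_primeProd_dvd {g : Ideal (𝓞 k)} (hg : g ≠ ⊥) :
    {s : Finset (HeightOneSpectrum (𝓞 k)) | primeProd s ∣ g}.Finite ∧
    ∑' s : Finset (HeightOneSpectrum (𝓞 k)), (if primeProd s ∣ g then (-1 : ℝ) ^ s.card else 0) =
      if g = ⊤ then 1 else 0 := by
  set F := (Ideal.finite_factors hg).toFinset
  have hF : ∀ s : Finset (HeightOneSpectrum (𝓞 k)), primeProd s ∣ g ↔ s ∈ F.powerset := by
    intro s
    rw [primeProd_dvd_iff, Finset.mem_powerset]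
    simp [F, Finset.subset_iff]
  simp_rw [hF]
  refine ⟨Finset.finite_toSet _, ?_⟩
  rw [tsum_eq_sum (s := F.powerset) fun s hs => if_neg hs,
    Finset.sum_congr rfl fun s hs => if_pos hs]
  have h := Finset.sum_powerset_neg_one_pow_card (x := F)
  have h2 : F = ∅ ↔ g = ⊤ := by
    rw [Finset.eq_empty_iff_forall_notMem]
    refine ⟨fun h => ?_, fun h p hp => ?_⟩
    · by_contra hg'
      obtain ⟨M, hM, hgM⟩ := Ideal.exists_le_maximal g hg'
      exact h ⟨M, hM.isPrime, fun hb => hg (le_bot_iff.mp (hb ▸ hgM))⟩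
        (by simpa [F] using Ideal.dvd_iff_le.mpr hgM)
    · have : p.asIdeal ∣ g := by simpa [F] using hp
      rw [h, ← Ideal.one_eq_top] at this
      exact p.prime.not_isUnit (isUnit_of_dvd_one this)
  rw [← if_congr h2 rfl rfl]
  exact_mod_cast h

variable (k)

/-- The quadratic extensions of bounded discriminant. -/
def boundedQuad (X : ℝ) : Set (QuadExt k) := {L | L.disc ≤ X}

theorem quadCount_eq (X : ℝ) : quadCount k X = (boundedQuad k X).ncard :=
  (Nat.card_congr (Equiv.subtypeSubtypeEquivSubtypeInter
    (fun L : IntermediateField k (AlgebraicClosure k) => Module.finrank k L = 2)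
    (fun L => relDiscNorm k L ≤ X))).symm

theorem ncard_boundedQuad_le (X : ℝ) : (boundedQuad k X).ncard ≤ (pairs k X).ncard := by
  refine Set.ncard_le_ncard_of_injOn (fun L => (L, (⊤ : Ideal (𝓞 k)))) ?_
    (fun L _ L' _ h => congrArg Prod.fst h) (finite_pairs k X)
  intro L hL
  refine ⟨top_ne_bot, ?_⟩
  simpa [boundedQuad] using hL

theorem pairs_mono {X Y : ℝ} (h : X ≤ Y) : pairs k X ⊆ pairs k Y := fun _ hp =>
  ⟨hp.1, hp.2.trans h⟩

theorem ncard_pairs_le : ∃ C : ℝ, ∀ Y : ℝ, 0 < Y → ((pairs k Y).ncard : ℝ) ≤ C * Y := by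
  have h := tendsto_pairs k
  set c := 1 / 2 ^ InfinitePlace.nrComplexPlaces k * dedekindZeta_residue k
  obtain ⟨Y₀, hY₀⟩ := eventually_atTop.mp (h.eventually (eventually_le_nhds (lt_add_one c)))
  refine ⟨max (c + 1) (pairs k Y₀).ncard, fun Y hY => ?_⟩
  rcases le_or_gt Y₀ Y with h1 | h1
  · exact ((div_le_iff₀ hY).mp (hY₀ Y h1)).trans (by gcongr; exact le_max_left _ _)
  rcases lt_or_ge Y 1 with h2 | h2
  · have : pairs k Y = ∅ := by
      refine Set.eq_empty_of_forall_notMem fun p hp => ?_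
      have h3 : (1 : ℝ) ≤ absNorm p.2 :=
        Nat.one_le_cast.mpr (Nat.one_le_iff_ne_zero.mpr (absNorm_eq_zero_iff.not.mpr hp.1))
      have h4 := one_le_mul_of_one_le_of_one_le p.1.one_le_disc (one_le_pow₀ (n := 2) h3)
      linarith [hp.2]
    rw [this, Set.ncard_empty, Nat.cast_zero]
    exact mul_nonneg ((Nat.cast_nonneg _).trans (le_max_right _ _)) hY.le
  · have h3 : ((pairs k Y).ncard : ℝ) ≤ (pairs k Y₀).ncard := by
      exact_mod_cast Set.ncard_le_ncard (pairs_mono k h1.le) (finite_pairs k Y₀)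
    calc ((pairs k Y).ncard : ℝ) ≤ max (c + 1) (pairs k Y₀).ncard := h3.trans (le_max_right _ _)
      _ ≤ _ := le_mul_of_one_le_right ((Nat.cast_nonneg _).trans (le_max_right _ _)) h2

theorem ncard_pairs_dvd {d : Ideal (𝓞 k)} (hd : d ≠ ⊥) (X : ℝ) :
    {p | p ∈ pairs k X ∧ d ∣ p.2}.ncard = (pairs k (X / (absNorm d : ℝ) ^ 2)).ncard := by
  have hN : (0 : ℝ) < (absNorm d : ℝ) ^ 2 := by
    have := absNorm_eq_zero_iff.not.mpr hd
    positivity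
  have key : ∀ p : QuadExt k × Ideal (𝓞 k), (p.1, d * p.2) ∈ pairs k X ↔
      p ∈ pairs k (X / (absNorm d : ℝ) ^ 2) := by
    intro p
    simp only [pairs, Set.mem_ofPred_eq, map_mul, Nat.cast_mul, ne_eq, mul_eq_bot, hd, false_or,
      le_div_iff₀ hN, mul_pow]
    rw [mul_left_comm, mul_comm]
  refine (Set.BijOn.ncard_eq (f := fun p : QuadExt k × Ideal (𝓞 k) => (p.1, d * p.2))
    ⟨?_, ?_, ?_⟩).symm
  · exact fun p hp => ⟨(key p).mpr hp, dvd_mul_right _ _⟩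
  · rintro ⟨L, g⟩ - ⟨L', g'⟩ - h
    obtain ⟨h1, h2⟩ := Prod.mk.inj h
    exact Prod.ext h1 (mul_left_cancel₀ hd h2)
  · rintro ⟨L, _⟩ ⟨hp, g, rfl⟩
    exact ⟨(L, g), (key (L, g)).mp hp, rfl⟩

theorem ncard_pairs_snd {g : Ideal (𝓞 k)} (hg : g ≠ ⊥) (X : ℝ) :
    {p | p ∈ pairs k X ∧ p.2 = g}.ncard = (boundedQuad k (X / (absNorm g : ℝ) ^ 2)).ncard := by
  have hN : (0 : ℝ) < (absNorm g : ℝ) ^ 2 := by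
    have := absNorm_eq_zero_iff.not.mpr hg
    positivity
  refine (Set.BijOn.ncard_eq (f := fun L : QuadExt k => (L, g)) ⟨?_, ?_, ?_⟩).symm
  · exact fun L hL => ⟨⟨hg, (le_div_iff₀ hN).mp hL⟩, rfl⟩
  · exact fun L _ L' _ h => congrArg Prod.fst h
  · rintro ⟨L, _⟩ ⟨hp, rfl⟩
    exact ⟨L, (le_div_iff₀ hN).mpr hp.2, rfl⟩

theorem ncard_boundedQuad_eq_tsum (X : ℝ) : ((boundedQuad k X).ncard : ℝ) =
    ∑' s : Finset (HeightOneSpectrum (𝓞 k)), (-1 : ℝ) ^ s.card *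
      ((pairs k (X / (absNorm (primeProd s) : ℝ) ^ 2)).ncard : ℝ) := by
  have h := finsetSum_tsum_ite (finite_pairs k X).toFinset
    (fun p (s : Finset (HeightOneSpectrum (𝓞 k))) => primeProd s ∣ p.2)
    (fun p hp => (tsum_primeProd_dvd ((Set.Finite.mem_toFinset _).mp hp).1).1)
    fun s => (-1 : ℝ) ^ s.card
  simp only [Set.Finite.mem_toFinset, ncard_pairs_dvd k (primeProd_ne_bot _)] at h
  rw [← h, Finset.sum_congr rfl fun p hp =>
    (tsum_primeProd_dvd ((Set.Finite.mem_toFinset _).mp hp).1).2, ← Finset.sum_filter,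
    Finset.sum_const, nsmul_one, ← Set.ncard_coe_finset]
  have h1 := ncard_pairs_snd k (g := ⊤) top_ne_bot X
  rw [absNorm_top, Nat.cast_one, one_pow, div_one] at h1
  rw [← h1]
  congr 2
  ext p
  simp

theorem ncard_pairs_eq_tsum (X : ℝ) : ((pairs k X).ncard : ℝ) =
    ∑' g : {I : Ideal (𝓞 k) // I ≠ ⊥}, (1 : ℝ) *
      ((boundedQuad k (X / (absNorm g.1 : ℝ) ^ 2)).ncard : ℝ) := by
  have h := finsetSum_tsum_ite (finite_pairs k X).toFinset
    (fun p (g : {I : Ideal (𝓞 k) // I ≠ ⊥}) => p.2 = g.1)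
    (fun p _ => Set.Subsingleton.finite fun g hg g' hg' => Subtype.ext (hg.symm.trans hg'))
    fun _ => (1 : ℝ)
  simp only [Set.Finite.mem_toFinset] at h
  simp_rw [← fun g : {I : Ideal (𝓞 k) // I ≠ ⊥} => ncard_pairs_snd k g.2 X]
  rw [← h, Finset.sum_congr rfl fun p hp => ?_, Finset.sum_const, nsmul_one,
    ← Set.ncard_coe_finset, Set.Finite.coe_toFinset]
  have hp := (Set.Finite.mem_toFinset _).mp hp
  exact (tsum_eq_single (⟨p.2, hp.1⟩ : {I : Ideal (𝓞 k) // I ≠ ⊥})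
    fun g hg => if_neg fun e => hg (Subtype.ext e.symm)).trans (if_pos rfl)

variable {k} in
/-- `primeProd` as a nonzero ideal. -/
def primeProdNeBot (s : Finset (HeightOneSpectrum (𝓞 k))) : {I : Ideal (𝓞 k) // I ≠ ⊥} :=
  ⟨primeProd s, primeProd_ne_bot s⟩

variable {k} in
theorem primeProdNeBot_injective : Function.Injective (primeProdNeBot (k := k)) := by
  intro s t h
  have h2 : primeProd s = primeProd t := congrArg Subtype.val h
  exact primeProd_injective h2

theorem summable_absNorm_primeProd_sq_inv :
    Summable fun s : Finset (HeightOneSpectrum (𝓞 k)) => ((absNorm (primeProd s) : ℝ) ^ 2)⁻¹ := by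
  have h := (summable_absNorm_sq_inv k).comp_injective (primeProdNeBot_injective (k := k))
  exact h

theorem tendsto_boundedQuad : Tendsto (fun X : ℝ => ((boundedQuad k X).ncard : ℝ) / X) atTop
    (𝓝 (1 / 2 ^ InfinitePlace.nrComplexPlaces k *
      (dedekindZeta_residue k / dedekindZetaReal k 2))) := by
  obtain ⟨C, hC⟩ := ncard_pairs_le k
  have hpos : ∀ I : Ideal (𝓞 k), I ≠ ⊥ → (0 : ℝ) < (absNorm I : ℝ) ^ 2 := by
    intro I hI
    have := absNorm_eq_zero_iff.not.mpr hI
    positivity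
  have hs := summable_absNorm_primeProd_sq_inv k
  have hP : ∀ Y : ℝ, 0 < Y → |((pairs k Y).ncard : ℝ)| ≤ C * Y := fun Y hY =>
    (abs_of_nonneg (Nat.cast_nonneg _)).trans_le (hC Y hY)
  have hQ : ∀ Y : ℝ, 0 < Y → |((boundedQuad k Y).ncard : ℝ)| ≤ C * Y := fun Y hY =>
    (abs_of_nonneg (Nat.cast_nonneg _)).trans_le
      ((Nat.cast_le.mpr (ncard_boundedQuad_le k Y)).trans (hC Y hY))
  have h1 := tendsto_tsum_dilate hP (tendsto_pairs k)
    (n := fun s : Finset (HeightOneSpectrum (𝓞 k)) => (absNorm (primeProd s) : ℝ) ^ 2)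
    (ε := fun s => (-1 : ℝ) ^ s.card)
    (fun s => hpos _ (primeProd_ne_bot s)) (fun s => by simp) hs
  simp_rw [← ncard_boundedQuad_eq_tsum k] at h1
  have h2 := tendsto_tsum_dilate hQ h1
    (n := fun g : {I : Ideal (𝓞 k) // I ≠ ⊥} => (absNorm g.1 : ℝ) ^ 2) (ε := fun _ => (1 : ℝ))
    (fun g => hpos _ g.2) (fun g => by simp) (summable_absNorm_sq_inv k)
  simp_rw [← ncard_pairs_eq_tsum k, one_mul, ← dedekindZetaReal_two] at h2
  have h3 := tendsto_nhds_unique h2 (tendsto_pairs k)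
  rwa [← mul_div_assoc, ← h3, mul_div_cancel_right₀ _ (dedekindZetaReal_two_pos k).ne']

end Moebius

/-- **Datskovsky–Wright:** if `κ` is the residue at `s = 1` of the Dedekind zeta
function of `k` and `r₂` the number of pairs of complex embeddings of `k`, then the
number of quadratic extensions `L/k` with `|Δ_{L/k}| ≤ x` is asymptotic to
`(1/2^{r₂}) ⬝ (κ / ζ_k(2)) ⬝ x` as `x → ∞`. -/
theorem count_quadratic_extensions (κ : ℝ)
    (hκ : Filter.Tendsto (fun s : ℝ => (s - 1) * dedekindZetaReal k s)
      (𝓝[>] (1 : ℝ)) (𝓝 κ)) :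
    Filter.Tendsto (fun x : ℝ => (quadCount k x : ℝ) / x) atTop
      (𝓝 ((1 / 2 ^ (NumberField.InfinitePlace.nrComplexPlaces k)) *
        (κ / dedekindZetaReal k 2))) := by
  have hκ' := tendsto_nhds_unique hκ (tendsto_sub_one_mul_dedekindZetaReal k)
  simpa only [hκ', quadCount_eq] using tendsto_boundedQuad k

end
end

section
/- Let k be a number field of degree n_k with exactly one complex place (i.e., r_2(k) = 1), let a, b \in k^{\times}, and let B = \mathbb{H}[k, a, b] be a quaternion algebra over k that is ramified at every real embedding of k, meaning that for each real embedding \sigma of k the quaternion algebra \mathbb{H}[\mathbb{R}, \sigma(a), \sigma(b)] is a division ring. Let L be a quadratic extension of k that admits an injective k-algebra homomorphism L \to B. Then the regulator of L satisfies Reg_L \le d_L^{n_k}. -/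
open NumberField
open scoped Quaternion

namespace RegulatorBound

open MeasureTheory Module NumberField.InfinitePlace
open NumberField.Units.dirichletUnitTheorem
open scoped ENNReal NNReal

section Covering

/-- If the translates of `S` by a lattice cover the space, then the covolume of the lattice is at
most the measure of `S`. -/
theorem addCovolume_le_of_forall_sub_mem {E : Type*} [NormedAddCommGroup E] [NormedSpace ℝ E]
    [FiniteDimensional ℝ E] [MeasurableSpace E] [BorelSpace E]
    (L : Submodule ℤ E) [DiscreteTopology L] [IsZLattice ℝ L]
    (μ : Measure E) [μ.IsAddHaarMeasure] {S : Set E} (hS : ∀ y, ∃ l ∈ L, y - l ∈ S) :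
    ENNReal.ofReal (ZLattice.covolume L μ) ≤ μ S := by
  have : MeasurableVAdd L E := (inferInstance : MeasurableVAdd L.toAddSubgroup E)
  have : VAddInvariantMeasure L E μ := (inferInstance : VAddInvariantMeasure L.toAddSubgroup E μ)
  have h := ZLattice.isAddFundamentalDomain (Free.chooseBasis ℤ L) μ
  rw [ZLattice.covolume_eq_measure_fundamentalDomain L μ h]
  refine ENNReal.ofReal_toReal_le.trans ?_
  rw [h.measure_eq_tsum S]
  refine (measure_mono fun y hy ↦ ?_).trans (measure_iUnion_le _)
  obtain ⟨l, hl, hyl⟩ := hS y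
  refine Set.mem_iUnion.mpr ⟨⟨l, hl⟩, ⟨y - l, hyl, ?_⟩, hy⟩
  simp [Submodule.vadd_def]

end Covering

variable (K : Type*) [Field K] [NumberField K]

section IdealCount

theorem finite_primesOver {p : ℕ} (hp : p.Prime) :
    ((Ideal.span {(p : ℤ)}).primesOver (𝓞 K)).Finite := by
  have : Fact p.Prime := ⟨hp⟩
  exact IsDedekindDomain.primesOver_finite _ _

theorem ncard_primesOver_le_finrank {p : ℕ} (hp : p.Prime) :
    ((Ideal.span {(p : ℤ)}).primesOver (𝓞 K)).ncard ≤ finrank ℚ K := by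
  have : Fact p.Prime := ⟨hp⟩
  have := (finite_primesOver K hp).fintype
  rw [← RingOfIntegers.rank K,
    ← Ideal.sum_ramification_inertia_eq_finrank (Ideal.span {(p : ℤ)}) (𝓞 K),
    ← Nat.card_coe_set_eq, Nat.card_eq_fintype_card, Fintype.card_eq_sum_ones]
  refine Finset.sum_le_sum fun P _ ↦ ?_
  have : P.1.IsPrime := P.2.1
  exact Right.one_le_mul (Ideal.ramificationIdx_pos ..) (Ideal.inertiaDeg_pos ..)

variable {K} in
/-- If `[K : ℚ] ≤ 2 ^ e`, then `𝓞 K` has at most `m ^ e` ideals of norm `m`. -/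
theorem ncard_absNorm_eq_le {e : ℕ} (he : finrank ℚ K ≤ 2 ^ e) (m : ℕ) (hm : m ≠ 0) :
    {I : Ideal (𝓞 K) | I.absNorm = m}.ncard ≤ m ^ e := by
  classical
  induction m using Nat.strong_induction_on with
  | _ m ih =>
  by_cases h1 : m = 1
  · subst h1
    simp [Ideal.absNorm_eq_one_iff]
  set p := m.minFac
  have hp : p.Prime := Nat.minFac_prime h1
  have hfin := finite_primesOver K hp
  set s : Finset (Ideal (𝓞 K)) := {P ∈ hfin.toFinset | P.absNorm ∣ m} with hs
  have hcard : s.card ≤ 2 ^ e := by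
    refine (Finset.card_filter_le _ _).trans ?_
    rw [← Set.ncard_eq_toFinset_card _ hfin]
    exact (ncard_primesOver_le_finrank K hp).trans he
  have hsub : {I : Ideal (𝓞 K) | I.absNorm = m} ⊆
      ⋃ P ∈ s, (P * ·) '' {J : Ideal (𝓞 K) | J.absNorm = m / P.absNorm} := by
    intro I hI
    obtain ⟨P, hP, hPp, J, rfl⟩ := Ideal.exists_isMaximal_dvd_of_dvd_absNorm' hp I
      ((show I.absNorm = m from hI) ▸ Nat.minFac_dvd m)
    have hI' : P.absNorm * J.absNorm = m := by simpa using hI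
    have hP0 : P.absNorm ≠ 0 := by rintro h; simp [h] at hI'; exact hm hI'.symm
    refine Set.mem_biUnion (x := P) ?_ ⟨J, ?_, rfl⟩
    · simp only [hs, Finset.coe_filter, Set.Finite.mem_toFinset, Set.mem_ofPred_eq]
      exact ⟨⟨hP.isPrime, ⟨hPp.symm⟩⟩, ⟨_, hI'.symm⟩⟩
    · simp [← hI', Nat.mul_div_cancel_left _ (Nat.pos_of_ne_zero hP0)]
  have hterm : ∀ P ∈ s, ((P * ·) '' {J : Ideal (𝓞 K) | J.absNorm = m / P.absNorm}).ncard
      ≤ (m / 2) ^ e := by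
    intro P hP
    simp only [hs, Finset.mem_filter, Set.Finite.mem_toFinset] at hP
    obtain ⟨⟨hprime, -⟩, hdvd⟩ := hP
    have hP0 : P.absNorm ≠ 0 := fun h ↦ hm (by simpa [h] using hdvd)
    have hP1 : P.absNorm ≠ 1 := fun h ↦ hprime.ne_top (Ideal.absNorm_eq_one_iff.mp h)
    have hP2 : 2 ≤ P.absNorm := by omega
    refine (Set.ncard_image_le (Ideal.finite_setOfPred_absNorm_eq _)).trans ?_
    refine (ih _ (Nat.div_lt_self (Nat.pos_of_ne_zero hm) hP2)
      (Nat.div_pos (Nat.le_of_dvd (Nat.pos_of_ne_zero hm) hdvd)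
        (Nat.pos_of_ne_zero hP0)).ne').trans ?_
    exact Nat.pow_le_pow_left (Nat.div_le_div_left hP2 two_pos) _
  calc {I : Ideal (𝓞 K) | I.absNorm = m}.ncard
      ≤ _ := Set.ncard_le_ncard hsub (s.finite_toSet.biUnion fun P _ ↦
        (Ideal.finite_setOfPred_absNorm_eq _).image _)
    _ ≤ ∑ P ∈ s, ((P * ·) '' {J : Ideal (𝓞 K) | J.absNorm = m / P.absNorm}).ncard :=
        Finset.set_ncard_biUnion_le _ _
    _ ≤ s.card * (m / 2) ^ e := by simpa using Finset.sum_le_card_nsmul _ _ _ hterm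
    _ ≤ 2 ^ e * (m / 2) ^ e := by gcongr
    _ = (2 * (m / 2)) ^ e := (mul_pow _ _ _).symm
    _ ≤ m ^ e := Nat.pow_le_pow_left (Nat.mul_div_le m 2) e

variable {K} in
theorem ncard_absNorm_mem_Icc_le {e : ℕ} (he : finrank ℚ K ≤ 2 ^ e) (n : ℕ) :
    {I : Ideal (𝓞 K) | I.absNorm ∈ Set.Icc 1 n}.ncard ≤ n ^ (e + 1) := by
  have h : {I : Ideal (𝓞 K) | I.absNorm ∈ Set.Icc 1 n} =
      ⋃ m ∈ Finset.Icc 1 n, {I : Ideal (𝓞 K) | I.absNorm = m} := by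
    ext; simp
  rw [h]
  refine (Finset.set_ncard_biUnion_le _ _).trans ?_
  refine (Finset.sum_le_card_nsmul _ _ (n ^ e) fun m hm ↦ ?_).trans ?_
  · rw [Finset.mem_Icc] at hm
    exact (ncard_absNorm_eq_le he m (by omega)).trans (Nat.pow_le_pow_left hm.2 e)
  · simp [pow_succ, mul_comm]

end IdealCount

section Minkowski

open scoped Classical in
theorem minkowskiBound_one_lt_volume_convexBodyLT (hc : nrComplexPlaces K ≠ 0)
    {f : InfinitePlace K → ℝ≥0} (hf : ∏ w, f w ^ mult w = NNReal.sqrt ‖discr K‖₊) :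
    mixedEmbedding.minkowskiBound K ↑1 < volume (mixedEmbedding.convexBodyLT K f) := by
  rw [mixedEmbedding.convexBodyLT_volume, mixedEmbedding.minkowskiBound,
    mixedEmbedding.volume_fundamentalDomain_fractionalIdealLatticeBasis, Units.val_one,
    FractionalIdeal.absNorm_one, Rat.cast_one, ENNReal.ofReal_one, one_mul, mixedEmbedding.finrank,
    mixedEmbedding.volume_fundamentalDomain_latticeBasis, hf,
    ← card_add_two_mul_card_eq_rank K, pow_add, pow_mul, mixedEmbedding.convexBodyLTFactor,
    show (2 : ℝ≥0∞)⁻¹ = ((2⁻¹ : ℝ≥0) : ℝ≥0∞) by simp]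
  norm_cast
  have hd : 0 < NNReal.sqrt ‖discr K‖₊ := by
    simpa [NNReal.sqrt_pos] using discr_ne_zero K
  have h2 : (2⁻¹ : ℝ≥0) ^ nrComplexPlaces K * NNReal.sqrt ‖discr K‖₊ *
      (2 ^ nrRealPlaces K * 4 ^ nrComplexPlaces K) =
      2 ^ nrRealPlaces K * 2 ^ nrComplexPlaces K * NNReal.sqrt ‖discr K‖₊ := by
    have : (2⁻¹ : ℝ≥0) ^ nrComplexPlaces K * 4 ^ nrComplexPlaces K =
        2 ^ nrComplexPlaces K := by
      rw [← mul_pow]; norm_num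
    rw [← this]; ring
  have h3 : (2 : ℝ≥0) ^ nrComplexPlaces K < NNReal.pi ^ nrComplexPlaces K :=
    pow_lt_pow_left₀ (by exact_mod_cast Real.pi_gt_three.trans' (by norm_num)) (by simp) hc
  push_cast
  refine h2.trans_lt ?_
  gcongr

theorem one_le_abs_norm {x : 𝓞 K} (hx : x ≠ 0) : 1 ≤ |(Algebra.norm ℚ (x : K) : ℝ)| := by
  rw [← Algebra.coe_norm_int]
  exact_mod_cast Int.one_le_abs (Algebra.norm_ne_zero_iff.mpr hx)

open scoped Classical in
/-- Every point of the logarithmic space is close to the logarithmic image of an algebraic integer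
of small norm. -/
theorem exists_sub_log_mem_Ioc (hc : nrComplexPlaces K ≠ 0) (y : logSpace K) :
    ∃ x : 𝓞 K, x ≠ 0 ∧ |(Algebra.norm ℚ (x : K) : ℝ)| ≤ √|discr K| ∧
      ∀ w : {w : InfinitePlace K // w ≠ w₀},
        y w - mult w.1 * Real.log (w.1 x) ∈ Set.Ioc 0 (Real.log √|discr K|) := by
  obtain ⟨f, hf, hprod⟩ := mixedEmbedding.adjust_f K (w₁ := w₀) (NNReal.sqrt ‖discr K‖₊)
    (f := fun w ↦ if h : w ≠ w₀ then (Real.exp (y ⟨w, h⟩ / mult w)).toNNReal else 1)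
    (fun w hw ↦ by
      rw [dif_pos hw]
      exact (Real.toNNReal_pos.mpr (Real.exp_pos _)).ne')
  obtain ⟨x, hx, hlt⟩ := mixedEmbedding.exists_ne_zero_mem_ringOfIntegers_lt K
    (minkowskiBound_one_lt_volume_convexBodyLT K hc hprod)
  have hxpos (w : InfinitePlace K) : 0 < w x := pos_iff.mpr (RingOfIntegers.coe_ne_zero_iff.mpr hx)
  have hprod' : ∏ w, (f w : ℝ) ^ mult w = √|discr K| := by
    have := congrArg NNReal.toReal hprod
    push_cast at this
    simpa [Int.norm_eq_abs] using this
  have hle : |(Algebra.norm ℚ (x : K) : ℝ)| ≤ √|discr K| := by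
    rw [← hprod', ← Rat.cast_abs, ← prod_eq_abs_norm]
    exact Finset.prod_le_prod (fun w _ ↦ by have := hxpos w; positivity)
      fun w _ ↦ pow_le_pow_left₀ (hxpos w).le (hlt w).le _
  refine ⟨x, hx, hle, fun w ↦ ?_⟩
  set g : InfinitePlace K → ℝ := fun w ↦ mult w * Real.log (f w) - mult w * Real.log (w x)
  have hg (w : InfinitePlace K) : 0 < g w :=
    sub_pos.mpr (mul_lt_mul_of_pos_left (Real.log_lt_log (hxpos w) (hlt w))
      (by exact_mod_cast mult_pos))
  have hsum : ∑ w, g w ≤ Real.log √|discr K| := by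
    have h1 : ∑ w, (mult w : ℝ) * Real.log (f w) = Real.log √|discr K| := by
      rw [← hprod', Real.log_prod fun w _ ↦ pow_ne_zero _ ((hxpos w).trans (hlt w)).ne']
      simp_rw [Real.log_pow]
    have h2 : ∑ w : InfinitePlace K, (mult w : ℝ) * Real.log (w x) =
        Real.log |(Algebra.norm ℚ (x : K) : ℝ)| := by
      rw [← Rat.cast_abs, ← prod_eq_abs_norm,
        Real.log_prod fun w _ ↦ pow_ne_zero _ (hxpos w).ne']
      simp_rw [Real.log_pow]
    rw [Finset.sum_sub_distrib, h1, h2]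
    linarith [Real.log_nonneg (one_le_abs_norm K hx)]
  have hy : y w = mult w.1 * Real.log (f w.1) := by
    rw [hf _ w.2, dif_pos w.2, Real.coe_toNNReal _ (Real.exp_pos _).le, Real.log_exp,
      mul_div_cancel₀ _ mult_coe_ne_zero]
  rw [hy]
  exact ⟨hg w.1, (Finset.single_le_sum (fun i _ ↦ (hg i).le) (Finset.mem_univ w.1)).trans hsum⟩

end Minkowski

open scoped Classical in
/-- The log space is covered by the translates under the unit lattice of one box of side
`log √|d_K|` for each ideal of norm at most `√|d_K|`. -/
theorem regulator_le_ncard_mul (hc : nrComplexPlaces K ≠ 0) :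
    Units.regulator K ≤ {I : Ideal (𝓞 K) | I.absNorm ∈ Set.Icc 1 ⌊√|discr K|⌋₊}.ncard *
      Real.log √|discr K| ^ Units.rank K := by
  set T := {I : Ideal (𝓞 K) | I.absNorm ∈ Set.Icc 1 ⌊√|discr K|⌋₊}
  have hT : T.Finite := (Ideal.finite_setOfPred_absNorm_le _).subset fun I hI ↦ hI.2
  have h0 : 0 ≤ Real.log √|discr K| := by
    refine Real.log_nonneg (Real.one_le_sqrt.mpr ?_)
    exact_mod_cast Int.one_le_abs (discr_ne_zero K)
  let logVec : 𝓞 K → logSpace K := fun x w ↦ mult w.1 * Real.log (w.1 x)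
  let gen : Ideal (𝓞 K) → 𝓞 K := fun I ↦ Classical.epsilon fun x ↦ Ideal.span {x} = I
  let box (I : Ideal (𝓞 K)) : Set (logSpace K) :=
    Set.univ.pi fun w ↦ Set.Ioc (logVec (gen I) w) (logVec (gen I) w + Real.log √|discr K|)
  have hcover : ∀ y : logSpace K, ∃ l ∈ Units.unitLattice K, y - l ∈ ⋃ I ∈ hT.toFinset, box I := by
    intro y
    obtain ⟨x, hx, hle, hmem⟩ := exists_sub_log_mem_Ioc K hc y
    have hgen : Ideal.span {gen (Ideal.span {x})} = Ideal.span {x} :=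
      Classical.epsilon_spec (p := fun z ↦ Ideal.span {z} = Ideal.span {x}) ⟨x, rfl⟩
    obtain ⟨u, hu⟩ := Ideal.span_singleton_eq_span_singleton.mp hgen
    refine ⟨Units.logEmbedding K (Additive.ofMul u), ⟨_, trivial, rfl⟩, ?_⟩
    refine Set.mem_biUnion (x := Ideal.span {x}) ?_ fun w _ ↦ ?_
    · have hnorm : ((Ideal.span {x}).absNorm : ℝ) = |(Algebra.norm ℚ (x : K) : ℝ)| := by
        rw [Ideal.absNorm_span_singleton, ← Algebra.coe_norm_int, Nat.cast_natAbs]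
        simp
      simp only [Finset.mem_coe, Set.Finite.mem_toFinset]
      refine ⟨?_, Nat.le_floor (hnorm ▸ hle)⟩
      exact_mod_cast hnorm ▸ one_le_abs_norm K hx
    · have hgpos : 0 < w.1 (gen (Ideal.span {x}) : K) := by
        refine pos_iff.mpr (RingOfIntegers.coe_ne_zero_iff.mpr fun h ↦ hx ?_)
        simpa [h] using hu.symm
      have hlog : mult w.1 * Real.log (w.1 x) =
          logVec (gen (Ideal.span {x})) w + Units.logEmbedding K (Additive.ofMul u) w := by
        have hu' : (x : K) = gen (Ideal.span {x}) * (u : K) := by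
          exact_mod_cast congrArg (algebraMap (𝓞 K) K) hu.symm
        simp only [logVec, logEmbedding_component]
        rw [hu', map_mul, Real.log_mul hgpos.ne' (Units.pos_at_place u w.1).ne', mul_add]
      have h := hmem w
      rw [hlog] at h
      constructor
      · simp only [Pi.sub_apply]
        linarith [h.1]
      · simp only [Pi.sub_apply]
        linarith [h.2]
  have hvol (I : Ideal (𝓞 K)) :
      volume (box I) = ENNReal.ofReal (Real.log √|discr K| ^ Units.rank K) := by
    simp only [box, Real.volume_pi_Ioc, add_sub_cancel_left, Finset.prod_const,
      ENNReal.ofReal_pow h0, Finset.card_univ]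
    rw [← Fintype.card_congr (Units.equivFinRank K), Fintype.card_fin]
  have h := (addCovolume_le_of_forall_sub_mem (Units.unitLattice K) volume hcover).trans
    (measure_biUnion_finset_le _ _)
  simp only [hvol, Finset.sum_const, ← Set.ncard_eq_toFinset_card _ hT] at h
  rw [← ENNReal.ofReal_nsmul, ENNReal.ofReal_le_ofReal_iff (by positivity), nsmul_eq_mul] at h
  exact h

theorem two_mul_le_two_pow {n : ℕ} (hn : n ≠ 0) : 2 * n ≤ 2 ^ n := by
  obtain ⟨m, rfl⟩ := Nat.exists_eq_succ_of_ne_zero hn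
  rw [pow_succ']
  exact Nat.mul_le_mul_left 2 Nat.lt_two_pow_self

theorem regulator_le_abs_discr_pow (hc : nrComplexPlaces K ≠ 0) {n : ℕ}
    (hn : finrank ℚ K = 2 * n) : Units.regulator K ≤ ((discr K).natAbs : ℝ) ^ n := by
  have hn1 : n ≠ 0 := by rintro rfl; simpa [hn] using (finrank_pos (R := ℚ) (M := K)).ne'
  have hn2 := two_mul_le_two_pow hn1
  set q : ℝ := √√|discr K| with hq
  have hD : (1 : ℝ) ≤ |(discr K : ℝ)| := by exact_mod_cast Int.one_le_abs (discr_ne_zero K)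
  have hM : 1 ≤ √|(discr K : ℝ)| := Real.one_le_sqrt.mpr hD
  have hq1 : 1 ≤ q := Real.one_le_sqrt.mpr hM
  have hqM : √|(discr K : ℝ)| = q ^ 2 := (Real.sq_sqrt (by positivity)).symm
  have hqD : ((discr K).natAbs : ℝ) = q ^ 4 := by
    rw [Nat.cast_natAbs, Int.cast_abs, ← Real.sq_sqrt (zero_le_one.trans hD), hqM, ← pow_mul]
  have hlog : Real.log √|discr K| ≤ q := by
    rw [Real.log_le_iff_le_exp (by positivity), hqM,
      show Real.exp q = Real.exp (q / 2) ^ 2 by rw [← Real.exp_nat_mul]; ring_nf]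
    refine pow_le_pow_left₀ (by positivity) ?_ 2
    nlinarith [Real.quadratic_le_exp_of_nonneg (show 0 ≤ q / 2 by positivity), sq_nonneg (q - 2)]
  have hrank : Units.rank K ≤ 2 * n - 2 := by
    have := card_add_two_mul_card_eq_rank K
    have := card_eq_nrRealPlaces_add_nrComplexPlaces K
    rw [Units.rank]
    omega
  have hcount : ({I : Ideal (𝓞 K) | I.absNorm ∈ Set.Icc 1 ⌊√|discr K|⌋₊}.ncard : ℝ) ≤
      (q ^ 2) ^ (n + 1) := by
    rw [← hqM]
    refine le_trans (Nat.cast_le.mpr (ncard_absNorm_mem_Icc_le (hn.trans_le hn2) _)) ?_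
    rw [Nat.cast_pow]
    exact pow_le_pow_left₀ (Nat.cast_nonneg _) (Nat.floor_le (Real.sqrt_nonneg _)) _
  calc Units.regulator K ≤ _ := regulator_le_ncard_mul K hc
    _ ≤ (q ^ 2) ^ (n + 1) * q ^ (2 * n - 2) := by
        have h0 := Real.log_nonneg hM
        gcongr
        exact (pow_le_pow_left₀ h0 hlog _).trans (pow_le_pow_right₀ hq1 hrank)
    _ = ((discr K).natAbs : ℝ) ^ n := by
        rw [hqD, ← pow_mul, ← pow_mul, ← pow_add]
        congr 1
        omega

end RegulatorBound

/-- **Regulator bound for maximal subfields** (Kleinian case).  Let `k` be a number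
field of degree `n_k` with exactly one complex place, and let `B = ℍ[k, a, b]` be a
quaternion algebra over `k` ramified at every real embedding of `k` (i.e. the real
quaternion algebra `ℍ[ℝ, σa, σb]` is a division ring for every real embedding `σ`).
If `L` is a quadratic extension of `k` admitting an injective `k`-algebra homomorphism
into `B`, then `Reg_L ≤ d_L^{n_k}`. -/
theorem regulator_le_of_embeds_in_quaternion_algebra
    (k : Type*) [Field k] [NumberField k]
    (hcomplex : NumberField.InfinitePlace.nrComplexPlaces k = 1)
    (a b : k) (ha : a ≠ 0) (hb : b ≠ 0)
    (hram : ∀ σ : k →+* ℝ, ∀ x : ℍ[ℝ, σ a, σ b], x ≠ 0 → IsUnit x)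
    (L : Type*) [Field L] [NumberField L] [Algebra k L]
    (hquad : Module.finrank k L = 2)
    (hembed : ∃ f : L →ₐ[k] ℍ[k, a, b], Function.Injective f) :
    NumberField.Units.regulator L ≤
      ((NumberField.discr L).natAbs : ℝ) ^ (Module.finrank ℚ k) := by
  have hcL : NumberField.InfinitePlace.nrComplexPlaces L ≠ 0 := fun h ↦ by
    have := nrComplexPlaces_eq_zero_iff.mp h
    have := IsTotallyReal.of_algebra k L
    simp at hcomplex
  refine RegulatorBound.regulator_le_abs_discr_pow L hcL ?_
  rw [← Module.finrank_mul_finrank ℚ k L, hquad, mul_comm]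
end

section
/- Let k be a totally real number field of degree n_k, let a, b \in k^{\times}, and let B = \mathbb{H}[k, a, b] be a quaternion algebra over k that is ramified at all but one real embedding of k, meaning there is exactly one real embedding \sigma_0 of k for which \mathbb{H}[\mathbb{R}, \sigma_0(a), \sigma_0(b)] is not a division ring, while \mathbb{H}[\mathbb{R}, \sigma(a), \sigma(b)] is a division ring for every other real embedding \sigma. Let L be a quadratic extension of k that admits an injective k-algebra homomorphism L \to B and that is not totally complex (i.e., L has at least one real embedding). Then the regulator of L satisfies Reg_L \le d_L^{n_k}. -/
open NumberField
open scoped Quaternion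

section

open MeasureTheory

/-- Exponential bound for the volume of an open corner simplex. -/
theorem volume_cornerSimplex_le {ι : Type*} [Fintype ι] (c : ι → ℝ) (C : ℝ) :
    volume {y : ι → ℝ | (∀ i, c i < y i) ∧ ∑ i, y i < C} ≤
      ENNReal.ofReal ((1 / 2) ^ Fintype.card ι * Real.exp (2 * (C - ∑ i, c i))) := by
  set φ : ι → ℝ → ℝ := fun i ↦ (Set.Ioi (c i)).indicator fun x ↦ Real.exp (-2 * x) with hφ
  have hφ0 (i x) : 0 ≤ φ i x := Set.indicator_nonneg (fun _ _ ↦ (Real.exp_pos _).le) x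
  have hφint (i) : Integrable (φ i) := by
    rw [hφ, integrable_indicator_iff measurableSet_Ioi]
    exact integrableOn_exp_mul_Ioi (by norm_num) _
  have hint : Integrable fun y : ι → ℝ ↦ Real.exp (2 * C) * ∏ i, φ i (y i) :=
    (Integrable.fintype_prod hφint).const_mul _
  have hval : ∫ y : ι → ℝ, Real.exp (2 * C) * ∏ i, φ i (y i) =
      (1 / 2) ^ Fintype.card ι * Real.exp (2 * (C - ∑ i, c i)) := by
    have h1 (i) : ∫ x, φ i x = 1 / 2 * Real.exp (-2 * c i) := by
      rw [hφ, integral_indicator measurableSet_Ioi, integral_exp_mul_Ioi (by norm_num)]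
      ring
    rw [integral_const_mul, integral_fintype_prod_volume_eq_prod, Finset.prod_congr rfl
      fun i _ ↦ h1 i, Finset.prod_mul_distrib, Finset.prod_const, ← Real.exp_sum,
      ← Finset.mul_sum, Finset.card_univ, mul_left_comm, ← Real.exp_add]
    ring_nf
  rw [← hval, ofReal_integral_eq_lintegral_ofReal hint
    (.of_forall fun y ↦ mul_nonneg (Real.exp_pos _).le (Finset.prod_nonneg fun i _ ↦ hφ0 i _))]
  refine le_trans (measure_mono fun y hy ↦ ?_) ((one_mul _).symm.le.trans
    (mul_meas_ge_le_lintegral₀ hint.aemeasurable.ennreal_ofReal 1))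
  have : ∏ i, φ i (y i) = Real.exp (-2 * ∑ i, y i) := by
    rw [Finset.mul_sum, Real.exp_sum]
    exact Finset.prod_congr rfl fun i _ ↦ Set.indicator_of_mem (hy.1 i) _
  rw [Set.mem_ofPred_eq, this, ← Real.exp_add, ← ENNReal.ofReal_one]
  exact ENNReal.ofReal_le_ofReal (Real.one_le_exp (by linarith [hy.2]))

/-- In dimension one the exponential bound for the simplex improves by a factor `e`. -/
theorem volume_cornerSimplex_le_of_unique {ι : Type*} [Fintype ι] (hι : Fintype.card ι = 1)
    (c : ι → ℝ) (C : ℝ) :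
    volume {y : ι → ℝ | (∀ i, c i < y i) ∧ ∑ i, y i < C} ≤
      ENNReal.ofReal (1 / (2 * Real.exp 1) * Real.exp (2 * (C - ∑ i, c i))) := by
  obtain ⟨i₀, h⟩ := Fintype.card_eq_one_iff.mp hι
  have : Unique ι := ⟨⟨i₀⟩, h⟩
  refine le_trans (measure_mono (t := Set.Icc c fun _ ↦ C) fun y hy ↦ ?_) ?_
  · refine ⟨fun i ↦ (hy.1 i).le, fun i ↦ ?_⟩
    have := hy.2
    rw [Fintype.sum_unique, ← Subsingleton.elim i default] at this
    exact this.le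
  · rw [Real.volume_Icc_pi, Fintype.prod_unique, Fintype.sum_unique]
    refine ENNReal.ofReal_le_ofReal ?_
    set t := C - c default
    have h1 := Real.add_one_le_exp (2 * t - 1)
    rw [Real.exp_sub] at h1
    calc t = (2 * t - 1 + 1) / 2 := by ring
      _ ≤ Real.exp (2 * t) / Real.exp 1 / 2 := by gcongr
      _ = _ := by field_simp

/-- If the translates of a set by a lattice cover the space, its measure is at least the
covolume of the lattice. -/
theorem ZLattice.ofReal_covolume_le_of_forall_exists_sub_mem {E : Type*} [NormedAddCommGroup E]
    [NormedSpace ℝ E] [FiniteDimensional ℝ E] [MeasurableSpace E] [BorelSpace E]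
    (Λ : Submodule ℤ E) [DiscreteTopology Λ] [IsZLattice ℝ Λ] (μ : Measure E)
    [μ.IsAddHaarMeasure] (A : Set E) (hA : ∀ x, ∃ v ∈ Λ, x - v ∈ A) :
    ENNReal.ofReal (ZLattice.covolume Λ μ) ≤ μ A := by
  let b := Module.Free.chooseBasis ℤ Λ
  have hF := ZLattice.isAddFundamentalDomain b μ
  set F := ZSpan.fundamentalDomain (b.ofZLatticeBasis ℝ)
  have : MeasurableVAdd Λ E := (inferInstance : MeasurableVAdd Λ.toAddSubgroup E)
  have : VAddInvariantMeasure Λ E μ :=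
    (inferInstance : VAddInvariantMeasure Λ.toAddSubgroup E μ)
  have hfin : μ F ≠ ⊤ := (ZSpan.fundamentalDomain_isBounded _).measure_lt_top.ne
  rw [ZLattice.covolume_eq_measure_fundamentalDomain Λ μ hF, ofReal_measureReal hfin,
    hF.measure_eq_tsum A]
  refine (measure_mono fun x hx ↦ ?_).trans (measure_iUnion_le _)
  obtain ⟨v, hv, hxv⟩ := hA x
  exact Set.mem_iUnion.mpr ⟨⟨v, hv⟩, ⟨x - v, hxv, by simp [Submodule.vadd_def]⟩, hx⟩

open Ideal UniqueFactorizationMonoid in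
/-- The nonzero primes of a number field of degree `n` can be labelled by `Fin n` so that primes
over the same rational prime receive distinct labels. -/
theorem exists_label_primes (K : Type*) [Field K] [NumberField K] :
    ∃ idx : Ideal (𝓞 K) → Fin (Module.finrank ℚ K), ∀ i,
      Set.InjOn (fun P : Ideal (𝓞 K) ↦ absNorm (under ℤ P)) {P | Prime P ∧ idx P = i} := by
  have key (p : Ideal ℤ) : ∃ g : Ideal (𝓞 K) → Fin (Module.finrank ℚ K),
      p.IsMaximal → p ≠ ⊥ → Set.InjOn g (p.primesOver (𝓞 K)) := by
    by_cases hp : p.IsMaximal ∧ p ≠ ⊥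
    swap
    · exact ⟨fun _ ↦ ⟨0, Module.finrank_pos⟩, fun h h' ↦ (hp ⟨h, h'⟩).elim⟩
    obtain ⟨hpm, hp0⟩ := hp
    have := Fintype.ofFinite (p.primesOver (𝓞 K))
    have hcard : Fintype.card (p.primesOver (𝓞 K)) ≤
        Fintype.card (Fin (Module.finrank ℚ K)) := by
      rw [Fintype.card_fin, ← RingOfIntegers.rank, ← sum_ramification_inertia_eq_finrank p,
        ← Finset.card_univ, Finset.card_eq_sum_ones]
      exact Finset.sum_le_sum fun q _ ↦
        have := q.2.1
        Right.one_le_mul (ramificationIdx_pos _ _) (inertiaDeg_pos _ _)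
    obtain ⟨f⟩ := Function.Embedding.nonempty_of_card_le hcard
    refine ⟨Function.extend Subtype.val f fun _ ↦ ⟨0, Module.finrank_pos⟩,
      fun _ _ P hP Q hQ hPQ ↦ ?_⟩
    have hval (R : p.primesOver (𝓞 K)) := Subtype.val_injective.extend_apply f
      (fun _ ↦ ⟨0, Module.finrank_pos⟩) R
    rw [hval ⟨P, hP⟩, hval ⟨Q, hQ⟩] at hPQ
    exact congr_arg Subtype.val (f.injective hPQ)
  choose g hg using key
  refine ⟨fun P ↦ g (under ℤ P) P, fun i P hP Q hQ hPQ ↦ ?_⟩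
  have hPp := isPrime_of_prime hP.1
  have hQp := isPrime_of_prime hQ.1
  have hu : under ℤ P = under ℤ Q := by
    rw [← Int.ideal_span_absNorm_eq_self (under ℤ P), ← Int.ideal_span_absNorm_eq_self (under ℤ Q)]
    exact congr_arg (fun m : ℕ ↦ span {(m : ℤ)}) hPQ
  have hPb : under ℤ P ≠ ⊥ := fun h ↦ hP.1.ne_zero (eq_bot_of_comap_eq_bot h)
  have hPm : (under ℤ P).IsMaximal := IsPrime.isMaximal inferInstance hPb
  refine hg _ hPm hPb ⟨hPp, ⟨rfl⟩⟩ ⟨hQp, ⟨hu⟩⟩ ?_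
  have : g (under ℤ P) P = g (under ℤ Q) Q := hP.2.trans hQ.2.symm
  rwa [← hu] at this

open Ideal UniqueFactorizationMonoid in
/-- Nonzero ideals inject into tuples of natural numbers with product at most the norm. -/
theorem exists_injOn_tuple_prod_le_absNorm (K : Type*) [Field K] [NumberField K] :
    ∃ a : Ideal (𝓞 K) → Fin (Module.finrank ℚ K) → ℕ, Set.InjOn a {I | I ≠ ⊥} ∧
      ∀ I ≠ ⊥, (∀ i, 0 < a I i) ∧ ∏ i, a I i ≤ absNorm I := by
  classical
  obtain ⟨idx, hidx⟩ := exists_label_primes K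
  let q (P : Ideal (𝓞 K)) : ℕ := absNorm (under ℤ P)
  have hq {P : Ideal (𝓞 K)} (hP : Prime P) : (q P).Prime := by
    have := isPrime_of_prime hP
    have : NeZero P := ⟨hP.ne_zero⟩
    exact Nat.absNorm_under_prime P
  let F (I : Ideal (𝓞 K)) (i) := (normalizedFactors I).filter (idx · = i)
  have hF {I : Ideal (𝓞 K)} {i P} (hP : P ∈ F I i) : Prime P ∧ idx P = i :=
    ⟨prime_of_normalized_factor _ (Multiset.mem_of_mem_filter hP), (Multiset.mem_filter.mp hP).2⟩
  refine ⟨fun I i ↦ ((F I i).map q).prod, fun I hI J hJ hIJ ↦ ?_, fun I hI ↦ ⟨fun i ↦ ?_, ?_⟩⟩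
  · have hmap (i) : (F I i).map q = (F J i).map q := by
      have hprime (I' : Ideal (𝓞 K)) : ∀ p ∈ (F I' i).map q, Prime p := by
        intro p hp
        obtain ⟨P, hP, rfl⟩ := Multiset.mem_map.mp hp
        exact (hq (hF hP).1).prime
      rw [← normalizedFactors_prod_of_prime (hprime I), ← normalizedFactors_prod_of_prime (hprime J)]
      exact congr_arg _ (congr_fun hIJ i)
    have hFF (i) : F I i = F J i := by
      have hinv (I' : Ideal (𝓞 K)) :
          ((F I' i).map q).map (Function.invFunOn q {P | Prime P ∧ idx P = i}) = F I' i := by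
        rw [Multiset.map_map]
        exact (Multiset.map_congr rfl fun P hP ↦
          (hidx i).leftInvOn_invFunOn (hF hP)).trans (Multiset.map_id _)
      rw [← hinv I, ← hinv J, hmap]
    have : normalizedFactors I = normalizedFactors J := by
      ext P
      rw [← Multiset.count_filter_of_pos (p := (idx · = idx P)) rfl,
        ← Multiset.count_filter_of_pos (p := (idx · = idx P)) (s := normalizedFactors J) rfl]
      exact congr_arg _ (hFF (idx P))
    rw [← Ideal.prod_normalizedFactors_eq_self hI, this, Ideal.prod_normalizedFactors_eq_self hJ]
  · refine Nat.pos_of_ne_zero (Multiset.prod_ne_zero fun h ↦ ?_)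
    obtain ⟨P, hP, h0⟩ := Multiset.mem_map.mp h
    exact (hq (hF hP).1).ne_zero h0
  · have hprod (m : Multiset (Ideal (𝓞 K))) :
        ∏ i, ((m.filter (idx · = i)).map q).prod = (m.map q).prod := by
      induction m using Multiset.induction with
      | empty => simp
      | cons P m ih =>
        rw [Multiset.map_cons, Multiset.prod_cons, ← ih]
        rw [show q P = ∏ i, if idx P = i then q P else 1 by simp, ← Finset.prod_mul_distrib]
        refine Finset.prod_congr rfl fun i _ ↦ ?_
        rw [Multiset.filter_cons]
        split_ifs <;> simp
    have hdvd : ((normalizedFactors I).map q).prod ∣ absNorm I := by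
      conv_rhs => rw [← Ideal.prod_normalizedFactors_eq_self hI, map_multiset_prod]
      exact Multiset.prod_dvd_prod_of_dvd _ _ fun P _ ↦ Int.absNorm_under_dvd_absNorm P
    rw [hprod]
    exact Nat.le_of_dvd (Nat.pos_of_ne_zero (absNorm_eq_zero_iff.not.mpr hI)) hdvd

/-- The partial sums of the Dedekind zeta function at `2` are at most `ζ(2) ^ [K : ℚ]`. -/
theorem sum_inv_absNorm_sq_le (K : Type*) [Field K] [NumberField K] (S : Finset (Ideal (𝓞 K)))
    (hS : ⊥ ∉ S) :
    ∑ I ∈ S, 1 / (Ideal.absNorm I : ℝ) ^ 2 ≤ (Real.pi ^ 2 / 6) ^ Module.finrank ℚ K := by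
  classical
  obtain ⟨a, hinj, ha⟩ := exists_injOn_tuple_prod_le_absNorm K
  have hS' {I} (hI : I ∈ S) : I ≠ ⊥ := fun h ↦ hS (h ▸ hI)
  calc
    _ ≤ ∑ I ∈ S, ∏ i, 1 / (a I i : ℝ) ^ 2 := by
      refine Finset.sum_le_sum fun I hI ↦ ?_
      obtain ⟨hpos, hle⟩ := ha I (hS' hI)
      simp only [one_div]
      rw [Finset.prod_inv_distrib, Finset.prod_pow]
      have : 0 < ∏ i, (a I i : ℝ) := Finset.prod_pos fun i _ ↦ by exact_mod_cast hpos i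
      gcongr
      exact_mod_cast hle
    _ = ∑ f ∈ S.image a, ∏ i, 1 / (f i : ℝ) ^ 2 :=
      (Finset.sum_image (f := fun f : Fin (Module.finrank ℚ K) → ℕ ↦ ∏ i, 1 / (f i : ℝ) ^ 2)
        fun I hI J hJ h ↦ hinj (hS' hI) (hS' hJ) h).symm
    _ ≤ ∑ f ∈ Fintype.piFinset fun i ↦ S.image (a · i), ∏ i, 1 / (f i : ℝ) ^ 2 := by
      refine Finset.sum_le_sum_of_subset_of_nonneg (fun f hf ↦ ?_) fun f _ _ ↦ by positivity
      obtain ⟨I, hI, rfl⟩ := Finset.mem_image.mp hf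
      exact Fintype.mem_piFinset.mpr fun i ↦ Finset.mem_image_of_mem (a · i) hI
    _ = ∏ i, ∑ m ∈ S.image (a · i), 1 / (m : ℝ) ^ 2 :=
      (Finset.prod_univ_sum _ fun _ (m : ℕ) ↦ 1 / (m : ℝ) ^ 2).symm
    _ ≤ ∏ _i : Fin (Module.finrank ℚ K), Real.pi ^ 2 / 6 :=
      Finset.prod_le_prod (fun _ _ ↦ by positivity) fun _ _ ↦
        sum_le_hasSum _ (fun _ _ ↦ by positivity) hasSum_zeta_two
    _ = _ := by rw [Finset.prod_const, Finset.card_univ, Fintype.card_fin]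

open NumberField.InfinitePlace NumberField.mixedEmbedding in
/-- Minkowski's convex body theorem for boxes, in terms of the discriminant. -/
theorem exists_ne_zero_forall_infinitePlace_lt (K : Type*) [Field K] [NumberField K]
    (f : InfinitePlace K → ℝ) (hf : ∀ w, 0 < f w)
    (h : (2 / Real.pi) ^ nrComplexPlaces K * √|(discr K : ℝ)| < ∏ w, f w ^ mult w) :
    ∃ a : 𝓞 K, a ≠ 0 ∧ ∀ w : InfinitePlace K, w a < f w := by
  classical
  lift f to InfinitePlace K → NNReal using fun w ↦ (hf w).le
  refine exists_ne_zero_mem_ringOfIntegers_lt K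
    ((ENNReal.toReal_lt_toReal (minkowskiBound_lt_top K 1).ne ?_).mp ?_)
  · rw [convexBodyLT_volume, ← ENNReal.coe_mul]
    exact ENNReal.coe_ne_top
  · rw [convexBodyLT_volume, minkowskiBound, volume_fundamentalDomain_fractionalIdealLatticeBasis,
      volume_fundamentalDomain_latticeBasis, mixedEmbedding.finrank,
      ← card_add_two_mul_card_eq_rank]
    simp only [Units.val_one, FractionalIdeal.absNorm_one, Rat.cast_one, ENNReal.ofReal_one,
      one_mul, ENNReal.toReal_mul, ENNReal.toReal_pow, ENNReal.toReal_inv, ENNReal.toReal_ofNat,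
      ENNReal.coe_toReal, NNReal.coe_mul, NNReal.coe_pow, NNReal.coe_prod, NNReal.coe_ofNat,
      NNReal.coe_real_pi, Real.coe_sqrt, coe_nnnorm, Int.norm_eq_abs]
    calc
      _ = 2 ^ nrRealPlaces K * Real.pi ^ nrComplexPlaces K *
          ((2 / Real.pi) ^ nrComplexPlaces K * √|(discr K : ℝ)|) := by
        rw [div_pow, inv_pow, pow_add, pow_mul', sq]
        field_simp
      _ < _ := by gcongr

/-- The logarithmic form of the infinite part of the product formula. -/
theorem sum_mult_mul_log_eq_log_absNorm {K : Type*} [Field K] [NumberField K] {a : 𝓞 K}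
    (ha : a ≠ 0) :
    ∑ w : InfinitePlace K, (w.mult : ℝ) * Real.log (w a) =
      Real.log (Ideal.absNorm (Ideal.span {a})) := by
  have hpos (w : InfinitePlace K) : w a ≠ 0 :=
    (map_ne_zero w).mpr (RingOfIntegers.coe_ne_zero_iff.mpr ha)
  simp_rw [← Real.log_pow]
  rw [← Real.log_prod fun w _ ↦ pow_ne_zero _ (hpos w), InfinitePlace.prod_eq_abs_norm,
    ← Algebra.coe_norm_int, Ideal.absNorm_span_singleton, Nat.cast_natAbs]
  norm_cast

open NumberField.InfinitePlace NumberField.Units NumberField.Units.dirichletUnitTheorem in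
open scoped Classical in
/-- A bound for the volume of corner simplices in dimension the unit rank gives a bound for the
regulator. -/
theorem regulator_le_of_volume_cornerSimplex_le (K : Type*) [Field K] [NumberField K] {κ : ℝ}
    (hκ0 : 0 ≤ κ)
    (hκ : ∀ (c : {w : InfinitePlace K // w ≠ w₀} → ℝ) (C : ℝ),
      volume {y : {w : InfinitePlace K // w ≠ w₀} → ℝ | (∀ i, c i < y i) ∧ ∑ i, y i < C} ≤
        ENNReal.ofReal (κ * Real.exp (2 * (C - ∑ i, c i))))
    {X : ℝ} (hX : (2 / Real.pi) ^ nrComplexPlaces K * √|(discr K : ℝ)| < X) :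
    regulator K ≤ κ * X ^ 2 * (Real.pi ^ 2 / 6) ^ Module.finrank ℚ K := by
  have hX0 : 0 < X := lt_of_le_of_lt (by positivity) hX
  let ℓ (a : 𝓞 K) (w : InfinitePlace K) : ℝ := mult w * Real.log (w a)
  have hℓ {a : 𝓞 K} (ha : a ≠ 0) : ℓ a w₀ + ∑ w : {w : InfinitePlace K // w ≠ w₀}, ℓ a w =
      Real.log (Ideal.absNorm (Ideal.span {a})) := by
    rw [← sum_mult_mul_log_eq_log_absNorm ha, Fintype.sum_eq_add_sum_subtype_ne _ w₀]
  have hgen (I : Ideal (𝓞 K)) : ∃ g, (∃ a, I = Ideal.span {a}) → I = Ideal.span {g} := by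
    by_cases h : ∃ a, I = Ideal.span {a}
    · exact ⟨h.choose, fun _ ↦ h.choose_spec⟩
    · exact ⟨0, fun h' ↦ (h h').elim⟩
  choose g hg using hgen
  have hSfin :
      {I : Ideal (𝓞 K) | Ideal.absNorm I ≤ ⌊X⌋₊ ∧ I ≠ ⊥ ∧ ∃ a, I = Ideal.span {a}}.Finite :=
    (Ideal.finite_setOfPred_absNorm_le ⌊X⌋₊).subset fun I hI ↦ hI.1
  let S := hSfin.toFinset
  let A (I : Ideal (𝓞 K)) : Set ({w : InfinitePlace K // w ≠ w₀} → ℝ) :=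
    {y | (∀ i : {w : InfinitePlace K // w ≠ w₀}, ℓ (g I) i < y i) ∧
      ∑ i, y i < Real.log X - ℓ (g I) w₀}
  have hgS {I} (hI : I ∈ S) : I = Ideal.span {g I} ∧ g I ≠ 0 := by
    obtain ⟨-, h0, ha⟩ := hSfin.mem_toFinset.mp hI
    have := hg I ha
    refine ⟨this, fun h ↦ h0 ?_⟩
    rw [this, h]
    simp
  have hvol {I} (hI : I ∈ S) :
      volume (A I) ≤ ENNReal.ofReal (κ * X ^ 2 * (1 / (Ideal.absNorm I : ℝ) ^ 2)) := by
    obtain ⟨h1, h2⟩ := hgS hI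
    have hN : 0 < (Ideal.absNorm I : ℝ) := by
      have := (hSfin.mem_toFinset.mp hI).2.1
      exact_mod_cast Nat.pos_of_ne_zero (Ideal.absNorm_eq_zero_iff.not.mpr this)
    refine (hκ (fun i ↦ ℓ (g I) i) (Real.log X - ℓ (g I) w₀)).trans_eq ?_
    rw [sub_sub, hℓ h2, ← h1, ← Real.log_div hX0.ne' hN.ne', mul_comm 2, Real.exp_mul,
      Real.exp_log (by positivity), Real.rpow_ofNat, div_pow]
    ring_nf
  have hcover (x : logSpace K) : ∃ v ∈ unitLattice K, x - v ∈ ⋃ I ∈ S, A I := by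
    let y (w : InfinitePlace K) : ℝ := if h : w = w₀ then Real.log X - ∑ i, x i else x ⟨w, h⟩
    have hy₀ : y w₀ = Real.log X - ∑ i, x i := dif_pos rfl
    have hyx (i : {w : InfinitePlace K // w ≠ w₀}) : y i = x i := dif_neg i.2
    have hysum : ∑ w, y w = Real.log X := by
      rw [Fintype.sum_eq_add_sum_subtype_ne _ w₀, Finset.sum_congr rfl fun i _ ↦ hyx i, hy₀,
        sub_add_cancel]
    obtain ⟨a, ha, hlt⟩ := exists_ne_zero_forall_infinitePlace_lt K
      (fun w ↦ Real.exp (y w / mult w)) (fun w ↦ Real.exp_pos _) (by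
        refine hX.trans_eq ?_
        simp_rw [← Real.exp_nat_mul]
        rw [← Real.exp_sum, Finset.sum_congr rfl fun w _ ↦ mul_div_cancel₀ (y w) mult_coe_ne_zero,
          hysum, Real.exp_log hX0])
    have hlog (w : InfinitePlace K) : ℓ a w < y w := by
      have hpos : 0 < w a := pos_iff.mpr (RingOfIntegers.coe_ne_zero_iff.mpr ha)
      have := (Real.log_lt_iff_lt_exp hpos).mpr (hlt w)
      rwa [lt_div_iff₀' (by exact_mod_cast mult_pos)] at this
    set I := Ideal.span {a}
    have hI0 : I ≠ ⊥ := by simpa [I] using ha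
    have hIS : I ∈ S := by
      refine hSfin.mem_toFinset.mpr ⟨Nat.le_floor ?_, hI0, a, rfl⟩
      have hN : 0 < (Ideal.absNorm I : ℝ) := by
        exact_mod_cast Nat.pos_of_ne_zero (Ideal.absNorm_eq_zero_iff.not.mpr hI0)
      rw [← Real.log_le_log_iff hN hX0, ← sum_mult_mul_log_eq_log_absNorm ha, ← hysum]
      exact Finset.sum_le_sum fun w _ ↦ (hlog w).le
    obtain ⟨h1, h2⟩ := hgS hIS
    obtain ⟨u, hu⟩ := (Ideal.span_singleton_eq_span_singleton.mp h1).symm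
    have hℓu (w : InfinitePlace K) : ℓ a w = ℓ (g I) w + mult w * Real.log (w (u : K)) := by
      have hgpos : w (g I) ≠ 0 := (map_ne_zero w).mpr (RingOfIntegers.coe_ne_zero_iff.mpr h2)
      have hupos : w (u : K) ≠ 0 := (map_ne_zero w).mpr (coe_ne_zero u)
      simp only [ℓ]
      rw [← hu, show ((g I * u : 𝓞 K) : K) = (g I : K) * (u : K) from map_mul _ _ _, map_mul w,
        Real.log_mul hgpos hupos, mul_add]
    refine ⟨logEmbedding K (Additive.ofMul u), ⟨Additive.ofMul u, trivial, rfl⟩,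
      Set.mem_biUnion hIS ⟨fun i ↦ ?_, ?_⟩⟩
    · have h3 := hlog i
      rw [hℓu, hyx] at h3
      rw [Pi.sub_apply, logEmbedding_component]
      linarith
    · have h3 := hlog w₀
      rw [hℓu, hy₀] at h3
      simp only [Pi.sub_apply, Finset.sum_sub_distrib]
      rw [sum_logEmbedding_component]
      linarith
  have hbot : ⊥ ∉ S := fun h ↦ (hSfin.mem_toFinset.mp h).2.1 rfl
  refine le_trans ?_ (mul_le_mul_of_nonneg_left (sum_inv_absNorm_sq_le K S hbot) (by positivity))
  rw [← ENNReal.ofReal_le_ofReal_iff (by positivity), Finset.mul_sum,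
    ENNReal.ofReal_sum_of_nonneg fun I _ ↦ by positivity]
  exact ((ZLattice.ofReal_covolume_le_of_forall_exists_sub_mem (unitLattice K) volume _
    hcover).trans (measure_biUnion_finset_le S A)).trans (Finset.sum_le_sum fun I hI ↦ hvol hI)


open NumberField.InfinitePlace NumberField.Units NumberField.Units.dirichletUnitTheorem in
/-- The regulator of a number field of degree at least `4` is at most the absolute value of its
discriminant. -/
theorem regulator_le_abs_discr_of_four_le_finrank (K : Type*) [Field K] [NumberField K]
    (hn : 4 ≤ Module.finrank ℚ K) : regulator K ≤ |(discr K : ℝ)| := by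
  classical
  have hd : 0 < |(discr K : ℝ)| := abs_pos.mpr (by exact_mod_cast discr_ne_zero K)
  have hX : (2 / Real.pi) ^ nrComplexPlaces K * √|(discr K : ℝ)| <
      1.01 * ((2 / Real.pi) ^ nrComplexPlaces K * √|(discr K : ℝ)|) := by
    have : 0 < (2 / Real.pi) ^ nrComplexPlaces K * √|(discr K : ℝ)| := by positivity
    linarith
  have h := regulator_le_of_volume_cornerSimplex_le K (by positivity)
    (fun c C ↦ volume_cornerSimplex_le c C) hX
  have hcard : Fintype.card {w : InfinitePlace K // w ≠ w₀} + 1 =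
      nrRealPlaces K + nrComplexPlaces K := by
    rw [← card_eq_nrRealPlaces_add_nrComplexPlaces, Fintype.card_subtype_compl,
      Fintype.card_subtype_eq]
    exact Nat.sub_add_cancel Fintype.card_pos
  have hrank := card_add_two_mul_card_eq_rank K
  have hhalf : (1 / 2 : ℝ) ^ Fintype.card {w : InfinitePlace K // w ≠ w₀} =
      2 * ((1 / 2) ^ nrRealPlaces K * (1 / 2) ^ nrComplexPlaces K) := by
    rw [← pow_add, ← hcard, pow_succ]
    ring
  have hpi := Real.pi_pos
  have hpi2 : Real.pi ^ 2 ≤ 9.87 := by nlinarith [Real.pi_lt_d4]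
  calc
    _ ≤ _ := h
    _ = 2.0402 * (Real.pi ^ 2 / 12) ^ nrRealPlaces K * (Real.pi ^ 2 / 18) ^ nrComplexPlaces K *
        |(discr K : ℝ)| := by
      rw [hhalf, ← hrank, mul_pow, mul_pow, Real.sq_sqrt hd.le, pow_add, pow_mul, ← pow_mul,
        mul_comm (nrComplexPlaces K) 2, pow_mul]
      have h1 : (Real.pi ^ 2 / 12) ^ nrRealPlaces K =
          (1 / 2) ^ nrRealPlaces K * (Real.pi ^ 2 / 6) ^ nrRealPlaces K := by
        rw [← mul_pow]; ring_nf
      have h2 : (Real.pi ^ 2 / 18) ^ nrComplexPlaces K = (1 / 2) ^ nrComplexPlaces K *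
          ((2 / Real.pi) ^ 2) ^ nrComplexPlaces K *
          ((Real.pi ^ 2 / 6) ^ 2) ^ nrComplexPlaces K := by
        rw [← mul_pow, ← mul_pow]
        congr 1
        field_simp
        norm_num
      rw [h1, h2]
      ring
    _ ≤ 2.0402 * 0.823 ^ nrRealPlaces K * (0.823 ^ 2) ^ nrComplexPlaces K *
        |(discr K : ℝ)| := by
      gcongr
      · linarith
      · linarith
    _ = 2.0402 * 0.823 ^ Module.finrank ℚ K * |(discr K : ℝ)| := by
      rw [← pow_mul, mul_assoc 2.0402, ← pow_add, hrank]
    _ ≤ 2.0402 * 0.823 ^ 4 * |(discr K : ℝ)| := by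
      gcongr ?_ * _
      exact mul_le_mul_of_nonneg_left
        (pow_le_pow_of_le_one (by norm_num) (by norm_num) hn) (by norm_num)
    _ ≤ _ := mul_le_of_le_one_left hd.le (by norm_num)

open NumberField.InfinitePlace NumberField.Units NumberField.Units.dirichletUnitTheorem in
/-- The regulator of a real quadratic field is at most its discriminant. -/
theorem regulator_le_abs_discr_of_finrank_eq_two (K : Type*) [Field K] [NumberField K]
    (hn : Module.finrank ℚ K = 2) (hreal : nrRealPlaces K ≠ 0) :
    regulator K ≤ |(discr K : ℝ)| := by
  classical
  have hd : 0 < |(discr K : ℝ)| := abs_pos.mpr (by exact_mod_cast discr_ne_zero K)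
  have hrank := card_add_two_mul_card_eq_rank K
  have hc : nrComplexPlaces K = 0 := by omega
  have hcard : Fintype.card {w : InfinitePlace K // w ≠ w₀} = 1 := by
    rw [Fintype.card_subtype_compl, Fintype.card_subtype_eq,
      card_eq_nrRealPlaces_add_nrComplexPlaces]
    omega
  have hX : (2 / Real.pi) ^ nrComplexPlaces K * √|(discr K : ℝ)| <
      1.01 * √|(discr K : ℝ)| := by
    have : 0 < √|(discr K : ℝ)| := by positivity
    rw [hc]
    linarith
  have h := regulator_le_of_volume_cornerSimplex_le K (by positivity)
    (fun c C ↦ volume_cornerSimplex_le_of_unique hcard c C) hX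
  have hpi2 : Real.pi ^ 2 ≤ 9.87 := by nlinarith [Real.pi_pos, Real.pi_lt_d4]
  rw [hn, mul_pow, Real.sq_sqrt hd.le] at h
  calc
    _ ≤ _ := h
    _ ≤ 1 / (2 * 2.7) * (1.01 ^ 2 * |(discr K : ℝ)|) * (9.87 / 6) ^ 2 := by
      gcongr
      linarith [Real.exp_one_gt_d9]
    _ ≤ _ := by linarith

end

/-- **Regulator bound for maximal subfields** (Fuchsian case).  Let `k` be a totally
real number field of degree `n_k` and let `B = ℍ[k, a, b]` be a quaternion algebra over
`k` ramified at all but one real embedding of `k`: there is exactly one real embedding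
`σ₀` for which `ℍ[ℝ, σ₀a, σ₀b]` is not a division ring, while it is a division ring for
every other real embedding.  If `L` is a quadratic extension of `k` which admits an
injective `k`-algebra homomorphism into `B` and is not totally complex (it has a real
embedding), then `Reg_L ≤ d_L^{n_k}`. -/
theorem regulator_le_of_embeds_in_quaternion_algebra_totallyReal
    (k : Type*) [Field k] [NumberField k]
    (htr : ∀ v : NumberField.InfinitePlace k, v.IsReal)
    (a b : k) (ha : a ≠ 0) (hb : b ≠ 0)
    (hram : ∃ σ₀ : k →+* ℝ,
      (¬ ∀ x : ℍ[ℝ, σ₀ a, σ₀ b], x ≠ 0 → IsUnit x) ∧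
      ∀ σ : k →+* ℝ, σ ≠ σ₀ → ∀ x : ℍ[ℝ, σ a, σ b], x ≠ 0 → IsUnit x)
    (L : Type*) [Field L] [NumberField L] [Algebra k L]
    (hquad : Module.finrank k L = 2)
    (hembed : ∃ f : L →ₐ[k] ℍ[k, a, b], Function.Injective f)
    (hreal : Nonempty (L →+* ℝ)) :
    NumberField.Units.regulator L ≤
      ((NumberField.discr L).natAbs : ℝ) ^ (Module.finrank ℚ k) := by
  have htower : 2 * Module.finrank ℚ k = Module.finrank ℚ L := by
    rw [mul_comm, ← hquad, Module.finrank_mul_finrank ℚ k L]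
  have hpos : 0 < Module.finrank ℚ k := Module.finrank_pos
  have hreal' : NumberField.InfinitePlace.nrRealPlaces L ≠ 0 := by
    obtain ⟨σ⟩ := hreal
    have hw : (InfinitePlace.mk (Complex.ofRealHom.comp σ)).IsReal :=
      ⟨_, RingHom.ext fun x ↦ Complex.conj_ofReal (σ x), rfl⟩
    have : Nonempty {w : InfinitePlace L // w.IsReal} := ⟨⟨_, hw⟩⟩
    classical exact Fintype.card_ne_zero
  have hd : (1 : ℝ) ≤ (discr L).natAbs := by
    exact_mod_cast Int.natAbs_pos.mpr (discr_ne_zero L)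
  have hreg : Units.regulator L ≤ (discr L).natAbs := by
    rw [Nat.cast_natAbs, Int.cast_abs]
    obtain h | h : Module.finrank ℚ k = 1 ∨ 2 ≤ Module.finrank ℚ k := by omega
    · exact regulator_le_abs_discr_of_finrank_eq_two L (by omega) hreal'
    · exact regulator_le_abs_discr_of_four_le_finrank L (by omega)
  exact hreg.trans (le_self_pow₀ hd hpos.ne')
end
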